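/- arXiv:1007.3028 — 2 statements merged into one kernel-verified Lean document; each statement's English description precedes it below -/
import Mathlib

section
/- The lattice T = U ⊕ E8(2) ⊕ [−4] of rank 11 admits a primitive embedding ι into the K3 lattice L = 2E8 ⊕ 3U, and for every such primitive embedding the orthogonal complement {y ∈ ℤ^22 : B_{G_L}(y, ι(x)) = 0 for all x ∈ ℤ^11} is isometric to U ⊕ E8(2) ⊕ [4]. -/
open Matrix

/-- Adjacency relation of the `E8` Dynkin diagram on vertices `0,…,7`:
a chain `0–1–2–3–4–5–6` with the extra vertex `7` attached to vertex `2`. -/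
def e8Adj (a b : ℕ) : Prop :=
  (a, b) ∈ [(0,1),(1,0),(1,2),(2,1),(2,3),(3,2),(3,4),(4,3),
            (4,5),(5,4),(5,6),(6,5),(2,7),(7,2)]

instance (a b : ℕ) : Decidable (e8Adj a b) := by unfold e8Adj; infer_instance

/-- The Cartan matrix of `E8` (entries indexed by natural numbers `0,…,7`). -/
def cartanE8 (a b : ℕ) : ℤ :=
  if a = b then 2 else if e8Adj a b then -1 else 0

/-- The bilinear form associated with an integral Gram matrix `G`. -/
def BG {k : ℕ} (G : Matrix (Fin k) (Fin k) ℤ) (x y : Fin k → ℤ) : ℤ :=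
  x ⬝ᵥ G.mulVec y

/-- The Gram matrix of the K3 lattice `L = 2E8 ⊕ 3U`: indices `0,…,7` and `8,…,15` carry two
copies of `−C` (the negative definite `E8` lattice), and indices `16,…,21` carry three
hyperbolic planes `U` on the pairs `(16,17)`, `(18,19)`, `(20,21)`. -/
def GramK3 : Matrix (Fin 22) (Fin 22) ℤ := Matrix.of fun i j =>
  if i.val < 8 then
    (if j.val < 8 then -(cartanE8 i.val j.val) else 0)
  else if i.val < 16 then
    (if 8 ≤ j.val ∧ j.val < 16 then -(cartanE8 (i.val - 8) (j.val - 8)) else 0)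
  else if j.val < 16 then 0
  else if i.val / 2 = j.val / 2 then (if i = j then 0 else 1)
  else 0

/-- The Gram matrix of `T = U ⊕ E8(2) ⊕ [−4]`: indices `0,1` span a hyperbolic plane `U`,
indices `2,…,9` carry `−2C` (the lattice `E8(2)`), and index `10` has square `−4`. -/
def GT : Matrix (Fin 11) (Fin 11) ℤ := Matrix.of fun i j =>
  if i.val < 2 then
    (if j.val < 2 then (if i = j then 0 else 1) else 0)
  else if i.val < 10 then
    (if 2 ≤ j.val ∧ j.val < 10 then -2 * cartanE8 (i.val - 2) (j.val - 2) else 0)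
  else
    (if j.val = 10 then -4 else 0)

/-- `ι` is a primitive embedding of the lattice with Gram matrix `GT` into the K3 lattice:
an injective isometric `ℤ`-linear map with torsion-free cokernel. -/
def IsPrimEmb (ι : (Fin 11 → ℤ) →ₗ[ℤ] (Fin 22 → ℤ)) : Prop :=
  Function.Injective ι ∧
  (∀ x y : Fin 11 → ℤ, BG GramK3 (ι x) (ι y) = BG GT x y) ∧
  (∀ y : Fin 22 → ℤ, ∀ k : ℤ, k ≠ 0 → k • y ∈ LinearMap.range ι → y ∈ LinearMap.range ι)

/-- The Gram matrix of `U ⊕ E8(2) ⊕ [4]`. -/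
def GComp : Matrix (Fin 11) (Fin 11) ℤ := Matrix.of fun i j =>
  if i.val < 2 then
    (if j.val < 2 then (if i = j then 0 else 1) else 0)
  else if i.val < 10 then
    (if 2 ≤ j.val ∧ j.val < 10 then -2 * cartanE8 (i.val - 2) (j.val - 2) else 0)
  else
    (if j.val = 10 then 4 else 0)

section
namespace K3

/-- `W` has an orthogonal basis indexed by `[a, b)` with norms `d i`. -/
def HasFrame {V : Type*} [AddCommGroup V] [Module ℚ V] (B : LinearMap.BilinForm ℚ V)
    (W : Submodule ℚ V) (d : ℕ → ℚ) (a b : ℕ) : Prop :=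
  ∃ w : ℕ → V,
    (∀ i ∈ Finset.Ico a b, ∀ j ∈ Finset.Ico a b, B (w i) (w j) = if i = j then d i else 0) ∧
    (∀ i ∈ Finset.Ico a b, w i ∈ W) ∧
    ∀ x ∈ W, ∃ c : ℕ → ℚ, x = ∑ i ∈ Finset.Ico a b, c i • w i

section frames
variable {V : Type*} [AddCommGroup V] [Module ℚ V] {B : LinearMap.BilinForm ℚ V}

theorem frame_coord {d : ℕ → ℚ} {a b : ℕ} {w : ℕ → V}
    (hw : ∀ i ∈ Finset.Ico a b, ∀ j ∈ Finset.Ico a b, B (w i) (w j) = if i = j then d i else 0)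
    (c : ℕ → ℚ) {j : ℕ} (hj : j ∈ Finset.Ico a b) :
    B (∑ i ∈ Finset.Ico a b, c i • w i) (w j) = c j * d j := by
  rw [map_sum, LinearMap.sum_apply]
  rw [Finset.sum_eq_single j]
  · simp [hw j hj j hj]
  · intro i hi hij
    simp [hw i hi j hj, hij]
  · intro h; exact absurd hj h

theorem HasFrame.nondeg {W : Submodule ℚ V} {d : ℕ → ℚ} {a b : ℕ} (H : HasFrame B W d a b)
    (hd : ∀ i ∈ Finset.Ico a b, d i ≠ 0) {x : V} (hx : x ∈ W) (h : ∀ y ∈ W, B x y = 0) : x = 0 := by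
  obtain ⟨w, hw, hW, hs⟩ := H
  obtain ⟨c, rfl⟩ := hs x hx
  apply Finset.sum_eq_zero
  intro j hj
  have := h (w j) (hW j hj)
  rw [frame_coord hw c hj] at this
  rcases mul_eq_zero.mp this with h | h
  · simp [h]
  · exact absurd h (hd j hj)

/-- Reflection. -/
noncomputable def refl (B : LinearMap.BilinForm ℚ V) (u : V) : V →ₗ[ℚ] V :=
  LinearMap.id - ((2 / B u u) • (B.flip u)).smulRight u

theorem refl_apply (u x : V) : refl B u x = x - (2 / B u u * B x u) • u := by
  simp [refl]

theorem refl_refl {u : V} (hu : B u u ≠ 0) (x : V) : refl B u (refl B u x) = x := by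
  have h2 : 2 / B u u * B u u = 2 := by field_simp
  simp only [refl_apply, map_sub, map_smul]
  rw [h2]; module

theorem refl_isom (hs : ∀ x y, B x y = B y x) {u : V} (hu : B u u ≠ 0) (x y : V) :
    B (refl B u x) (refl B u y) = B x y := by
  simp only [refl_apply, map_sub, map_smul, LinearMap.sub_apply, LinearMap.smul_apply, smul_eq_mul]
  rw [hs u y]
  field_simp; ring

theorem frame_step_aux (hs : ∀ x y, B x y = B y x) {W W' : Submodule ℚ V} {d : ℕ → ℚ} {a b : ℕ}
    {w : ℕ → V}
    (hw : ∀ i ∈ Finset.Ico a b, ∀ j ∈ Finset.Ico a b, B (w i) (w j) = if i = j then d i else 0)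
    (hW : ∀ i ∈ Finset.Ico a b, w i ∈ W)
    (hsp : ∀ x ∈ W, ∃ c : ℕ → ℚ, x = ∑ i ∈ Finset.Ico a b, c i • w i)
    (hab : a < b) (hda : d a ≠ 0) {h : V} 
    (hW' : ∀ x, x ∈ W' ↔ x ∈ W ∧ B x h = 0) {u : V} (huW : u ∈ W) (hu : B u u ≠ 0) {ε : ℚ}
    (hε : h = ε • refl B u (w a)) (hε0 : ε ≠ 0) : HasFrame B W' d (a+1) b := by
  have hrW : ∀ x ∈ W, refl B u x ∈ W := fun x hx => by
    rw [refl_apply]; exact W.sub_mem hx (W.smul_mem _ huW)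
  have ha : a ∈ Finset.Ico a b := by simp [hab]
  have hsub : ∀ i ∈ Finset.Ico (a+1) b, i ∈ Finset.Ico a b ∧ i ≠ a := by
    intro i hi; simp at hi ⊢; omega
  refine ⟨fun i => refl B u (w i), ?_, ?_, ?_⟩
  · intro i hi j hj
    rw [refl_isom hs hu]; exact hw i (hsub i hi).1 j (hsub j hj).1
  · intro i hi
    rw [hW']
    refine ⟨hrW _ (hW i (hsub i hi).1), ?_⟩
    rw [hε, map_smul, refl_isom hs hu, hw i (hsub i hi).1 a ha, if_neg (hsub i hi).2]; simp
  · intro x hx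
    rw [hW'] at hx
    obtain ⟨c, hc⟩ := hsp _ (hrW x hx.1)
    have hx2 : B (refl B u x) (w a) = 0 := by
      have h2 := hx.2
      rw [hε, map_smul, smul_eq_mul] at h2
      have h3 := (mul_eq_zero.mp h2).resolve_left hε0
      rw [← refl_isom hs hu, refl_refl hu] at h3
      exact h3
    rw [hc, frame_coord hw c ha] at hx2
    have hca := (mul_eq_zero.mp hx2).resolve_right hda
    refine ⟨c, ?_⟩
    have : x = refl B u (refl B u x) := (refl_refl hu x).symm
    rw [this, hc, Finset.sum_eq_sum_Ico_succ_bot hab, hca, zero_smul, zero_add, map_sum]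
    simp

theorem HasFrame.step (hs : ∀ x y, B x y = B y x) {W W' : Submodule ℚ V} {d : ℕ → ℚ} {a b : ℕ}
    (H : HasFrame B W d a b) (hab : a < b) (hda : d a ≠ 0) {h : V} (hh : h ∈ W)
    (hhh : B h h = d a) (hW' : ∀ x, x ∈ W' ↔ x ∈ W ∧ B x h = 0) : HasFrame B W' d (a+1) b := by
  obtain ⟨w, hw, hW, hsp⟩ := H
  have ha : a ∈ Finset.Ico a b := by simp [hab]
  have hwa : B (w a) (w a) = d a := by rw [hw a ha a ha, if_pos rfl]
  have e1 : B (w a - h) (w a - h) = 2 * d a - 2 * B (w a) h := by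
    simp only [map_sub, LinearMap.sub_apply, hwa, hhh, hs h (w a)]; ring
  have e2 : B (w a + h) (w a + h) = 2 * d a + 2 * B (w a) h := by
    simp only [map_add, LinearMap.add_apply, hwa, hhh, hs h (w a)]; ring
  by_cases h1 : B (w a - h) (w a - h) = 0
  · have h2 : B (w a + h) (w a + h) ≠ 0 := by
      intro h2; rw [e1] at h1; rw [e2] at h2; apply hda; linarith
    refine frame_step_aux hs hw hW hsp hab hda hW' (W.add_mem (hW a ha) hh) h2 (ε := -1) ?_ (by norm_num)
    rw [refl_apply]
    have : 2 / B (w a + h) (w a + h) * B (w a) (w a + h) = 1 := by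
      have : B (w a) (w a + h) = B (w a + h) (w a + h) / 2 := by
        rw [e2, map_add, hwa]; ring
      rw [this]; field_simp
    rw [this]; module
  · refine frame_step_aux hs hw hW hsp hab hda hW' (W.sub_mem (hW a ha) hh) h1 (ε := 1) ?_ (by norm_num)
    rw [refl_apply]
    have : 2 / B (w a - h) (w a - h) * B (w a) (w a - h) = 1 := by
      have : B (w a) (w a - h) = B (w a - h) (w a - h) / 2 := by
        rw [e1, map_sub, hwa]; ring
      rw [this]; field_simp
    rw [this]; module

/-- Witt cancellation for orthogonal frames. -/
theorem HasFrame.peel (hs : ∀ x y, B x y = B y x) {d : ℕ → ℚ} {b : ℕ}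
    (H : HasFrame B ⊤ d 0 b) (hd : ∀ i < b, d i ≠ 0) (v : ℕ → V) (k : ℕ) (hk : k ≤ b)
    (hv : ∀ i < k, ∀ j < k, B (v i) (v j) = if i = j then d i else 0) (W : Submodule ℚ V)
    (hW : ∀ x, x ∈ W ↔ ∀ i < k, B x (v i) = 0) : HasFrame B W d k b := by
  induction k generalizing W with
  | zero =>
    have : W = ⊤ := by ext x; simp [hW]
    rw [this]; exact H
  | succ k ih =>
    let W0 : Submodule ℚ V :=
      { carrier := {x | ∀ i < k, B x (v i) = 0}
        add_mem' := by intro x y hx hy i hi; simp [hx i hi, hy i hi]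
        zero_mem' := by intro i _; simp
        smul_mem' := by intro c x hx i hi; simp [hx i hi] }
    have h0 : HasFrame B W0 d k b := ih (by omega) (fun i hi j hj => hv i (by omega) j (by omega)) W0
      (fun x => Iff.rfl)
    refine h0.step hs (by omega) (hd k (by omega)) (h := v k) ?_ ?_ ?_
    · intro i hi
      rw [hv k (by omega) i (by omega), if_neg (by omega)]
    · rw [hv k (by omega) k (by omega), if_pos rfl]
    · intro x
      rw [hW]
      constructor
      · intro h; exact ⟨fun i hi => h i (by omega), h k (by omega)⟩
      · rintro ⟨h1, h2⟩ i hi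
        rcases Nat.lt_succ_iff_lt_or_eq.mp hi with h | h
        · exact h1 i h
        · rw [h]; exact h2
end frames
end K3
end

section
namespace K3

/-- `X` is an integral lattice in `W` whose discriminant group has order two, generated by `μ/2`. -/
structure Lat {V : Type*} [AddCommGroup V] [Module ℚ V] (B : LinearMap.BilinForm ℚ V)
    (W : Submodule ℚ V) (X : AddSubgroup V) (μ : V) : Prop where
  sub : ∀ x ∈ X, x ∈ W
  int : ∀ x ∈ X, ∀ y ∈ X, ∃ n : ℤ, B x y = n
  full : ∀ w ∈ W, ∃ N : ℤ, N ≠ 0 ∧ (N : ℚ) • w ∈ X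
  mem : μ ∈ X
  ev : ∀ x ∈ X, ∃ n : ℤ, B μ x = 2 * n
  nrm : ∃ k : ℤ, B μ μ = 4 * k + 2
  dual : ∀ v ∈ W, (∀ x ∈ X, ∃ n : ℤ, B v x = n) → ∃ c : ℤ, v - ((c : ℚ) / 2) • μ ∈ X

section lat
variable {V : Type*} [AddCommGroup V] [Module ℚ V] {B : LinearMap.BilinForm ℚ V}

theorem zsm {X : AddSubgroup V} {x : V} (hx : x ∈ X) (n : ℤ) : (n : ℚ) • x ∈ X := by
  rw [Int.cast_smul_eq_zsmul]; exact X.zsmul_mem hx n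

/-- The values of an integral functional on a subgroup form a cyclic group. -/
theorem values_cyclic (X : AddSubgroup V) (φ : V →ₗ[ℚ] ℚ) (hφ : ∀ x ∈ X, ∃ n : ℤ, φ x = n) :
    ∃ d : ℤ, (∃ x ∈ X, φ x = d) ∧ ∀ x ∈ X, ∃ n : ℤ, φ x = d * n := by
  let H : AddSubgroup ℤ :=
    { carrier := {n | ∃ x ∈ X, φ x = n}
      add_mem' := by
        rintro m n ⟨x, hx, h1⟩ ⟨y, hy, h2⟩
        exact ⟨x + y, X.add_mem hx hy, by simp [h1, h2]⟩
      zero_mem' := ⟨0, X.zero_mem, by simp⟩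
      neg_mem' := by
        rintro m ⟨x, hx, h1⟩
        exact ⟨-x, X.neg_mem hx, by simp [h1]⟩ }
  obtain ⟨d, hd⟩ := Int.subgroup_cyclic H
  have hdH : d ∈ H := by rw [hd]; exact AddSubgroup.subset_closure rfl
  refine ⟨d, hdH, ?_⟩
  intro x hx
  obtain ⟨m, hm⟩ := hφ x hx
  have : m ∈ H := ⟨x, hx, hm⟩
  rw [hd, AddSubgroup.mem_closure_singleton] at this
  obtain ⟨n, hn⟩ := this
  refine ⟨n, ?_⟩
  rw [hm, ← hn]; simp [mul_comm]

theorem Lat.iso_split (hs : ∀ x y, B x y = B y x) {W : Submodule ℚ V} {X : AddSubgroup V} {μ : V}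
    (H : Lat B W X μ) (nd : ∀ x ∈ W, (∀ y ∈ W, B x y = 0) → x = 0)
    {z : V} (hz : z ∈ W) (hz0 : z ≠ 0) (hzz : B z z = 0) :
    ∃ e ∈ X, B e e = 0 ∧ ∃ f ∈ X, B e f = 1 := by
  obtain ⟨N, hN, hNz⟩ := H.full z hz
  have hNQ : (N : ℚ) ≠ 0 := by exact_mod_cast hN
  obtain ⟨d, ⟨f, hf, hdf⟩, hd⟩ := values_cyclic X (B ((N : ℚ) • z)) (fun x hx => H.int _ hNz x hx)
  have hd0 : d ≠ 0 := by
    intro h0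
    apply hz0
    apply nd z hz
    intro y hy
    obtain ⟨M, hM, hMy⟩ := H.full y hy
    obtain ⟨n, hn⟩ := hd _ hMy
    have hMQ : (M : ℚ) ≠ 0 := by exact_mod_cast hM
    simp [h0] at hn
    tauto
  have hdQ : (d : ℚ) ≠ 0 := by exact_mod_cast hd0
  set v : V := ((N : ℚ) / d) • z with hv
  have hvW : v ∈ W := W.smul_mem _ hz
  have hBv : ∀ x, B v x = B ((N : ℚ) • z) x / d := by
    intro x; simp [hv]; ring
  obtain ⟨c, hc⟩ := H.dual v hvW (by
    intro x hx
    obtain ⟨n, hn⟩ := hd x hx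
    exact ⟨n, by rw [hBv, hn]; field_simp⟩)
  have hvv : B v v = 0 := by simp [hv, hzz]
  set x := v - ((c : ℚ) / 2) • μ with hx
  have hvx : v = x + ((c : ℚ) / 2) • μ := by rw [hx]; module
  obtain ⟨n1, h1⟩ := H.int x hc x hc
  obtain ⟨n2, h2⟩ := H.ev x hc
  obtain ⟨k, h3⟩ := H.nrm
  have hce : (c * c * (2 * k + 1) : ℤ) = -2 * (n1 + 2 * c * n2) := by
    rw [hvx] at hvv
    simp only [map_add, map_smul, LinearMap.add_apply, LinearMap.smul_apply, smul_eq_mul, h1, h2, h3,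
      hs x μ] at hvv
    have : ((c * c * (2 * k + 1) : ℤ) : ℚ) = ((-2 * (n1 + 2 * c * n2) : ℤ) : ℚ) := by
      push_cast; linarith
    exact_mod_cast this
  have hc2 : Even c := by
    have : Even (c * c * (2 * k + 1)) := by rw [hce]; exact ⟨-(n1 + 2 * c * n2), by ring⟩
    rw [Int.even_mul, Int.even_mul] at this
    rcases this with h | h
    · tauto
    · exfalso; revert h; simp
  obtain ⟨c', rfl⟩ := hc2
  have hvX : v ∈ X := by
    rw [hvx]
    apply X.add_mem hc
    have : (((c' + c' : ℤ) : ℚ) / 2) = (c' : ℚ) := by push_cast; ring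
    rw [this]; exact zsm H.mem c'
  exact ⟨v, hvX, hvv, f, hf, by rw [hBv, hdf]; field_simp⟩

/-- Splitting off a vector of norm `±1`. -/
theorem Lat.split (hs : ∀ x y, B x y = B y x) {W W' : Submodule ℚ V} {X X' : AddSubgroup V} {μ : V}
    (H : Lat B W X μ) {h : V} (hX : h ∈ X) {ε : ℤ} (hε : ε * ε = 1) (hh : B h h = ε)
    (hW' : ∀ x, x ∈ W' ↔ x ∈ W ∧ B x h = 0) (hX' : ∀ x, x ∈ X' ↔ x ∈ X ∧ B x h = 0) :
    (∃ μ', Lat B W' X' μ') ∧ ∀ x ∈ X, ∃ n : ℤ, x - (n : ℚ) • h ∈ X' := by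
  have hεQ : (ε : ℚ) * ε = 1 := by exact_mod_cast hε
  have hdec : ∀ x ∈ X, ∃ n : ℤ, x - (n : ℚ) • h ∈ X' := by
    intro x hx
    obtain ⟨n, hn⟩ := H.int x hx h hX
    refine ⟨ε * n, ?_⟩
    rw [hX']
    refine ⟨X.sub_mem hx (zsm hX _), ?_⟩
    simp only [map_sub, map_smul, LinearMap.sub_apply, LinearMap.smul_apply, smul_eq_mul, hh, hn]
    push_cast
    linear_combination (-(n : ℚ)) * hεQ
  refine ⟨?_, hdec⟩
  obtain ⟨m, hm⟩ := H.ev h hX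
  have hμ' : μ - ((ε * (2 * m) : ℤ) : ℚ) • h ∈ X' := by
    rw [hX']
    refine ⟨X.sub_mem H.mem (zsm hX _), ?_⟩
    simp only [map_sub, map_smul, LinearMap.sub_apply, LinearMap.smul_apply, smul_eq_mul, hh, hm]
    push_cast
    linear_combination (-(2 * m : ℚ)) * hεQ
  refine ⟨μ - ((ε * (2 * m) : ℤ) : ℚ) • h, ?_, ?_, ?_, hμ', ?_, ?_, ?_⟩
  · intro x hx
    rw [hX'] at hx; rw [hW']
    exact ⟨H.sub x hx.1, hx.2⟩
  · intro x hx y hy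
    rw [hX'] at hx hy
    exact H.int x hx.1 y hy.1
  · intro w hw
    rw [hW'] at hw
    obtain ⟨N, hN, hNw⟩ := H.full w hw.1
    refine ⟨N, hN, ?_⟩
    rw [hX']; exact ⟨hNw, by simp [hw.2]⟩
  · intro x hx
    rw [hX'] at hx
    obtain ⟨n, hn⟩ := H.ev x hx.1
    refine ⟨n, ?_⟩
    simp [hn, hs h x, hx.2]
  · obtain ⟨k, hk⟩ := H.nrm
    refine ⟨k - ε * m * m, ?_⟩
    simp only [map_sub, map_smul, LinearMap.sub_apply, LinearMap.smul_apply, smul_eq_mul, hh, hm, hk,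
      hs h μ]
    push_cast
    linear_combination (4 * m * m * ε : ℚ) * hεQ
  · intro v hv hvX
    rw [hW'] at hv
    obtain ⟨c, hc⟩ := H.dual v hv.1 (by
      intro x hx
      obtain ⟨n, hn⟩ := hdec x hx
      obtain ⟨k, hk⟩ := hvX _ hn
      refine ⟨k, ?_⟩
      rw [← hk]; simp [hv.2])
    refine ⟨c, ?_⟩
    rw [hX']
    constructor
    · have : v - ((c : ℚ) / 2) • (μ - ((ε * (2 * m) : ℤ) : ℚ) • h) =
        (v - ((c : ℚ) / 2) • μ) + ((c * (ε * m) : ℤ) : ℚ) • h := by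
        push_cast; module
      rw [this]; exact X.add_mem hc (zsm hX _)
    · have h1 := ((hX' _).mp hμ').2
      rw [map_sub, LinearMap.sub_apply, map_smul, LinearMap.smul_apply, h1, hv.2]; simp

/-- rank one -/
theorem Lat.rank_one (hs : ∀ x y, B x y = B y x) {W : Submodule ℚ V} {X : AddSubgroup V} {μ w : V}
    (H : Lat B W X μ) (hw : ∀ x ∈ W, ∃ c : ℚ, x = c • w) (hww : B w w = -2) :
    ∃ g ∈ X, B g g = -2 ∧ ∀ x ∈ X, ∃ n : ℤ, x = (n : ℚ) • g := by
  obtain ⟨k, hk⟩ := H.nrm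
  have hμμ : B μ μ ≠ 0 := by
    rw [hk]; intro h
    have : (4 * k + 2 : ℤ) = 0 := by exact_mod_cast h
    omega
  have hxμ : ∀ x ∈ W, x = (B μ x / B μ μ) • μ := by
    intro x hx
    obtain ⟨a, rfl⟩ := hw x hx
    obtain ⟨b, hb⟩ := hw μ (H.sub _ H.mem)
    have hb0 : b ≠ 0 := by rintro rfl; apply hμμ; simp [hb]
    rw [hb]
    simp only [map_smul, LinearMap.smul_apply, smul_eq_mul, hww, smul_smul]
    congr 1
    field_simp
  obtain ⟨d, ⟨g, hg, hdg⟩, hd⟩ := values_cyclic X (B μ) (fun x hx => H.int _ H.mem x hx)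
  have hd0 : (d : ℚ) ≠ 0 := by
    intro h
    obtain ⟨n, hn⟩ := hd μ H.mem
    rw [h] at hn; apply hμμ; simp [hn]
  have hgen : ∀ x ∈ X, ∃ n : ℤ, x = (n : ℚ) • g := by
    intro x hx
    obtain ⟨n, hn⟩ := hd x hx
    refine ⟨n, ?_⟩
    rw [hxμ x (H.sub x hx), hxμ g (H.sub g hg), hn, hdg]
    rw [smul_smul]; congr 1; ring
  refine ⟨g, hg, ?_, hgen⟩
  obtain ⟨s, hsg⟩ := hgen μ H.mem
  obtain ⟨a, ha⟩ := H.int g hg g hg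
  obtain ⟨q, hq⟩ := hw g (H.sub g hg)
  have ha0 : (a : ℚ) ≠ 0 := by
    intro h; apply hμμ; rw [hsg]; simp [ha, h]
  have haneg : a < 0 := by
    have : (a : ℚ) < 0 := by
      have h1 : (a : ℚ) = -2 * (q * q) := by rw [← ha, hq]; simp [hww]; ring
      have : 0 ≤ q * q := mul_self_nonneg q
      rcases lt_or_eq_of_le (show (a : ℚ) ≤ 0 by linarith) with h | h
      · exact h
      · exact absurd h ha0
    exact_mod_cast this
  obtain ⟨c, hc⟩ := H.dual ((1 / (a : ℚ)) • g) (W.smul_mem _ (H.sub g hg)) (by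
    intro x hx
    obtain ⟨n, rfl⟩ := hgen x hx
    refine ⟨n, ?_⟩
    simp [ha]; field_simp)
  obtain ⟨m, hm⟩ := hgen _ hc
  have hrel : 2 = (2 * m + c * s) * a := by
    have h1 := congrArg (fun x => B x g) hm
    rw [hsg] at h1
    simp only [map_sub, map_smul, LinearMap.sub_apply, LinearMap.smul_apply, smul_eq_mul, ha] at h1
    have : (2 : ℚ) = ((2 * m + c * s) * a : ℤ) := by
      push_cast
      field_simp at h1
      linear_combination h1
    exact_mod_cast this
  have hrel2 : s * s * a = 4 * k + 2 := by
    have : ((s * s * a : ℤ) : ℚ) = ((4 * k + 2 : ℤ) : ℚ) := by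
      push_cast
      rw [← hk, hsg]; simp [ha]; ring
    exact_mod_cast this
  have hdvd : a ∣ 2 := ⟨_, by rw [mul_comm]; exact hrel⟩
  have hlow : -2 ≤ a := by
    have := Int.le_of_dvd (by norm_num) ((neg_dvd).mpr hdvd)
    omega
  have : a = -2 ∨ a = -1 := by omega
  rcases this with h | h
  · rw [ha, h]; norm_num
  · exfalso
    rw [h] at hrel2
    rcases Int.emod_two_eq_zero_or_one s with hs2 | hs2
    · obtain ⟨j, rfl⟩ : ∃ j, s = 2 * j := ⟨s / 2, by omega⟩
      have : 2 * (2 * (j * j)) = -(4 * k + 2) := by linarith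
      omega
    · obtain ⟨j, rfl⟩ : ∃ j, s = 2 * j + 1 := ⟨s / 2, by omega⟩
      have : 2 * (2 * (j * j) + 2 * j) + 1 = -(4 * k + 2) := by linarith
      omega

end lat
end K3
end

section
namespace K3

/-- The norms `(-1)^7, 1, -2`. -/
def dn (i : ℕ) : ℚ := if i < 7 then -1 else if i = 7 then 1 else -2

theorem dn_ne (i : ℕ) : dn i ≠ 0 := by unfold dn; split_ifs <;> norm_num

section odd
variable {V : Type*} [AddCommGroup V] [Module ℚ V] {B : LinearMap.BilinForm ℚ V}

/-- orthogonal complement in a subspace -/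
def perpW (B : LinearMap.BilinForm ℚ V) (W : Submodule ℚ V) (h : V) : Submodule ℚ V where
  carrier := {x | x ∈ W ∧ B x h = 0}
  add_mem' := by rintro x y ⟨h1, h2⟩ ⟨h3, h4⟩; exact ⟨W.add_mem h1 h3, by simp [h2, h4]⟩
  zero_mem' := ⟨W.zero_mem, by simp⟩
  smul_mem' := by rintro c x ⟨h1, h2⟩; exact ⟨W.smul_mem _ h1, by simp [h2]⟩

/-- orthogonal complement in a subgroup -/
def perpX (B : LinearMap.BilinForm ℚ V) (X : AddSubgroup V) (h : V) : AddSubgroup V where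
  carrier := {x | x ∈ X ∧ B x h = 0}
  add_mem' := by rintro x y ⟨h1, h2⟩ ⟨h3, h4⟩; exact ⟨X.add_mem h1 h3, by simp [h2, h4]⟩
  zero_mem' := ⟨X.zero_mem, by simp⟩
  neg_mem' := by rintro x ⟨h1, h2⟩; exact ⟨X.neg_mem h1, by simp [h2]⟩

theorem exists_units (hs : ∀ x y, B x y = B y x) {X : AddSubgroup V}
    (hIntg : ∀ x ∈ X, ∀ y ∈ X, ∃ n : ℤ, B x y = n) {e f o : V} (he : e ∈ X) (hf : f ∈ X) (ho : o ∈ X)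
    (hee : B e e = 0) (hef : B e f = 1) (hoo : B o o = 1) :
    ∃ h ∈ X, ∃ a ∈ X, B h h = -1 ∧ B a a = 1 ∧ B a h = 0 := by
  obtain ⟨f', hf', hef', j, hj⟩ : ∃ f' ∈ X, B e f' = 1 ∧ ∃ j : ℤ, B f' f' = 2 * j + 1 := by
    obtain ⟨q, hq⟩ := hIntg f hf f hf
    rcases Int.even_or_odd' q with ⟨j, hj | hj⟩
    · obtain ⟨p, hp⟩ := hIntg o ho e he
      obtain ⟨r, hr⟩ := hIntg o ho f hf
      refine ⟨o + ((1 - p : ℤ) : ℚ) • f, X.add_mem ho (zsm hf _), ?_, (1 - p) * r + (1 - p) * (1 - p) * j, ?_⟩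
      · simp only [map_add, map_smul, smul_eq_mul, hef, hs e o, hp]; push_cast; ring
      · simp only [map_add, map_smul, smul_eq_mul, LinearMap.add_apply, LinearMap.smul_apply,
          hoo, hs f o, hr, hq, hj]
        push_cast; ring
    · exact ⟨f, hf, hef, j, by rw [hq, hj]; push_cast; ring⟩
  refine ⟨f' - ((j + 1 : ℤ) : ℚ) • e, X.sub_mem hf' (zsm he _), f' - (j : ℚ) • e,
    X.sub_mem hf' (zsm he _), ?_, ?_, ?_⟩ <;>
  · simp only [map_sub, map_smul, smul_eq_mul, LinearMap.sub_apply, LinearMap.smul_apply,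
          hee, hs f' e, hef', hj]
    push_cast; ring

theorem odd_class (hs : ∀ x y, B x y = B y x) (n : ℕ) : ∀ (a : ℕ), a + n = 7 →
    ∀ (W : Submodule ℚ V) (X : AddSubgroup V) (μ : V), Lat B W X μ → HasFrame B W dn a 9 →
    (∃ o ∈ X, B o o = 1) →
    ∃ b : ℕ → V, (∀ i ∈ Finset.Ico a 9, ∀ j ∈ Finset.Ico a 9, B (b i) (b j) = if i = j then dn i else 0) ∧
      (∀ i ∈ Finset.Ico a 9, b i ∈ X) ∧
      ∀ x ∈ X, ∃ c : ℕ → ℤ, x = ∑ i ∈ Finset.Ico a 9, (c i : ℚ) • b i := by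
  induction n with
  | zero =>
    rintro a ha W X μ H F ⟨o, ho, hoo⟩
    obtain rfl : a = 7 := by omega
    have F' : HasFrame B (perpW B W o) dn 8 9 := F.step hs (by omega) (dn_ne _) (H.sub o ho)
      (by rw [hoo]; simp [dn]) (fun x => Iff.rfl)
    obtain ⟨⟨μ', H'⟩, hdec⟩ := H.split hs ho (ε := 1) (by norm_num) (by rw [hoo]; norm_num)
      (W' := perpW B W o) (X' := perpX B X o) (fun x => Iff.rfl) (fun x => Iff.rfl)
    obtain ⟨w, hw, hwW, hsp⟩ := F'
    obtain ⟨g, hg, hgg, hgen⟩ := H'.rank_one hs (w := w 8)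
      (by intro x hx; obtain ⟨c, hc⟩ := hsp x hx; exact ⟨c 8, by simpa using hc⟩)
      (by rw [hw 8 (by simp) 8 (by simp)]; simp [dn])
    have hIco : Finset.Ico 7 9 = {7, 8} := by decide
    refine ⟨fun i => if i = 7 then o else g, ?_, ?_, ?_⟩
    · rw [hIco]; simp [hoo, hgg, hs o g, hg.2, dn]
    · rw [hIco]; simp [ho, hg.1]
    · intro x hx
      obtain ⟨n, hn⟩ := hdec x hx
      obtain ⟨m, hm⟩ := hgen _ hn
      refine ⟨fun i => if i = 7 then n else m, ?_⟩
      rw [hIco]; simp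
      rw [← hm]; module
  | succ n ih =>
    rintro a ha W X μ H F ⟨o, ho, hoo⟩
    have ha7 : a < 7 := by omega
    obtain ⟨e, he, hee, f, hf, hef⟩ : ∃ e ∈ X, B e e = 0 ∧ ∃ f ∈ X, B e f = 1 := by
      have nd : ∀ x ∈ W, (∀ y ∈ W, B x y = 0) → x = 0 := fun x hx h => F.nondeg (fun i _ => dn_ne i) hx h
      obtain ⟨w, hw, hwW, hsp⟩ := F
      have m1 : a ∈ Finset.Ico a 9 := by simp; omega
      have m2 : 7 ∈ Finset.Ico a 9 := by simp; omega
      have h1 := hw a m1 a m1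
      have h2 := hw 7 m2 7 m2
      have h3 := hw a m1 7 m2
      have h4 := hw 7 m2 a m1
      simp only [dn, ha7, if_true, if_neg (show ¬ (7 < 7) by omega), if_neg (show ¬ a = 7 by omega),
        if_neg (show ¬ 7 = a by omega)] at h1 h2 h3 h4
      refine H.iso_split hs nd (z := w a + w 7) (W.add_mem (hwW a m1) (hwW 7 m2)) ?_ ?_
      · intro h0
        have := congrArg (fun x => B x (w 7)) h0
        simp [h2, h3] at this
      · simp [h1, h2, h3, h4]
    obtain ⟨h, hh, a1, ha1, hhh, haa, hah⟩ := exists_units hs H.int he hf ho hee hef hoo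
    have F' : HasFrame B (perpW B W h) dn (a+1) 9 := F.step hs (by omega) (dn_ne _) (H.sub h hh)
      (by rw [hhh]; simp [dn, ha7]) (fun x => Iff.rfl)
    obtain ⟨⟨μ', H'⟩, hdec⟩ := H.split hs hh (ε := -1) (by norm_num) (by rw [hhh]; norm_num)
      (W' := perpW B W h) (X' := perpX B X h) (fun x => Iff.rfl) (fun x => Iff.rfl)
    obtain ⟨b, hb, hbX, hbs⟩ := ih (a+1) (by omega) _ _ _ H' F' ⟨a1, ⟨ha1, hah⟩, haa⟩
    have hmem : ∀ i ∈ Finset.Ico a 9, i ≠ a → i ∈ Finset.Ico (a+1) 9 := by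
      intro i hi hne; simp at hi ⊢; omega
    refine ⟨fun i => if i = a then h else b i, ?_, ?_, ?_⟩
    · intro i hi j hj
      by_cases h1 : i = a <;> by_cases h2 : j = a
      · simp [h1, h2, hhh, dn, ha7]
      · simp only [h1, h2, if_true, if_false]
        rw [hs, (hbX j (hmem j hj h2)).2, if_neg (fun h => h2 h.symm)]
      · simp only [h1, h2, if_true, if_false]
        rw [(hbX i (hmem i hi h1)).2]
      · simp only [h1, h2, if_false]
        exact hb i (hmem i hi h1) j (hmem j hj h2)
    · intro i hi
      by_cases h1 : i = a
      · simp [h1, hh]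
      · simp only [h1, if_false]; exact (hbX i (hmem i hi h1)).1
    · intro x hx
      obtain ⟨n, hn⟩ := hdec x hx
      obtain ⟨c, hc⟩ := hbs _ hn
      refine ⟨fun i => if i = a then n else c i, ?_⟩
      rw [Finset.sum_eq_sum_Ico_succ_bot (by omega)]
      have : ∑ k ∈ Finset.Ico (a + 1) 9, (((if k = a then n else c k : ℤ)) : ℚ) • (if k = a then h else b k)
          = ∑ k ∈ Finset.Ico (a + 1) 9, (c k : ℚ) • b k := by
        apply Finset.sum_congr rfl
        intro k hk
        have : k ≠ a := by simp at hk; omega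
        simp [this]
      rw [this, ← hc]; simp
end odd
end K3
end

section
namespace K3
section even
variable {V : Type*} [AddCommGroup V] [Module ℚ V] {B : LinearMap.BilinForm ℚ V}

theorem Lat.change (hs : ∀ x y, B x y = B y x) {W : Submodule ℚ V} {X : AddSubgroup V} {μ m : V}
    (H : Lat B W X μ) (hm : m ∈ X) : Lat B W X (μ - (2 : ℚ) • m) := by
  have h2 : (2 : ℚ) • m ∈ X := by simpa using zsm hm 2
  refine ⟨H.sub, H.int, H.full, X.sub_mem H.mem h2, ?_, ?_, ?_⟩
  · intro x hx
    obtain ⟨n, hn⟩ := H.ev x hx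
    obtain ⟨k, hk⟩ := H.int m hm x hx
    exact ⟨n - k, by simp [hn, hk]; ring⟩
  · obtain ⟨k, hk⟩ := H.nrm
    obtain ⟨n, hn⟩ := H.ev m hm
    obtain ⟨l, hl⟩ := H.int m hm m hm
    refine ⟨k - 2 * n + l, ?_⟩
    simp only [map_sub, map_smul, smul_eq_mul, LinearMap.sub_apply, LinearMap.smul_apply, hs m μ,
      hk, hn, hl]
    push_cast; ring
  · intro v hv h
    obtain ⟨c, hc⟩ := H.dual v hv h
    refine ⟨c, ?_⟩
    have : v - ((c : ℚ) / 2) • (μ - (2 : ℚ) • m) = v - ((c : ℚ) / 2) • μ + (c : ℚ) • m := by module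
    rw [this]; exact X.add_mem hc (zsm hm c)

/-- the odd neighbour -/
def nbr (B : LinearMap.BilinForm ℚ V) (M : AddSubgroup V) (e f : V) (hff : B f f = 0) (hef : B e f = 1)
    : AddSubgroup V where
  carrier := {x | ∃ x0 ∈ M, ∃ n k : ℤ, B x0 f = 2 * k ∧ x = x0 + (n : ℚ) • (e + (1/2 : ℚ) • f)}
  add_mem' := by
    rintro x y ⟨x0, hx0, n, k, h1, rfl⟩ ⟨y0, hy0, m, l, h2, rfl⟩
    exact ⟨x0 + y0, M.add_mem hx0 hy0, n + m, k + l, by simp [h1, h2]; ring, by push_cast; module⟩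
  zero_mem' := ⟨0, M.zero_mem, 0, 0, by simp, by simp⟩
  neg_mem' := by
    rintro x ⟨x0, hx0, n, k, h1, rfl⟩
    exact ⟨-x0, M.neg_mem hx0, -n, -k, by simp [h1], by push_cast; module⟩

theorem nbr_lat (hs : ∀ x y, B x y = B y x) {W : Submodule ℚ V} {M : AddSubgroup V} {μ e f : V}
    (H : Lat B W M μ) (he : e ∈ M) (hf : f ∈ M)
    (hee : B e e = 0) (hff : B f f = 0) (hef : B e f = 1) (hμe : B μ e = 0) (hμf : B μ f = 0) :
    Lat B W (nbr B M e f hff hef) μ := by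
  have hfe : B f e = 1 := by rw [hs, hef]
  refine ⟨?_, ?_, ?_, ?_, ?_, H.nrm, ?_⟩
  · rintro x ⟨x0, hx0, n, k, h1, rfl⟩
    exact W.add_mem (H.sub _ hx0) (W.smul_mem _ (W.add_mem (H.sub _ he) (W.smul_mem _ (H.sub _ hf))))
  · rintro x ⟨x0, hx0, n, k, h1, rfl⟩ y ⟨y0, hy0, m, l, h2, rfl⟩
    obtain ⟨p, hp⟩ := H.int x0 hx0 y0 hy0
    obtain ⟨q, hq⟩ := H.int x0 hx0 e he
    obtain ⟨r, hr⟩ := H.int y0 hy0 e he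
    refine ⟨p + m * (q + k) + n * (r + l) + n * m, ?_⟩
    simp only [map_add, map_smul, smul_eq_mul, LinearMap.add_apply, LinearMap.smul_apply, hs e y0,
      hs f y0, hp, hq, hr, h1, h2, hee, hff, hef, hfe]
    push_cast; ring
  · intro w hw
    obtain ⟨N, hN, hNw⟩ := H.full w hw
    obtain ⟨p, hp⟩ := H.int _ hNw f hf
    refine ⟨2 * N, by omega, (2 : ℚ) • ((N : ℚ) • w), by simpa using zsm hNw 2, 0, p, ?_, ?_⟩
    · simp only [map_smul, LinearMap.smul_apply, smul_eq_mul] at hp ⊢; rw [hp]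
    · push_cast; module
  · exact ⟨μ, H.mem, 0, 0, by simp [hμf], by simp⟩
  · rintro x ⟨x0, hx0, n, k, h1, rfl⟩
    obtain ⟨p, hp⟩ := H.ev x0 hx0
    exact ⟨p, by simp [hp, hμe, hμf]⟩
  · intro v hv hvX
    -- subtract the hyperbolic part
    obtain ⟨α, hα⟩ := hvX f ⟨f, hf, 0, 0, by simp [hff], by simp⟩
    obtain ⟨γ, hγ⟩ := hvX (e + (1/2 : ℚ) • f) ⟨0, M.zero_mem, 1, 0, by simp, by simp⟩
    have hβ : B v e = γ - α / 2 := by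
      simp only [map_add, map_smul, smul_eq_mul, hα] at hγ; linarith
    set v' := v - (α : ℚ) • e - ((γ : ℚ) - α / 2) • f with hv'
    have hv'e : B v' e = 0 := by simp [hv', hβ, hee, hfe]
    have hv'f : B v' f = 0 := by simp [hv', hα, hef, hff]
    obtain ⟨c, hc⟩ := H.dual v' (W.sub_mem (W.sub_mem hv (W.smul_mem _ (H.sub _ he)))
        (W.smul_mem _ (H.sub _ hf))) (by
      intro x hx
      obtain ⟨p, hp⟩ := H.int x hx e he
      obtain ⟨q, hq⟩ := H.int x hx f hf
      set y := x - (q : ℚ) • e - (p : ℚ) • f with hy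
      have hyM : y ∈ M := M.sub_mem (M.sub_mem hx (zsm he _)) (zsm hf _)
      have hyf : B y f = 0 := by simp [hy, hq, hef, hff]
      have hye : B y e = 0 := by simp [hy, hp, hee, hfe]
      obtain ⟨n, hn⟩ := hvX y ⟨y, hyM, 0, 0, by simp [hyf], by simp⟩
      refine ⟨n, ?_⟩
      have h1 : x = y + (q : ℚ) • e + (p : ℚ) • f := by rw [hy]; module
      have h2 : B v' y = B v y := by simp [hv', hs e y, hs f y, hye, hyf]
      rw [h1]; simp only [map_add, map_smul, hv'e, hv'f, h2, hn]; simp)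
    refine ⟨c, v' - ((c : ℚ) / 2) • μ + ((γ - α : ℤ) : ℚ) • f, M.add_mem hc (zsm hf _), α, 0, ?_, ?_⟩
    · simp [hv'f, hμf, hff]
    · rw [hv']; push_cast; module

theorem nbr_even (hs : ∀ x y, B x y = B y x) {W : Submodule ℚ V} {M : AddSubgroup V} {μ e f : V}
    (H : Lat B W M μ) (hev : ∀ x ∈ M, ∃ n : ℤ, B x x = 2 * n) (he : e ∈ M) (hf : f ∈ M)
    (hee : B e e = 0) (hff : B f f = 0) (hef : B e f = 1) {x : V} (hx : x ∈ nbr B M e f hff hef)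
    {j : ℤ} (hj : B x x = 2 * j) : x ∈ M ∧ ∃ k : ℤ, B x f = 2 * k := by
  have hfe : B f e = 1 := by rw [hs, hef]
  obtain ⟨x0, hx0, n, k, h1, rfl⟩ := hx
  obtain ⟨p, hp⟩ := hev x0 hx0
  obtain ⟨q, hq⟩ := H.int x0 hx0 e he
  simp only [map_add, map_smul, smul_eq_mul, LinearMap.add_apply, LinearMap.smul_apply, hs e x0,
      hs f x0, hp, hq, h1, hee, hff, hef, hfe] at hj
  have h3 : n * n = 2 * (j - p - n * (q + k)) := by
    have : ((n * n : ℤ) : ℚ) = ((2 * (j - p - n * (q + k)) : ℤ) : ℚ) := by push_cast; linarith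
    exact_mod_cast this
  have h4 : Even n := by
    have : Even (n * n) := by rw [h3]; exact even_two_mul _
    rw [Int.even_mul] at this; tauto
  obtain ⟨r, rfl⟩ := h4
  constructor
  · have : x0 + ((r + r : ℤ) : ℚ) • (e + (1/2 : ℚ) • f) = x0 + ((2 * r : ℤ) : ℚ) • e + (r : ℚ) • f := by
      push_cast; module
    rw [this]
    exact M.add_mem (M.add_mem hx0 (zsm he _)) (zsm hf _)
  · exact ⟨k + r, by
      simp only [map_add, map_smul, smul_eq_mul, LinearMap.add_apply, LinearMap.smul_apply, h1, hef, hff]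
      push_cast; ring⟩

/-- Reformulation of the classification of odd lattices of rank nine. -/
theorem odd_class' (hs : ∀ x y, B x y = B y x) {W : Submodule ℚ V} {X : AddSubgroup V} {μ : V}
    (H : Lat B W X μ) (F : HasFrame B W dn 0 9) (ho : ∃ o ∈ X, B o o = 1) :
    ∃ g ∈ X, ∃ h : Fin 8 → V, (∀ i, h i ∈ X) ∧ B g g = 2 ∧ (∀ i, B g (h i) = 0) ∧
      (∀ i j, B (h i) (h j) = if i = j then -1 else 0) ∧
      ∀ x ∈ X, ∃ (n : ℤ) (c : Fin 8 → ℤ), x = (n : ℚ) • g + ∑ i, (c i : ℚ) • h i := by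
  obtain ⟨b, hb, hbX, hsp⟩ := odd_class hs 7 0 rfl W X μ H F ho
  have hbb : ∀ i j : ℕ, i < 9 → j < 9 → B (b i) (b j) = if i = j then dn i else 0 :=
    fun i j hi hj => hb i (by simp; omega) j (by simp; omega)
  have hbm : ∀ i < 9, b i ∈ X := fun i hi => hbX i (by simp; omega)
  have h7 := hbm 7 (by omega)
  have h8 := hbm 8 (by omega)
  refine ⟨(2 : ℚ) • b 7 + b 8, X.add_mem (by simpa using zsm h7 2) h8,
    fun i => if i.val = 7 then b 7 + b 8 else b i.val, ?_, ?_, ?_, ?_, ?_⟩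
  · intro i
    by_cases hi : i.val = 7
    · simp only [hi, if_true]; exact X.add_mem h7 h8
    · simp only [hi, if_false]; exact hbm _ (by omega)
  · simp [hbb, dn]; norm_num
  · intro i
    by_cases hi : i.val = 7
    · simp [hi, hbb, dn]
    · have := i.2
      simp [hi, hbb, show i.val < 9 by omega, show ¬ 7 = i.val by omega, show ¬ 8 = i.val by omega]
  · intro i j
    have := i.2
    have := j.2
    by_cases hi : i.val = 7 <;> by_cases hj : j.val = 7
    · have : i = j := Fin.ext (by omega)
      simp [hj, this, hbb, dn]; norm_num
    · have h1 : ¬ i = j := fun h => hj (by rw [← h]; exact hi)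
      simp [hi, hj, h1, hbb, show j.val < 9 by omega, show ¬ 7 = j.val by omega, show ¬ 8 = j.val by omega]
    · have h1 : ¬ i = j := fun h => hi (by rw [h]; exact hj)
      simp [hi, hj, h1, hbb, show i.val < 9 by omega, show ¬ i.val = 8 by omega]
    · simp only [hi, hj, if_false]
      rw [hbb _ _ (by omega) (by omega)]
      simp [Fin.ext_iff, dn, show i.val < 7 by omega]
  · intro x hx
    obtain ⟨c, hc⟩ := hsp x hx
    refine ⟨c 7 - c 8, fun i => if i.val = 7 then 2 * c 8 - c 7 else c i.val, ?_⟩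
    rw [hc]
    simp [Finset.sum_Ico_eq_sum_range, Finset.sum_range_succ, Fin.sum_univ_eight]
    module

end even
end K3
end

section
namespace K3
section even2
variable {V : Type*} [AddCommGroup V] [Module ℚ V] {B : LinearMap.BilinForm ℚ V}

theorem coord_h {g : V} {h : Fin 8 → V} (hgh : ∀ i, B g (h i) = 0)
    (hh : ∀ i j, B (h i) (h j) = if i = j then -1 else 0) (n : ℚ) (c : Fin 8 → ℚ) (j : Fin 8) :
    B (n • g + ∑ i, c i • h i) (h j) = - c j := by
  simp only [map_add, LinearMap.add_apply, map_smul, LinearMap.smul_apply, map_sum, LinearMap.sum_apply,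
    hgh, hh, smul_eq_mul]
  simp

theorem coord_g (hs : ∀ x y, B x y = B y x) {g : V} {h : Fin 8 → V} (hgg : B g g = 2)
    (hgh : ∀ i, B g (h i) = 0) (n : ℚ) (c : Fin 8 → ℚ) :
    B (n • g + ∑ i, c i • h i) g = 2 * n := by
  simp only [map_add, LinearMap.add_apply, map_smul, LinearMap.smul_apply, map_sum, LinearMap.sum_apply,
    hgg, hs _ g, hgh, smul_eq_mul]
  simp [mul_comm]

theorem coord_norm (hs : ∀ x y, B x y = B y x) {g : V} {h : Fin 8 → V} (hgg : B g g = 2)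
    (hgh : ∀ i, B g (h i) = 0)
    (hh : ∀ i j, B (h i) (h j) = if i = j then -1 else 0) (n : ℚ) (c : Fin 8 → ℚ) :
    B (n • g + ∑ i, c i • h i) (n • g + ∑ i, c i • h i) = 2 * n * n - ∑ i, c i * c i := by
  conv_lhs => rw [map_add, map_smul, map_sum]
  simp only [map_smul, coord_h hgh hh, coord_g hs hgg hgh, smul_eq_mul]
  simp only [mul_neg, Finset.sum_neg_distrib]; ring

theorem even_sum_sq (c : Fin 8 → ℤ) : Even (∑ i, c i * c i) ↔ Even (∑ i, c i) := by
  simp only [Fin.sum_univ_eight, Int.even_add, Int.even_mul, and_self, or_self]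

theorem even_class1 (hs : ∀ x y, B x y = B y x) {W : Submodule ℚ V} {M : AddSubgroup V} {μ : V}
    (H : Lat B W M μ) (hev : ∀ x ∈ M, ∃ n : ℤ, B x x = 2 * n) (F : HasFrame B W dn 0 9) :
    ∃ g ∈ M, ∃ (h : Fin 8 → V) (b : Fin 8 → ℤ), B g g = 2 ∧ (∀ i, B g (h i) = 0) ∧
      (∀ i j, B (h i) (h j) = if i = j then -1 else 0) ∧
      (∀ c : Fin 8 → ℤ, Even (∑ i, c i) → ∑ i, (c i : ℚ) • h i ∈ M) ∧
      ∑ i, ((b i : ℚ) + 1 / 2) • h i ∈ M ∧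
      ∀ x ∈ M, ∃ (n q : ℤ) (c : Fin 8 → ℤ), Even (∑ i, c i) ∧
        x = (n : ℚ) • g + ∑ i, (c i : ℚ) • h i + (q : ℚ) • ∑ i, ((b i : ℚ) + 1 / 2) • h i := by
  have nd : ∀ x ∈ W, (∀ y ∈ W, B x y = 0) → x = 0 := fun x hx h => F.nondeg (fun i _ => dn_ne i) hx h
  obtain ⟨e, he, hee, f0, hf0, hef0⟩ : ∃ e ∈ M, B e e = 0 ∧ ∃ f ∈ M, B e f = 1 := by
    obtain ⟨w, hw, hwW, hsp⟩ := F
    have h1 := hw 0 (by simp) 0 (by simp)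
    have h2 := hw 7 (by simp) 7 (by simp)
    have h3 := hw 0 (by simp) 7 (by simp)
    have h4 := hw 7 (by simp) 0 (by simp)
    simp [dn] at h1 h2 h3 h4
    refine H.iso_split hs nd (z := w 0 + w 7) (W.add_mem (hwW 0 (by simp)) (hwW 7 (by simp))) ?_ ?_
    · intro h0
      have := congrArg (fun x => B x (w 7)) h0
      simp [h2, h3] at this
    · simp [h1, h2, h3, h4]
  obtain ⟨f, hf, hef, hff⟩ : ∃ f ∈ M, B e f = 1 ∧ B f f = 0 := by
    obtain ⟨n, hn⟩ := hev f0 hf0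
    refine ⟨f0 - (n : ℚ) • e, M.sub_mem hf0 (zsm he _), ?_, ?_⟩
    · simp [hef0, hee]
    · simp only [map_sub, map_smul, smul_eq_mul, LinearMap.sub_apply, LinearMap.smul_apply, hs f0 e,
        hef0, hee, hn]; ring
  have hfe : B f e = 1 := by rw [hs, hef]
  obtain ⟨μ', H', hμe, hμf⟩ : ∃ μ', Lat B W M μ' ∧ B μ' e = 0 ∧ B μ' f = 0 := by
    obtain ⟨p, hp⟩ := H.ev e he
    obtain ⟨q, hq⟩ := H.ev f hf
    refine ⟨_, H.change hs (m := (q : ℚ) • e + (p : ℚ) • f) (M.add_mem (zsm he _) (zsm hf _)), ?_, ?_⟩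
    · simp [hp, hee, hfe]
    · simp [hq, hff, hef]
  clear H
  have HX := nbr_lat hs H' he hf hee hff hef hμe hμf
  set X := nbr B M e f hff hef with hXdef
  have hXev : ∀ {x}, x ∈ X → ∀ {j : ℤ}, B x x = 2 * j → x ∈ M ∧ ∃ k : ℤ, B x f = 2 * k :=
    fun hx _ hj => nbr_even hs H' hev he hf hee hff hef hx hj
  obtain ⟨g, hg, h, hhX, hgg, hgh, hh, hsp⟩ := odd_class' hs HX F
    ⟨e + (1/2 : ℚ) • f, ⟨0, M.zero_mem, 1, 0, by simp, by simp⟩, by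
      simp [hee, hff, hef, hfe]; norm_num⟩
  have hgM : g ∈ M := (hXev hg (j := 1) (by rw [hgg]; norm_num)).1
  have hcX : ∀ c : Fin 8 → ℤ, ∑ i, (c i : ℚ) • h i ∈ X := fun c =>
    X.sum_mem (fun i _ => zsm (hhX i) _)
  have hcM : ∀ c : Fin 8 → ℤ, Even (∑ i, c i) → ∑ i, (c i : ℚ) • h i ∈ M := by
    intro c hc
    obtain ⟨r, hr⟩ := (even_sum_sq c).mpr hc
    refine (hXev (hcX c) (j := -r) ?_).1
    have := coord_norm hs hgg hgh hh 0 (fun i => (c i : ℚ))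
    rw [zero_smul, zero_add] at this
    rw [this]
    have : ∑ i, (c i : ℚ) * c i = r + r := by exact_mod_cast hr
    rw [this]; push_cast; ring
  -- coordinates of e
  obtain ⟨α, β, hαβ⟩ : ∃ (α : ℚ) (β : Fin 8 → ℚ), e = α • g + ∑ i, β i • h i := by
    obtain ⟨N, hN, hNe⟩ := HX.full e (H'.sub e he)
    obtain ⟨n, c, hc⟩ := hsp _ hNe
    have hNQ : (N : ℚ) ≠ 0 := by exact_mod_cast hN
    refine ⟨n / N, fun i => c i / N, ?_⟩
    have : e = (1 / (N : ℚ)) • ((N : ℚ) • e) := by rw [smul_smul]; field_simp; simp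
    rw [this, hc, smul_add, Finset.smul_sum, smul_smul]
    congr 1
    · congr 1; ring
    · apply Finset.sum_congr rfl; intro i _; rw [smul_smul]; congr 1; ring
  obtain ⟨a, ha⟩ := H'.int e he g hgM
  have ha2 : α = a / 2 := by
    rw [hαβ, coord_g hs hgg hgh] at ha; linarith
  have hpair : ∀ i j : Fin 8, ∃ n : ℤ, β i + β j = n := by
    intro i j
    have hm : h i + h j ∈ M := by
      have := hcM (fun k => (if k = i then 1 else 0) + (if k = j then 1 else 0)) (by
        rw [Finset.sum_add_distrib]; simp)
      simpa [add_smul, Finset.sum_add_distrib] using this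
    obtain ⟨n, hn⟩ := H'.int e he _ hm
    rw [hαβ, map_add, coord_h hgh hh, coord_h hgh hh] at hn
    exact ⟨-n, by push_cast; linarith⟩
  have hnorm : (a : ℚ) * a / 2 = ∑ i, β i * β i := by
    have := hee
    rw [hαβ, coord_norm hs hgg hgh hh, ha2] at this
    linarith
  choose p hp using fun i => hpair i i
  obtain ⟨b, a', hb, ha'⟩ : ∃ (b : Fin 8 → ℤ) (a' : ℤ), (∀ i, β i = b i + 1 / 2) ∧ a = 2 * a' := by
    rcases Int.even_or_odd' (p 0) with ⟨k, hk | hk⟩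
    · exfalso
      have : ∀ i, ∃ b : ℤ, β i = b := by
        intro i
        obtain ⟨n, hn⟩ := hpair i 0
        have := hp 0
        rw [hk] at this; push_cast at this
        exact ⟨n - k, by push_cast; linarith⟩
      choose b hb using this
      have h1 : a * a = 2 * ∑ i, b i * b i := by
        have : ((a * a : ℤ) : ℚ) = ((2 * ∑ i, b i * b i : ℤ) : ℚ) := by
          push_cast
          simp only [hb] at hnorm; linarith
        exact_mod_cast this
      have h2 : Even a := by
        have : Even (a * a) := by rw [h1]; exact even_two_mul _
        rw [Int.even_mul] at this; tauto
      obtain ⟨r, rfl⟩ := h2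
      have heX : e ∈ X := by
        rw [hαβ, ha2]
        have : (((r + r : ℤ) : ℚ) / 2) = (r : ℚ) := by push_cast; ring
        rw [this]
        simp only [hb]
        exact X.add_mem (zsm hg _) (hcX b)
      obtain ⟨_, k, hk⟩ := hXev heX (j := 0) (by simp [hee])
      rw [hef] at hk
      have : (1 : ℤ) = 2 * k := by exact_mod_cast hk
      omega
    · have : ∀ i, ∃ b : ℤ, β i = b + 1 / 2 := by
        intro i
        obtain ⟨n, hn⟩ := hpair i 0
        have := hp 0
        rw [hk] at this; push_cast at this
        exact ⟨n - k - 1, by push_cast; linarith⟩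
      choose b hb using this
      have h1 : a * a = 2 * ∑ i, (b i * (b i + 1)) + 4 := by
        have : ((a * a : ℤ) : ℚ) = ((2 * ∑ i, (b i * (b i + 1)) + 4 : ℤ) : ℚ) := by
          push_cast
          simp only [hb] at hnorm
          rw [Fin.sum_univ_eight] at hnorm ⊢
          linarith
        exact_mod_cast this
      have h2 : Even a := by
        have : Even (a * a) := by
          rw [h1]; exact (even_two_mul _).add ⟨2, rfl⟩
        rw [Int.even_mul] at this; tauto
      obtain ⟨r, rfl⟩ := h2
      exact ⟨b, r, hb, by ring⟩
  have hαa : α = a' := by rw [ha2, ha']; push_cast; ring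
  have hes : e = (a' : ℚ) • g + ∑ i, ((b i : ℚ) + 1 / 2) • h i := by
    rw [hαβ, hαa]; simp only [hb]
  refine ⟨g, hgM, h, b, hgg, hgh, hh, hcM, ?_, ?_⟩
  · have : ∑ i, ((b i : ℚ) + 1 / 2) • h i = e - (a' : ℚ) • g := by rw [hes]; module
    rw [this]; exact M.sub_mem he (zsm hgM _)
  · intro x hx
    obtain ⟨q, hq⟩ := H'.int x hx f hf
    have hxX : x - (q : ℚ) • e ∈ X := ⟨x - (q : ℚ) • e, M.sub_mem hx (zsm he _), 0, 0, by simp [hq, hef], by simp⟩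
    obtain ⟨j, hj⟩ := hev _ (M.sub_mem hx (zsm he q))
    obtain ⟨n, c, hc⟩ := hsp _ hxX
    refine ⟨n + q * a', q, c, ?_, ?_⟩
    · rw [hc, coord_norm hs hgg hgh hh] at hj
      rw [← even_sum_sq]
      refine ⟨n * n - j, ?_⟩
      have : ((∑ i, c i * c i : ℤ) : ℚ) = ((n * n - j + (n * n - j) : ℤ) : ℚ) := by
        push_cast; linarith
      exact_mod_cast this
    · have : x = (x - (q : ℚ) • e) + (q : ℚ) • e := by module
      rw [this, hc, hes]; push_cast; module

theorem even_class (hs : ∀ x y, B x y = B y x) {W : Submodule ℚ V} {M : AddSubgroup V} {μ : V}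
    (H : Lat B W M μ) (hev : ∀ x ∈ M, ∃ n : ℤ, B x x = 2 * n) (F : HasFrame B W dn 0 9) :
    ∃ g ∈ M, ∃ h : Fin 8 → V, B g g = 2 ∧ (∀ i, B g (h i) = 0) ∧
      (∀ i j, B (h i) (h j) = if i = j then -1 else 0) ∧
      (∀ c : Fin 8 → ℤ, Even (∑ i, c i) → ∑ i, (c i : ℚ) • h i ∈ M) ∧
      (1 / 2 : ℚ) • ∑ i, h i ∈ M ∧
      ∀ x ∈ M, ∃ (n q : ℤ) (c : Fin 8 → ℤ), Even (∑ i, c i) ∧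
        x = (n : ℚ) • g + ∑ i, ((c i : ℚ) + q / 2) • h i := by
  obtain ⟨g, hg, h, b, hgg, hgh, hh, hcM, hsM, hsp⟩ := even_class1 hs H hev F
  by_cases hb : Even (∑ i, b i)
  · refine ⟨g, hg, h, hgg, hgh, hh, hcM, ?_, ?_⟩
    · have : (1 / 2 : ℚ) • ∑ i, h i = ∑ i, ((b i : ℚ) + 1 / 2) • h i - ∑ i, (b i : ℚ) • h i := by
        rw [← Finset.sum_sub_distrib, Finset.smul_sum]
        apply Finset.sum_congr rfl; intro i _; module
      rw [this]; exact M.sub_mem hsM (hcM b hb)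
    · intro x hx
      obtain ⟨n, q, c, hc, rfl⟩ := hsp x hx
      refine ⟨n, q, fun i => c i + q * b i, ?_, ?_⟩
      · rw [Finset.sum_add_distrib, ← Finset.mul_sum]; exact hc.add (hb.mul_left _)
      · rw [Finset.smul_sum, add_assoc, ← Finset.sum_add_distrib]
        congr 1
        apply Finset.sum_congr rfl; intro i _; push_cast; module
  · have hodd : Odd (∑ i, b i) := Int.not_even_iff_odd.mp hb
    let σ : Fin 8 → ℤ := fun i => if i = 7 then -1 else 1
    let δ : Fin 8 → ℤ := fun i => if i = 7 then 1 else 0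
    have hσ : ∀ i, (σ i : ℚ) * σ i = 1 := by intro i; simp only [σ]; split_ifs <;> norm_num
    have hσδ : ∀ i, (σ i : ℚ) = 1 - 2 * δ i := by
      intro i; simp only [σ, δ]; split_ifs <;> norm_num
    have hσδZ : ∀ i, σ i = 1 - 2 * δ i := by
      intro i; simp only [σ, δ]; split_ifs <;> norm_num
    have hδ : ∑ i, δ i = 1 := by simp [δ]
    have par : ∀ c : Fin 8 → ℤ, Even (∑ i, c i * σ i) ↔ Even (∑ i, c i) := by
      intro c
      have : ∑ i, c i * σ i = ∑ i, c i - 2 * ∑ i, c i * δ i := by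
        rw [Finset.mul_sum, ← Finset.sum_sub_distrib]
        apply Finset.sum_congr rfl; intro i _; rw [hσδZ]; ring
      rw [this, Int.even_sub]; simp
    refine ⟨g, hg, fun i => (σ i : ℚ) • h i, hgg, ?_, ?_, ?_, ?_, ?_⟩
    · intro i; simp [hgh]
    · intro i j
      simp only [map_smul, LinearMap.smul_apply, hh, smul_eq_mul]
      split_ifs with hij
      · subst hij; linear_combination (-1 : ℚ) * hσ i
      · ring
    · intro c hc
      have := hcM (fun i => c i * σ i) ((par c).mpr hc)
      simpa [smul_smul] using this
    · have : (1 / 2 : ℚ) • ∑ i, (σ i : ℚ) • h i =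
          ∑ i, ((b i : ℚ) + 1 / 2) • h i - ∑ i, ((b i + δ i : ℤ) : ℚ) • h i := by
        rw [← Finset.sum_sub_distrib, Finset.smul_sum]
        apply Finset.sum_congr rfl; intro i _; rw [hσδ]; push_cast; module
      rw [this]; refine M.sub_mem hsM (hcM _ ?_)
      rw [Finset.sum_add_distrib, hδ]; exact hodd.add_one
    · intro x hx
      obtain ⟨n, q, c, hc, rfl⟩ := hsp x hx
      refine ⟨n, q, fun i => (c i + q * (b i + δ i)) * σ i, ?_, ?_⟩
      · rw [par, Finset.sum_add_distrib, ← Finset.mul_sum, Finset.sum_add_distrib, hδ]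
        exact hc.add (hodd.add_one.mul_left _)
      · rw [Finset.smul_sum, add_assoc, ← Finset.sum_add_distrib]
        congr 1
        apply Finset.sum_congr rfl; intro i _
        rw [smul_smul, smul_smul, ← add_smul]
        congr 1
        push_cast
        linear_combination (-(c i + q * (b i + δ i) : ℚ)) * hσ i - (q/2 : ℚ) * hσδ i
end even2
end K3
end

section
namespace K3
section basisF
variable {V : Type*} [AddCommGroup V] [Module ℚ V] {B : LinearMap.BilinForm ℚ V}

/-- Twice the coordinates of the simple roots of `E8`. -/
def rootZ : Matrix (Fin 8) (Fin 8) ℤ :=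
  !![1,-1,-1,-1,-1,-1,-1,1;
     -2,2,0,0,0,0,0,0;
     0,-2,2,0,0,0,0,0;
     0,0,-2,2,0,0,0,0;
     0,0,0,-2,2,0,0,0;
     0,0,0,0,-2,2,0,0;
     0,0,0,0,0,-2,2,0;
     2,2,0,0,0,0,0,0]

theorem rootZ_gram : ∀ i j : Fin 8, ∑ k, rootZ i k * rootZ j k = 4 * cartanE8 i.val j.val := by
  decide +kernel

theorem even_basis (hs : ∀ x y, B x y = B y x) {W : Submodule ℚ V} {M : AddSubgroup V} {μ : V}
    (H : Lat B W M μ) (hev : ∀ x ∈ M, ∃ n : ℤ, B x x = 2 * n) (F : HasFrame B W dn 0 9) :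
    ∃ g ∈ M, ∃ (α : Fin 8 → V), B g g = 2 ∧ (∀ i, B g (α i) = 0) ∧ (∀ i, α i ∈ M) ∧
      (∀ i j, B (α i) (α j) = -(cartanE8 i.val j.val : ℚ)) ∧
      ∀ x ∈ M, ∃ (n : ℤ) (c : Fin 8 → ℤ), x = (n : ℚ) • g + ∑ i, (c i : ℚ) • α i := by
  obtain ⟨g, hg, h, hgg, hgh, hh, hc, hhalf, hsp⟩ := even_class hs H hev F
  refine ⟨g, hg, fun i => ∑ k, ((rootZ i k : ℚ) / 2) • h k, hgg, ?_, ?_, ?_, ?_⟩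
  · intro i
    simp [map_sum, hgh]
  · intro i
    by_cases hi : i = 0
    · subst hi
      have h1 := hc ![0,-1,-1,-1,-1,-1,-1,0] (by decide)
      have h2 := M.add_mem h1 hhalf
      convert h2 using 1
      rw [Finset.smul_sum, ← Finset.sum_add_distrib]
      refine Finset.sum_congr rfl fun k _ => ?_
      rw [← add_smul]
      congr 1
      fin_cases k <;> norm_num [rootZ]
    · have key : ∀ i : Fin 8, i ≠ 0 → Even (∑ k, rootZ i k / 2) ∧
          ∀ k, rootZ i k = 2 * (rootZ i k / 2) := by
        have k1 : ∀ i : Fin 8, i = 0 ∨ (∑ k, rootZ i k / 2) % 2 = 0 := by decide +kernel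
        have k2 : ∀ i k : Fin 8, i = 0 ∨ rootZ i k % 2 = 0 := by decide +kernel
        exact fun i hi => ⟨Int.even_iff.mpr ((k1 i).resolve_left hi), fun k => by
          have := (k2 i k).resolve_left hi
          omega⟩
      have h1 := hc (fun k => rootZ i k / 2) (key i hi).1
      convert h1 using 1
      refine Finset.sum_congr rfl fun k _ => ?_
      congr 1
      have := (key i hi).2 k
      have h3 : (rootZ i k : ℚ) = 2 * ((rootZ i k / 2 : ℤ) : ℚ) := by exact_mod_cast this
      linarith
  · intro i j
    simp only [map_sum, LinearMap.sum_apply, map_smul, LinearMap.smul_apply, hh, smul_eq_mul]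
    have := rootZ_gram i j
    have h3 : (∑ k, (rootZ i k : ℚ) * rootZ j k) = 4 * cartanE8 i.val j.val := by exact_mod_cast this
    have h4 : (cartanE8 i.val j.val : ℚ) = (∑ k, (rootZ i k : ℚ) * rootZ j k) / 4 := by rw [h3]; ring
    rw [h4]
    simp only [mul_ite, mul_zero, Finset.sum_ite_eq', Finset.mem_univ, if_true]
    rw [Finset.sum_div, ← Finset.sum_neg_distrib]
    refine Finset.sum_congr rfl fun k _ => ?_
    ring
  · intro x hx
    obtain ⟨n, q, c, ⟨s, hsum⟩, rfl⟩ := hsp x hx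
    have hs0 : c 0 = s + s - c 1 - c 2 - c 3 - c 4 - c 5 - c 6 - c 7 := by
      rw [Fin.sum_univ_eight] at hsum; linarith
    refine ⟨n, ![2 * c 7 + q, (s + 3 * q + 2 * c 7) + c 7 - c 0, c 2 + c 3 + c 4 + c 5 + c 6 + 5 * c 7 + 5 * q,
      c 3 + c 4 + c 5 + c 6 + 4 * c 7 + 4 * q, c 4 + c 5 + c 6 + 3 * c 7 + 3 * q,
      c 5 + c 6 + 2 * c 7 + 2 * q, c 6 + c 7 + q, s + 3 * q + 2 * c 7 - q + q - q + q], ?_⟩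
    congr 1
    simp only [Finset.smul_sum, smul_smul]
    rw [Finset.sum_comm]
    refine Finset.sum_congr rfl fun k _ => ?_
    rw [← Finset.sum_smul]
    congr 1
    rw [Fin.sum_univ_eight]
    have hsq : (c 0 : ℚ) = s + s - c 1 - c 2 - c 3 - c 4 - c 5 - c 6 - c 7 := by exact_mod_cast hs0
    fin_cases k <;> simp [rootZ] <;> linarith
end basisF
end K3
end

section
open Matrix
namespace K3

/-- The inverse of the Cartan matrix of `E8`. -/
def cinvN (a b : ℕ) : ℤ :=
  (([[4,7,10,8,6,4,2,5],
    [7,14,20,16,12,8,4,10],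
    [10,20,30,24,18,12,6,15],
    [8,16,24,20,15,10,5,12],
    [6,12,18,15,12,8,4,9],
    [4,8,12,10,8,6,3,6],
    [2,4,6,5,4,3,2,3],
    [5,10,15,12,9,6,3,8]] : List (List ℤ)).getD a []).getD b 0

/-- The inverse of the Gram matrix of the K3 lattice. -/
def GInv : Matrix (Fin 22) (Fin 22) ℤ := Matrix.of fun i j =>
  if i.val < 8 then
    (if j.val < 8 then -(cinvN i.val j.val) else 0)
  else if i.val < 16 then
    (if 8 ≤ j.val ∧ j.val < 16 then -(cinvN (i.val - 8) (j.val - 8)) else 0)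
  else if j.val < 16 then 0
  else if i.val / 2 = j.val / 2 then (if i = j then 0 else 1)
  else 0

/-- Half of the Gram matrix of the K3 lattice. -/
def GHalf : Matrix (Fin 22) (Fin 22) ℤ := Matrix.of fun i j =>
  if i < j then GramK3 i j else if i = j then GramK3 i j / 2 else 0

theorem gram_mul_inv : GramK3 * GInv = 1 := by decide +kernel

theorem gram_half : GramK3 = GHalf + GHalfᵀ := by decide +kernel

theorem gram_symm : GramK3ᵀ = GramK3 := by decide +kernel

/-- The K3 form with coefficients in `R`. -/
noncomputable def BR (R : Type) [CommRing R] : LinearMap.BilinForm R (Fin 22 → R) :=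
  Matrix.toBilin' (GramK3.map (Int.cast : ℤ → R))

/-- Cast of integral vectors. -/
def cv (R : Type) [CommRing R] : (Fin 22 → ℤ) →+ (Fin 22 → R) where
  toFun x := fun i => (x i : R)
  map_zero' := by ext; simp
  map_add' x y := by ext; simp

@[simp] theorem cv_apply (R : Type) [CommRing R] (x : Fin 22 → ℤ) (i) : cv R x i = (x i : R) := rfl

theorem cv_smul (R : Type) [CommRing R] (n : ℤ) (x : Fin 22 → ℤ) : cv R (n • x) = (n : R) • cv R x := by
  ext; simp

theorem BR_cast {R : Type} [CommRing R] (x y : Fin 22 → ℤ) :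
    BR R (cv R x) (cv R y) = ((BR ℤ x y : ℤ) : R) := by
  simp [BR, Matrix.toBilin'_apply]

theorem BR_int (x y : Fin 22 → ℤ) : BR ℤ x y = BG GramK3 x y := by
  have : GramK3.map (Int.cast : ℤ → ℤ) = GramK3 := by ext; simp
  simp [BR, this, Matrix.toBilin'_apply', BG]

theorem BR_symm {R : Type} [CommRing R] (x y : Fin 22 → R) : BR R x y = BR R y x := by
  simp only [BR, Matrix.toBilin'_apply]
  rw [Finset.sum_comm]
  refine Finset.sum_congr rfl fun i _ => Finset.sum_congr rfl fun j _ => ?_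
  have : GramK3 j i = GramK3 i j := congrFun (congrFun gram_symm i) j
  simp [this]; ring

/-- Dual basis. -/
def gd (j : Fin 22) : Fin 22 → ℤ := fun i => GInv i j

theorem BR_gd {R : Type} [CommRing R] (x : Fin 22 → R) (j : Fin 22) :
    BR R x (cv R (gd j)) = x j := by
  have h : (GramK3.map (Int.cast : ℤ → R)) * (GInv.map (Int.cast : ℤ → R)) = 1 := by
    have := congrArg (Int.castRingHom R).mapMatrix gram_mul_inv
    rw [map_mul, map_one] at this
    exact this
  have h2 : (GramK3.map (Int.cast : ℤ → R)) *ᵥ (cv R (gd j)) = Pi.single j 1 := by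
    ext i
    have := congrFun (congrFun h i) j
    rw [Matrix.mul_apply] at this
    simp only [Matrix.mulVec, dotProduct, cv_apply, gd]
    simp only [Matrix.map_apply] at this ⊢
    rw [this, Matrix.one_apply, Pi.single_apply]
  rw [BR, Matrix.toBilin'_apply', h2]
  simp

theorem BR_ext {R : Type} [CommRing R] {x : Fin 22 → R} (h : ∀ z : Fin 22 → ℤ, BR R x (cv R z) = 0) :
    x = 0 := by
  ext j; rw [← BR_gd x j, h]; rfl

theorem BR_integral {x : Fin 22 → ℚ} (h : ∀ z : Fin 22 → ℤ, ∃ n : ℤ, BR ℚ x (cv ℚ z) = n) :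
    ∃ l, x = cv ℚ l := by
  choose f hf using h
  exact ⟨fun j => f (gd j), by ext j; rw [← BR_gd x j, hf]; rfl⟩

theorem BR_even (x : Fin 22 → ℤ) : ∃ n : ℤ, BR ℤ x x = 2 * n := by
  refine ⟨x ⬝ᵥ GHalf *ᵥ x, ?_⟩
  rw [BR_int, BG, gram_half, Matrix.add_mulVec, dotProduct_add, two_mul]
  congr 1
  rw [Matrix.mulVec_transpose, dotProduct_comm, ← Matrix.dotProduct_mulVec]

theorem cv_inj : Function.Injective (cv ℚ) := by
  intro x y h
  ext i
  have := congrFun h i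
  simpa using this

theorem BR_nondeg (R : Type) [Field R] : (BR R).Nondegenerate := by
  have h1 : ∀ x, (∀ y, BR R x y = 0) → x = 0 := fun x h => BR_ext fun z => h _
  refine ⟨h1, fun y h => h1 y fun x => ?_⟩
  rw [BR_symm]; exact h x

theorem BR_refl (R : Type) [CommRing R] : (BR R).IsRefl := by
  intro x y h; rw [BR_symm]; exact h

end K3
end

section
open Matrix
namespace K3
set_option linter.unusedSimpArgs false

/-- A primitive system of vectors with Gram matrix `GT` and a dual system. -/
structure Emb (t y : Fin 11 → Fin 22 → ℤ) : Prop where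
  ht : ∀ i j, BR ℤ (t i) (t j) = GT i j
  hy : ∀ i j, BR ℤ (t i) (y j) = if i = j then 1 else 0

/-- The orthogonal complement. -/
def InK (t : Fin 11 → Fin 22 → ℤ) (z : Fin 22 → ℤ) : Prop := ∀ i, BR ℤ z (t i) = 0

theorem gt0 : ∀ i, GT 0 i = if i = 1 then 1 else 0 := by decide +kernel
theorem gt1 : ∀ i, GT 1 i = if i = 0 then 1 else 0 := by decide +kernel
theorem gt_even : ∀ i j : Fin 11, 2 ≤ i.val → GT i j % 2 = 0 := by decide +kernel
theorem gt_symm : GTᵀ = GT := by decide +kernel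

theorem InK.add {t : Fin 11 → Fin 22 → ℤ} {a b} (ha : InK t a) (hb : InK t b) : InK t (a + b) := by
  intro i; simp [ha i, hb i]
theorem InK.sub {t : Fin 11 → Fin 22 → ℤ} {a b} (ha : InK t a) (hb : InK t b) : InK t (a - b) := by
  intro i; simp [ha i, hb i]
theorem InK.smul {t : Fin 11 → Fin 22 → ℤ} {a} (ha : InK t a) (n : ℤ) : InK t (n • a) := by
  intro i; rw [map_smul, LinearMap.smul_apply, ha i]; simp

variable {t y : Fin 11 → Fin 22 → ℤ}

theorem lemC (E : Emb t y) (z : Fin 22 → ℤ) (h : ∀ i : Fin 11, 2 ≤ i.val → 2 ∣ BR ℤ z (t i)) :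
    ∃ k l, InK t k ∧ z = k + BR ℤ z (t 1) • t 0 + BR ℤ z (t 0) • t 1 + (2 : ℤ) • l := by
  set p := BR ℤ z (t 1)
  set q := BR ℤ z (t 0)
  set z' := z - p • t 0 - q • t 1 with hz'
  have hz : ∀ i, BR ℤ z' (t i) = BR ℤ z (t i) - p * GT 0 i - q * GT 1 i := by
    intro i; simp [hz', E.ht, -zsmul_eq_mul]
  have hd : ∀ i, ∃ m, BR ℤ z' (t i) = 2 * m := by
    intro i
    by_cases hi : 2 ≤ i.val
    · obtain ⟨m, hm⟩ := h i hi
      refine ⟨m, ?_⟩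
      rw [hz, gt0, gt1, if_neg (by rintro rfl; simp at hi), if_neg (by rintro rfl; simp at hi), hm]
      ring
    · refine ⟨0, ?_⟩
      have : i = 0 ∨ i = 1 := by omega
      rcases this with rfl | rfl
      · rw [hz, gt0, gt1]; simp [q]
      · rw [hz, gt0, gt1]; simp [p]
  choose m hm using hd
  refine ⟨z' - (2 : ℤ) • ∑ i, m i • y i, ∑ i, m i • y i, ?_, ?_⟩
  · intro j
    simp only [map_sub, LinearMap.sub_apply, map_smul, LinearMap.smul_apply, map_sum,
      LinearMap.sum_apply, hm, BR_symm (y _), E.hy, smul_eq_mul]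
    simp
  · rw [hz']; abel

theorem parity (n : ℤ) : ((n : ℤ) : ZMod 2) = 0 ↔ 2 ∣ n := by
  simpa using ZMod.intCast_zmod_eq_zero_iff_dvd n 2

theorem cv2_zero {x : Fin 22 → ℤ} (h : cv (ZMod 2) x = 0) : ∃ l, x = (2 : ℤ) • l := by
  have : ∀ i, 2 ∣ x i := fun i => (parity _).mp (congrFun h i)
  choose l hl using this
  exact ⟨l, by ext i; simp [hl]⟩

theorem cv2_surj (x : Fin 22 → ZMod 2) : ∃ z, cv (ZMod 2) z = x := by
  refine ⟨fun i => ((x i).val : ℤ), ?_⟩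
  ext i
  simp

theorem zmod2_surj (c : ZMod 2) : ∃ n : ℤ, (n : ZMod 2) = c := ⟨(c.val : ℤ), by simp⟩

theorem BR_t2 (E : Emb t y) (i j) : BR (ZMod 2) (cv _ (t i)) (cv _ (y j)) = if i = j then 1 else 0 := by
  rw [BR_cast, E.hy]; split_ifs <;> simp

theorem indep_t (E : Emb t y) : LinearIndependent (ZMod 2) (fun i => cv (ZMod 2) (t i)) := by
  rw [Fintype.linearIndependent_iff]
  intro g hg j
  have := congrArg (fun v => BR (ZMod 2) v (cv _ (y j))) hg
  simpa [BR_t2 E] using this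

/-- The span mod 2 of the `t i` with `i` in a set. -/
noncomputable def spanT (t : Fin 11 → Fin 22 → ℤ) (s : Set (Fin 11)) : Submodule (ZMod 2) (Fin 22 → ZMod 2) :=
  Submodule.span (ZMod 2) ((fun i => cv (ZMod 2) (t i)) '' s)

theorem finrank_spanT (E : Emb t y) (s : Finset (Fin 11)) :
    Module.finrank (ZMod 2) (spanT t s) = s.card := by
  have h := (indep_t E).comp (fun i : s => (i : Fin 11)) Subtype.val_injective
  have h2 := finrank_span_eq_card h
  rw [Fintype.card_coe] at h2
  have h3 : (fun i => cv (ZMod 2) (t i)) '' (s : Set (Fin 11)) =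
      Set.range ((fun i => cv (ZMod 2) (t i)) ∘ fun i : s => (i : Fin 11)) := by
    ext x; simp [Set.mem_range]
  rw [← h2, spanT, h3]

theorem mem_orth_spanT (s : Set (Fin 11)) (z : Fin 22 → ℤ) :
    cv (ZMod 2) z ∈ (BR (ZMod 2)).orthogonal (spanT t s) ↔ ∀ i ∈ s, 2 ∣ BR ℤ z (t i) := by
  rw [LinearMap.BilinForm.mem_orthogonal_iff]
  constructor
  · intro h i hi
    have := h (cv _ (t i)) (Submodule.subset_span ⟨i, hi, rfl⟩)
    rw [BR_symm, BR_cast, parity] at this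
    exact this
  · intro h x hx
    induction hx using Submodule.span_induction with
    | mem x hx =>
      obtain ⟨i, hi, rfl⟩ := hx
      show BR _ _ _ = 0
      rw [BR_symm, BR_cast, parity]
      exact h i hi
    | zero => show BR _ _ _ = 0; simp
    | add a b _ _ ha hb =>
      change BR _ _ _ = 0 at ha hb
      show BR _ _ _ = 0
      rw [map_add, LinearMap.add_apply, ha, hb, add_zero]
    | smul r a _ ha =>
      change BR _ _ _ = 0 at ha
      show BR _ _ _ = 0
      rw [map_smul, LinearMap.smul_apply, ha, smul_zero]

/-- Indices at least two. -/
def sR : Finset (Fin 11) := {2,3,4,5,6,7,8,9,10}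

theorem mem_sR : ∀ i, i ∈ sR ↔ 2 ≤ i.val := by decide +kernel

theorem finrank_orth (W : Submodule (ZMod 2) (Fin 22 → ZMod 2)) :
    Module.finrank (ZMod 2) ((BR (ZMod 2)).orthogonal W) = 22 - Module.finrank (ZMod 2) W := by
  have := LinearMap.BilinForm.finrank_orthogonal (BR_nondeg (ZMod 2)) W
  simpa using this

theorem expand13 (E : Emb t y) {b c : Fin 22 → ℤ} (hb : InK t b) (hc : InK t c)
    (hbc : ¬ 2 ∣ BR ℤ b c) (x : Fin 22 → ℤ) (hx : ∀ i : Fin 11, 2 ≤ i.val → 2 ∣ BR ℤ x (t i)) :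
    ∃ (r : Fin 11 → ℤ) (p q : ℤ) (l : Fin 22 → ℤ), x = ∑ i, r i • t i + p • b + q • c + (2 : ℤ) • l := by
  let v : Fin 11 ⊕ Fin 2 → (Fin 22 → ZMod 2) :=
    Sum.elim (fun i => cv (ZMod 2) (t i)) (fun i => cv (ZMod 2) (![b, c] i))
  have hbb : BR (ZMod 2) (cv _ b) (cv _ b) = 0 := by
    rw [BR_cast, parity]; exact (BR_even b).imp fun n h => h
  have hcc : BR (ZMod 2) (cv _ c) (cv _ c) = 0 := by
    rw [BR_cast, parity]; exact (BR_even c).imp fun n h => h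
  have hbc1 : BR (ZMod 2) (cv _ b) (cv _ c) ≠ 0 := by
    rw [BR_cast, Ne, parity]; exact hbc
  have htb : ∀ i, BR (ZMod 2) (cv _ (t i)) (cv _ b) = 0 := by
    intro i; rw [BR_symm, BR_cast, hb i]; simp
  have htc : ∀ i, BR (ZMod 2) (cv _ (t i)) (cv _ c) = 0 := by
    intro i; rw [BR_symm, BR_cast, hc i]; simp
  have hli : LinearIndependent (ZMod 2) v := by
    rw [Fintype.linearIndependent_iff]
    intro g hg
    rw [Fintype.sum_sum_type, Fin.sum_univ_two] at hg
    simp only [v, Sum.elim_inl, Sum.elim_inr, Matrix.cons_val_zero, Matrix.cons_val_one] at hg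
    have h0 := congrArg (fun v => BR (ZMod 2) v (cv _ c)) hg
    have h1 := congrArg (fun v => BR (ZMod 2) v (cv _ b)) hg
    simp [htb, htc, hbb, hcc, hbc1] at h0
    simp [htb, htc, hbb, hcc, BR_symm (cv _ c), hbc1] at h1
    rw [h0, h1] at hg
    have h2 := Fintype.linearIndependent_iff.mp (indep_t E) (fun i => g (Sum.inl i)) (by simpa using hg)
    rintro (i | i)
    · exact h2 i
    · fin_cases i
      · exact h0
      · exact h1
  have hfr := finrank_span_eq_card hli
  have hle : Submodule.span (ZMod 2) (Set.range v) ≤ (BR (ZMod 2)).orthogonal (spanT t sR) := by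
    rw [Submodule.span_le]
    rintro _ ⟨i | i, rfl⟩
    · refine (mem_orth_spanT _ _).mpr fun j hj => ?_
      have hj' := (mem_sR j).mp hj
      rw [BR_symm, E.ht]
      exact Int.dvd_of_emod_eq_zero (gt_even j i hj')
    · refine (mem_orth_spanT _ _).mpr fun j hj => ?_
      fin_cases i
      · simp [hb j]
      · simp [hc j]
  have heq := Submodule.eq_of_le_of_finrank_eq hle (by
    rw [hfr, finrank_orth, finrank_spanT E]; simp [sR])
  have hxm : cv (ZMod 2) x ∈ Submodule.span (ZMod 2) (Set.range v) := by
    rw [heq]; exact (mem_orth_spanT _ _).mpr fun j hj => hx j ((mem_sR j).mp hj)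
  rw [Submodule.mem_span_range_iff_exists_fun] at hxm
  obtain ⟨g, hg⟩ := hxm
  choose n hn using zmod2_surj
  have : cv (ZMod 2) (x - (∑ i, n (g (Sum.inl i)) • t i + n (g (Sum.inr 0)) • b + n (g (Sum.inr 1)) • c)) = 0 := by
    rw [map_sub, ← hg]
    simp [Fintype.sum_sum_type, v, cv_smul, hn, -zsmul_eq_mul, map_add]
    abel
  obtain ⟨l, hl⟩ := cv2_zero this
  exact ⟨_, _, _, l, (sub_eq_iff_eq_add'.mp hl)⟩

theorem gt_quad_mat : ∃ A : Matrix (Fin 11) (Fin 11) ℤ,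
    GT = Matrix.of (fun i j => if i.val < 2 ∧ j.val < 2 then GT i j else 0) + (2:ℤ) • (A + Aᵀ) := by
  refine ⟨Matrix.of fun i j => if i.val < 2 then 0 else if i < j then GT i j / 2 else
    if i = j then GT i j / 4 else 0, ?_⟩
  decide +kernel

theorem gt_quad (r : Fin 11 → ℤ) : ∃ n, r ⬝ᵥ GT *ᵥ r = 2 * r 0 * r 1 + 4 * n := by
  obtain ⟨A, hA⟩ := gt_quad_mat
  refine ⟨r ⬝ᵥ A *ᵥ r, ?_⟩
  have h1 : r ⬝ᵥ Aᵀ *ᵥ r = r ⬝ᵥ A *ᵥ r := by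
    rw [Matrix.mulVec_transpose, dotProduct_comm, ← Matrix.dotProduct_mulVec]
  have h2 : r ⬝ᵥ (Matrix.of (fun i j : Fin 11 => if i.val < 2 ∧ j.val < 2 then GT i j else 0)) *ᵥ r = 2 * r 0 * r 1 := by
    simp [dotProduct, Matrix.mulVec, Fin.sum_univ_succ, GT]
    ring
  rw [hA, Matrix.add_mulVec, dotProduct_add, h2, Matrix.smul_mulVec, dotProduct_smul, Matrix.add_mulVec,
    dotProduct_add, h1]
  simp; ring

theorem sum_t_norm (E : Emb t y) (r : Fin 11 → ℤ) :
    BR ℤ (∑ i, r i • t i) (∑ i, r i • t i) = r ⬝ᵥ GT *ᵥ r := by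
  simp only [map_sum, LinearMap.sum_apply, map_smul, LinearMap.smul_apply, E.ht, dotProduct, mulVec,
    smul_eq_mul, Finset.mul_sum]
  rw [Finset.sum_comm]
  refine Finset.sum_congr rfl fun i _ => Finset.sum_congr rfl fun j _ => ?_
  ring

theorem r1 (E : Emb t y) {b c : Fin 22 → ℤ} (hb : InK t b) (hc : InK t c)
    (hbc : ¬ 2 ∣ BR ℤ b c) {x : Fin 22 → ℤ} (hx : InK t x) (hxb : 2 ∣ BR ℤ x b) (hxc : 2 ∣ BR ℤ x c) :
    (∀ k, InK t k → 2 ∣ BR ℤ x k) ∧ 4 ∣ BR ℤ x x := by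
  obtain ⟨r, p, q, l, h⟩ := expand13 E hb hc hbc x (fun i _ => by rw [hx i]; simp)
  have tk : ∀ {k}, InK t k → ∀ i, BR ℤ (t i) k = 0 := fun hk i => by rw [BR_symm]; exact hk i
  obtain ⟨nb, hnb⟩ := BR_even b
  obtain ⟨nc, hnc⟩ := BR_even c
  have e1 : BR ℤ x b = p * BR ℤ b b + q * BR ℤ b c + 2 * BR ℤ l b := by
    conv_lhs => rw [h]
    simp [tk hb, BR_symm c b, -zsmul_eq_mul]
  have e2 : BR ℤ x c = p * BR ℤ b c + q * BR ℤ c c + 2 * BR ℤ l c := by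
    conv_lhs => rw [h]
    simp [tk hc, -zsmul_eq_mul]
  have hq : 2 ∣ q := by
    have : 2 ∣ q * BR ℤ b c := by
      rw [hnb] at e1
      have : q * BR ℤ b c = BR ℤ x b - 2 * (p * nb + BR ℤ l b) := by rw [e1]; ring
      rw [this]; exact dvd_sub hxb (dvd_mul_right _ _)
    exact (Int.prime_two.dvd_or_dvd this).resolve_right hbc
  have hp : 2 ∣ p := by
    have : 2 ∣ p * BR ℤ b c := by
      rw [hnc] at e2
      have : p * BR ℤ b c = BR ℤ x c - 2 * (q * nc + BR ℤ l c) := by rw [e2]; ring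
      rw [this]; exact dvd_sub hxc (dvd_mul_right _ _)
    exact (Int.prime_two.dvd_or_dvd this).resolve_right hbc
  obtain ⟨p', rfl⟩ := hp
  obtain ⟨q', rfl⟩ := hq
  obtain ⟨l', hl'⟩ : ∃ l', x = ∑ i, r i • t i + (2 : ℤ) • l' :=
    ⟨p' • b + q' • c + l, by rw [h]; simp only [smul_add, mul_smul]; abel⟩
  have hr0 : 2 ∣ r 0 := by
    have := hx 1
    rw [hl'] at this
    simp only [map_add, LinearMap.add_apply, map_smul, LinearMap.smul_apply, map_sum,
      LinearMap.sum_apply, BR_symm (t _) (t 1), E.ht, gt1, smul_eq_mul, mul_ite, mul_one, mul_zero,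
      Finset.sum_ite_eq', Finset.mem_univ, if_true] at this
    exact ⟨-BR ℤ l' (t 1), by linarith⟩
  constructor
  · intro k hk
    rw [hl']
    simp [tk hk, -zsmul_eq_mul]
  · obtain ⟨n, hn⟩ := gt_quad r
    obtain ⟨m, hm⟩ := BR_even l'
    have e3 : (2 : ℤ) • l' = x - ∑ i, r i • t i := by rw [hl']; abel
    have e4 := congrArg (fun v => BR ℤ v v) e3
    simp only [map_sub, LinearMap.sub_apply, map_smul, LinearMap.smul_apply, sum_t_norm E, hn, hm] at e4
    have e5 : BR ℤ x (∑ i, r i • t i) = 0 := by simp [hx _, -zsmul_eq_mul]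
    rw [e5, BR_symm (∑ i, r i • t i) x, e5] at e4
    simp only [smul_eq_mul] at e4
    obtain ⟨r', hr'⟩ := hr0
    rw [hr'] at e4
    exact ⟨2 * m - r' * r 1 - n, by linarith⟩
end K3
end

section
open Matrix
namespace K3
set_option linter.unusedSimpArgs false

/-- A basis of a totally singular sublattice modulo 2. -/
def sv (i : Fin 11) : Fin 22 → ℤ := fun k =>
  if i.val < 8 then (if k.val = i.val ∨ k.val = i.val + 8 then 1 else 0)
  else if k.val = 2 * i.val then 1 else 0

/-- Its Gram matrix. -/
def GS : Matrix (Fin 11) (Fin 11) ℤ := Matrix.of fun i j =>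
  if i.val < 8 ∧ j.val < 8 then -2 * cartanE8 i.val j.val else 0

theorem gs_gram : ∀ i j, sv i ⬝ᵥ GramK3 *ᵥ sv j = GS i j := by
  have h : Matrix.of (fun i j => sv i ⬝ᵥ GramK3 *ᵥ sv j) = GS := by decide +kernel
  exact fun i j => congrFun (congrFun h i) j

theorem gs_mat : ∃ A : Matrix (Fin 11) (Fin 11) ℤ, GS = (2:ℤ) • (A + Aᵀ) := by
  refine ⟨Matrix.of fun i j => if i < j then GS i j / 2 else if i = j then GS i j / 4 else 0, ?_⟩
  decide +kernel

theorem gs_norm (r : Fin 11 → ℤ) : 4 ∣ BR ℤ (∑ i, r i • sv i) (∑ i, r i • sv i) := by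
  have h1 : ∀ i j, BR ℤ (sv i) (sv j) = GS i j := fun i j => by rw [BR_int, BG, gs_gram]
  have h2 : BR ℤ (∑ i, r i • sv i) (∑ i, r i • sv i) = r ⬝ᵥ GS *ᵥ r := by
    simp only [map_sum, LinearMap.sum_apply, map_smul, LinearMap.smul_apply, h1, dotProduct, mulVec,
      smul_eq_mul, Finset.mul_sum]
    rw [Finset.sum_comm]
    refine Finset.sum_congr rfl fun i _ => Finset.sum_congr rfl fun j _ => ?_
    ring
  obtain ⟨A, hA⟩ := gs_mat
  have h3 : r ⬝ᵥ Aᵀ *ᵥ r = r ⬝ᵥ A *ᵥ r := by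
    rw [Matrix.mulVec_transpose, dotProduct_comm, ← Matrix.dotProduct_mulVec]
  refine ⟨r ⬝ᵥ A *ᵥ r, ?_⟩
  rw [h2, hA, Matrix.smul_mulVec, dotProduct_smul, Matrix.add_mulVec, dotProduct_add, h3]
  simp; ring

/-- The totally singular subspace. -/
noncomputable def spanS : Submodule (ZMod 2) (Fin 22 → ZMod 2) :=
  Submodule.span (ZMod 2) (Set.range fun i => cv (ZMod 2) (sv i))

theorem finrank_spanS : Module.finrank (ZMod 2) spanS = 11 := by
  have h : LinearIndependent (ZMod 2) (fun i => cv (ZMod 2) (sv i)) := by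
    rw [Fintype.linearIndependent_iff]
    intro g hg j
    have h1 : ∀ i j : Fin 11, sv i (if j.val < 8 then ⟨j.val, by omega⟩ else ⟨2 * j.val, by omega⟩)
      = if i = j then 1 else 0 := by decide +kernel
    have := congrFun hg (if j.val < 8 then ⟨j.val, by omega⟩ else ⟨2 * j.val, by omega⟩)
    simp only [Finset.sum_apply, Pi.smul_apply, cv_apply, h1, smul_eq_mul] at this
    simpa using this
  exact (finrank_span_eq_card h).trans (by simp)

theorem spanS_lift {x : Fin 22 → ZMod 2} (hx : x ∈ spanS) :
    ∃ z, cv (ZMod 2) z = x ∧ 4 ∣ BR ℤ z z := by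
  rw [spanS, Submodule.mem_span_range_iff_exists_fun] at hx
  obtain ⟨g, hg⟩ := hx
  choose n hn using zmod2_surj
  refine ⟨∑ i, n (g i) • sv i, ?_, gs_norm _⟩
  rw [← hg, map_sum]
  simp only [cv_smul, hn]

theorem spanS_iso {x y : Fin 22 → ZMod 2} (hx : x ∈ spanS) (hy : y ∈ spanS) : BR (ZMod 2) x y = 0 := by
  rw [spanS, Submodule.mem_span_range_iff_exists_fun] at hx hy
  obtain ⟨g, rfl⟩ := hx
  obtain ⟨g', rfl⟩ := hy
  have h1 : ∀ i j, BR (ZMod 2) (cv _ (sv i)) (cv _ (sv j)) = 0 := fun i j => by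
    have h : ∀ i j, GS i j % 2 = 0 := by decide +kernel
    rw [BR_cast, BR_int, BG, gs_gram, parity]
    exact Int.dvd_of_emod_eq_zero (h i j)
  simp [map_sum, h1]

variable {t y : Fin 11 → Fin 22 → ℤ}

/-- Indices other than one. -/
def sRp : Finset (Fin 11) := {0,2,3,4,5,6,7,8,9,10}

theorem mem_sRp : ∀ i, i ∈ sRp ↔ i ≠ 1 := by decide +kernel

theorem exists_sing (E : Emb t y) : ∃ z, 4 ∣ BR ℤ z z ∧ (∀ i, i ≠ 1 → 2 ∣ BR ℤ z (t i)) ∧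
    cv (ZMod 2) z ∉ spanT t sRp := by
  by_contra hcon
  push Not at hcon
  set O := (BR (ZMod 2)).orthogonal (spanT t sRp) with hO
  have hsub : spanS ⊓ O ≤ spanS ⊓ spanT t sRp := by
    rintro x ⟨hx1, hx2⟩
    refine ⟨hx1, ?_⟩
    obtain ⟨z, rfl, hz⟩ := spanS_lift hx1
    exact hcon z hz (fun i hi => (mem_orth_spanT _ _).mp hx2 i ((mem_sRp i).mpr hi))
  have h1 := Submodule.finrank_sup_add_finrank_inf_eq spanS O
  have h2 := Submodule.finrank_mono hsub
  have hsup : spanS ⊔ O ≤ (BR (ZMod 2)).orthogonal (spanS ⊓ spanT t sRp) := by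
    refine sup_le ?_ ?_
    · intro x hx
      rw [LinearMap.BilinForm.mem_orthogonal_iff]
      rintro n ⟨hn, _⟩
      exact spanS_iso hn hx
    · intro x hx
      rw [LinearMap.BilinForm.mem_orthogonal_iff]
      rintro n ⟨_, hn⟩
      exact (LinearMap.BilinForm.mem_orthogonal_iff.mp hx) n hn
  have h3 := Submodule.finrank_mono hsup
  rw [finrank_orth] at h3
  have h4 : Module.finrank (ZMod 2) O = 12 := by
    rw [hO, finrank_orth, finrank_spanT E]; simp [sRp]
  rw [finrank_spanS, h4] at h1
  have h5 := Submodule.finrank_mono (inf_le_left : spanS ⊓ spanT t sRp ≤ spanS)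
  rw [finrank_spanS] at h5
  omega

theorem f1 (E : Emb t y) : ∃ b c, InK t b ∧ InK t c ∧ 4 ∣ BR ℤ b b ∧ 4 ∣ BR ℤ c c ∧ ¬ 2 ∣ BR ℤ b c := by
  obtain ⟨z, hz4, hzt, hzR⟩ := exists_sing E
  obtain ⟨b, l, hb, hbz⟩ := lemC E z (fun i hi => hzt i (by rintro rfl; simp at hi))
  set p := BR ℤ z (t 1) with hp
  obtain ⟨q, hq⟩ := hzt 0 (by decide)
  have tk : ∀ {k}, InK t k → ∀ i, BR ℤ (t i) k = 0 := fun hk i => by rw [BR_symm]; exact hk i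
  have hb4 : 4 ∣ BR ℤ b b := by
    have e : b = z - p • t 0 - (2 : ℤ) • (q • t 1 + l) := by
      conv_rhs => rw [hbz, hq]
      module
    set l' := q • t 1 + l
    have h00 : BR ℤ (t 0) (t 0) = 0 := by rw [E.ht]; rfl
    obtain ⟨m, hm⟩ := BR_even l'
    obtain ⟨n, hn⟩ := hz4
    rw [e]
    simp only [map_sub, LinearMap.sub_apply, map_smul, LinearMap.smul_apply, smul_eq_mul, hm, hn, h00,
      BR_symm (t 0) z, hq, BR_symm l']
    exact ⟨n - p * q + 2 * m + p * BR ℤ (t 0) l' - BR ℤ z l', by ring⟩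
  have hbR : cv (ZMod 2) b ∉ spanT t sR := by
    intro hh
    apply hzR
    have e : cv (ZMod 2) z = cv _ b + (p : ZMod 2) • cv _ (t 0) := by
      rw [hbz, hq]
      simp only [map_add, cv_smul]
      have : ((2 : ℤ) : ZMod 2) = 0 := by decide
      rw [Int.cast_mul, this]; simp
    rw [e]
    refine Submodule.add_mem _ ?_ (Submodule.smul_mem _ _ (Submodule.subset_span ⟨0, by simp [sRp], rfl⟩))
    exact Submodule.span_mono (Set.image_mono (fun i hi => by
      have := (mem_sR i).mp hi
      exact (mem_sRp i).mpr (by rintro rfl; simp at this))) hh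
  obtain ⟨c, hc, hbc⟩ : ∃ c, InK t c ∧ ¬ 2 ∣ BR ℤ b c := by
    by_contra hcon
    push Not at hcon
    apply hbR
    rw [← LinearMap.BilinForm.orthogonal_orthogonal (BR_nondeg (ZMod 2)) (BR_refl (ZMod 2)) (spanT t sR),
      LinearMap.BilinForm.mem_orthogonal_iff]
    intro x hx
    obtain ⟨w, rfl⟩ := cv2_surj x
    have hw := (mem_orth_spanT _ _).mp hx
    obtain ⟨c, l, hc, hcw⟩ := lemC E w (fun i hi => hw i ((mem_sR i).mpr hi))
    rw [BR_symm, BR_cast, parity, hcw]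
    simp only [map_add, map_smul, hb _, smul_eq_mul]
    obtain ⟨n, hn⟩ := hcon c hc
    exact ⟨n + BR ℤ b l, by rw [hn]; ring⟩
  obtain ⟨n, hn⟩ := BR_even c
  by_cases h2 : 2 ∣ n
  · exact ⟨b, c, hb, hc, hb4, by obtain ⟨m, rfl⟩ := h2; exact ⟨m, by rw [hn]; ring⟩, hbc⟩
  · refine ⟨b, b + c, hb, hb.add hc, hb4, ?_, ?_⟩
    · obtain ⟨m, hm⟩ := hb4
      have : BR ℤ (b + c) (b + c) = 4 * m + 2 * (BR ℤ b c + n) := by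
        simp only [map_add, LinearMap.add_apply, hm, hn, BR_symm c b]; ring
      rw [this]
      omega
    · rw [map_add]
      obtain ⟨m, hm⟩ := hb4
      rw [hm]; omega
end K3
end

section
open Matrix
namespace K3
set_option linter.unusedSimpArgs false
variable {t y : Fin 11 → Fin 22 → ℤ}

/-- Exponents of the discriminant group of `T`. -/
def den (i : Fin 11) : ℤ := if i.val < 2 then 1 else if i.val < 10 then 2 else 4

/-- The adjoint of `GT`. -/
def GTI : Matrix (Fin 11) (Fin 11) ℤ := Matrix.of fun i j =>
  if i.val < 2 then
    (if j.val < 2 then (if i = j then 0 else 1) else 0)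
  else if i.val < 10 then
    (if 2 ≤ j.val ∧ j.val < 10 then -cinvN (i.val - 2) (j.val - 2) else 0)
  else
    (if j.val = 10 then -1 else 0)

theorem gt_gti : GT * GTI = Matrix.diagonal den := by decide +kernel

theorem den_ne : ∀ i, den i ≠ 0 := by decide +kernel

theorem BQ_zero_of {z : Fin 22 → ℤ} {w} (h : BR ℤ z w = 0) : BR ℚ (cv ℚ z) (cv ℚ w) = 0 := by
  rw [BR_cast, h]; simp

theorem kdual (E : Emb t y) (v : Fin 22 → ℚ) (hv : ∀ i, BR ℚ v (cv ℚ (t i)) = 0)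
    (hK : ∀ k, InK t k → ∃ n : ℤ, BR ℚ v (cv ℚ k) = n) :
    ∃ (l : Fin 22 → ℤ) (a : Fin 11 → ℤ), v = cv ℚ l + ∑ i, ((a i : ℚ) / den i) • cv ℚ (t i) := by
  set σ : Fin 11 → ℚ := fun i => BR ℚ v (cv ℚ (y i)) with hσ
  obtain ⟨l, hl⟩ : ∃ l, v - ∑ i, σ i • cv ℚ (t i) = cv ℚ l := by
    apply BR_integral
    intro z
    obtain ⟨n, hn⟩ := hK (z - ∑ i, BR ℤ z (t i) • y i) (fun j => by
      simp only [map_sub, LinearMap.sub_apply, map_smul, LinearMap.smul_apply, map_sum,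
        LinearMap.sum_apply, BR_symm (y _), E.hy, smul_eq_mul]
      simp)
    refine ⟨n, ?_⟩
    rw [← hn]
    simp only [map_sub, map_sum, cv_smul, map_smul, LinearMap.sub_apply, LinearMap.sum_apply,
      LinearMap.smul_apply, smul_eq_mul, BR_cast, BR_symm (t _) z]
    congr 1
    exact Finset.sum_congr rfl fun i _ => by rw [hσ]; ring
  have hIntg : ∀ j, ∑ i, σ i * GT i j = ((- BR ℤ l (t j) : ℤ) : ℚ) := by
    intro j
    have := congrArg (fun x => BR ℚ x (cv ℚ (t j))) hl
    simp only [map_sub, map_sum, map_smul, LinearMap.sub_apply, LinearMap.sum_apply,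
      LinearMap.smul_apply, smul_eq_mul, BR_cast, hv, E.ht] at this
    push_cast
    linarith
  refine ⟨l, fun k => ∑ j, (- BR ℤ l (t j)) * GTI j k, ?_⟩
  have hk : ∀ k, ((∑ j, (- BR ℤ l (t j)) * GTI j k : ℤ) : ℚ) / den k = σ k := by
    intro k
    have hd : (den k : ℚ) ≠ 0 := by exact_mod_cast den_ne k
    rw [div_eq_iff hd]
    push_cast
    have e1 : ∀ j, -((BR ℤ l (t j) : ℤ) : ℚ) = ∑ i, σ i * GT i j := by
      intro j; rw [hIntg]; push_cast; rfl
    simp only [e1, Finset.sum_mul]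
    rw [Finset.sum_comm]
    have e2 : ∀ i, ∑ j, σ i * (GT i j : ℚ) * GTI j k = σ i * (if i = k then (den k : ℚ) else 0) := by
      intro i
      have := congrFun (congrFun gt_gti i) k
      rw [Matrix.mul_apply, Matrix.diagonal_apply] at this
      simp only [mul_assoc]
      rw [← Finset.mul_sum]
      congr 1
      have h2 : ((∑ j, GT i j * GTI j k : ℤ) : ℚ) = ((if i = k then den i else 0 : ℤ) : ℚ) := by rw [this]
      push_cast at h2
      rw [h2]
      split_ifs with h
      · rw [h]
      · rfl
    simp only [e2]
    simp
  simp only [hk]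
  rw [← hl]; abel

/-- Rescaled form on the discriminant group. -/
def GT4 : Matrix (Fin 11) (Fin 11) ℤ := Matrix.of fun i j => 4 * GT i j / (den i * den j)

theorem gt4_den : ∀ i j, GT4 i j * (den i * den j) = 4 * GT i j := by
  have h : Matrix.of (fun i j => GT4 i j * (den i * den j)) = (4:ℤ) • GT := by decide +kernel
  exact fun i j => congrFun (congrFun h i) j

theorem gt4_mat : ∃ A : Matrix (Fin 11) (Fin 11) ℤ,
    GT4 = (2:ℤ) • (A + Aᵀ) + Matrix.diagonal (fun i => if i = 10 then -1 else 0) := by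
  refine ⟨Matrix.of fun i j => if i < j then GT4 i j / 2 else if i = j ∧ i.val < 10 then GT4 i j / 4 else 0, ?_⟩
  decide +kernel

theorem disc_norm (E : Emb t y) (a : Fin 11 → ℤ) :
    ∃ n : ℤ, 4 * BR ℚ (∑ i, ((a i : ℚ) / den i) • cv ℚ (t i)) (∑ i, ((a i : ℚ) / den i) • cv ℚ (t i)) =
      4 * n - (a 10) ^ 2 := by
  obtain ⟨A, hA⟩ := gt4_mat
  have h3 : a ⬝ᵥ Aᵀ *ᵥ a = a ⬝ᵥ A *ᵥ a := by
    rw [Matrix.mulVec_transpose, dotProduct_comm, ← Matrix.dotProduct_mulVec]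
  have h4 : a ⬝ᵥ GT4 *ᵥ a = 4 * (a ⬝ᵥ A *ᵥ a) - a 10 ^ 2 := by
    rw [hA, Matrix.add_mulVec, dotProduct_add, Matrix.smul_mulVec, dotProduct_smul, Matrix.add_mulVec,
      dotProduct_add, h3]
    simp [dotProduct, Matrix.mulVec_diagonal]
    ring
  refine ⟨a ⬝ᵥ A *ᵥ a, ?_⟩
  have h5 : (4 * ((a ⬝ᵥ A *ᵥ a : ℤ) : ℚ) - a 10 ^ 2) = ((a ⬝ᵥ GT4 *ᵥ a : ℤ) : ℚ) := by
    rw [h4]; push_cast; rfl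
  rw [h5]
  simp only [map_sum, LinearMap.sum_apply, map_smul, LinearMap.smul_apply, BR_cast, E.ht, dotProduct, mulVec,
      smul_eq_mul, Finset.mul_sum, Int.cast_sum, Int.cast_mul]
  rw [Finset.sum_comm]
  refine Finset.sum_congr rfl fun i _ => Finset.sum_congr rfl fun j _ => ?_
  have e : ((GT4 i j * (den i * den j) : ℤ) : ℚ) = ((4 * GT i j : ℤ) : ℚ) := by rw [gt4_den]
  push_cast at e
  have hd : (den i : ℚ) ≠ 0 := by exact_mod_cast den_ne i
  have hd' : (den j : ℚ) ≠ 0 := by exact_mod_cast den_ne j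
  have e' : (GT i j : ℚ) = GT4 i j * (den i * den j) / 4 := by rw [e]; ring
  rw [e']
  field_simp

theorem clear_den (v : Fin 22 → ℚ) : ∃ N : ℤ, N ≠ 0 ∧ ∃ l, (N : ℚ) • v = cv ℚ l := by
  refine ⟨∏ i, ((v i).den : ℤ), Finset.prod_ne_zero_iff.mpr fun i _ => by exact_mod_cast (v i).den_nz,
    fun i => (∏ j ∈ Finset.univ.erase i, ((v j).den : ℤ)) * (v i).num, ?_⟩
  ext i
  rw [← Finset.mul_prod_erase _ _ (Finset.mem_univ i)]
  simp only [Pi.smul_apply, smul_eq_mul, cv_apply]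
  push_cast
  have := Rat.den_mul_eq_num (v i)
  rw [mul_right_comm, this]; ring
end K3
end

section
open Matrix
namespace K3
set_option linter.unusedSimpArgs false
variable {t y : Fin 11 → Fin 22 → ℤ}

/-- Coordinates of an orthogonal frame in `E8`. -/
def frE (a b : ℕ) : ℤ :=
  (([[0,-1,0,0,0,0,0,1],
    [0,1,0,0,0,0,0,1],
    [0,1,2,0,0,0,0,1],
    [0,1,2,2,0,0,0,1],
    [0,1,2,2,2,0,0,1],
    [0,1,2,2,2,2,0,1],
    [0,1,2,2,2,2,2,1],
    [4,7,10,8,6,4,2,5]] : List (List ℤ)).getD a []).getD b 0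

/-- Norms of the reference frame. -/
def dz (i : ℕ) : ℤ :=
  ([2,-2,-8,-8,-8,-8,-8,-8,-8,-8,-4,2,-2,-8,-8,-8,-8,-8,-8,-8,8,-16] : List ℤ).getD i 1

/-- Norms of the reference frame. -/
def dq (i : ℕ) : ℚ := dz i

/-- Vectors of the reference frame. -/
def WM : Matrix (Fin 22) (Fin 22) ℤ := Matrix.of fun i k =>
  if i.val = 0 then (if k.val = 16 ∨ k.val = 17 then 1 else 0)
  else if i.val = 1 then (if k.val = 16 then 1 else if k.val = 17 then -1 else 0)
  else if i.val < 10 then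
    (if k.val < 8 then frE (i.val - 2) k.val else if k.val < 16 then frE (i.val - 2) (k.val - 8) else 0)
  else if i.val = 10 then (if k.val = 18 then 1 else if k.val = 19 then -2 else 0)
  else if i.val = 11 then (if k.val = 20 ∨ k.val = 21 then 1 else 0)
  else if i.val = 12 then (if k.val = 20 then 1 else if k.val = 21 then -1 else 0)
  else if i.val < 20 then
    (if k.val < 8 then frE (i.val - 13) k.val else if k.val < 16 then -frE (i.val - 13) (k.val - 8) else 0)
  else
    (if k.val < 8 then (i.val - 19 : ℤ) * frE 7 k.val else
      if k.val < 16 then -(i.val - 19 : ℤ) * frE 7 (k.val - 8) else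
      if k.val = 18 then 2 else if k.val = 19 then 4 else 0)

theorem wm_gram : WM * GramK3 * WMᵀ = Matrix.diagonal (fun i => dz i.val) := by decide +kernel

theorem dz_ne (i : ℕ) : dz i ≠ 0 := by
  by_cases h : i < 22
  · interval_cases i <;> decide
  · have : dz i = 1 := by
      unfold dz
      rw [List.getD_eq_default]; simpa using h
    rw [this]; decide

theorem dq_ne (i : ℕ) : dq i ≠ 0 := by
  unfold dq; exact_mod_cast dz_ne i

theorem row_gram {n m : ℕ} {M : Matrix (Fin n) (Fin m) ℤ} {G : Matrix (Fin m) (Fin m) ℤ} {d : Fin n → ℤ}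
    (h : M * G * Mᵀ = Matrix.diagonal d) (i j : Fin n) :
    ∑ k, ∑ l, (M i k : ℚ) * M j l * G k l = if i = j then (d i : ℚ) else 0 := by
  have := congrFun (congrFun h i) j
  rw [Matrix.mul_apply, Matrix.diagonal_apply] at this
  have h2 : (((∑ k, (M * G) i k * Mᵀ k j : ℤ)) : ℚ) = ((if i = j then d i else 0 : ℤ) : ℚ) := by rw [this]
  simp only [Matrix.mul_apply, Finset.sum_mul, Matrix.transpose_apply] at h2
  push_cast at h2
  rw [← h2, Finset.sum_comm]
  exact Finset.sum_congr rfl fun k _ => Finset.sum_congr rfl fun l _ => by ring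

theorem exists_linv {n : ℕ} {M G : Matrix (Fin n) (Fin n) ℤ} {d : Fin n → ℤ} (hd : ∀ i, d i ≠ 0)
    (h : M * G * Mᵀ = Matrix.diagonal d) :
    ∃ P : Matrix (Fin n) (Fin n) ℚ, P * M.map (Int.cast : ℤ → ℚ) = 1 := by
  refine ⟨(G.map (Int.cast : ℤ → ℚ)) * (M.map (Int.cast : ℤ → ℚ))ᵀ * Matrix.diagonal (fun i => ((d i : ℚ))⁻¹), ?_⟩
  rw [mul_eq_one_comm]
  have := congrArg (Int.castRingHom ℚ).mapMatrix h
  rw [map_mul, map_mul] at this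
  have h2 : (M.map (Int.cast : ℤ → ℚ)) * (G.map (Int.cast : ℤ → ℚ)) * (M.map (Int.cast : ℤ → ℚ))ᵀ =
      Matrix.diagonal (fun i => (d i : ℚ)) := by
    refine this.trans ?_
    ext i j
    simp [Matrix.diagonal_apply]
  rw [← mul_assoc, ← mul_assoc, h2, Matrix.diagonal_mul_diagonal]
  ext i j
  have : (d i : ℚ) ≠ 0 := by exact_mod_cast hd i
  simp [Matrix.diagonal_apply, Matrix.one_apply, this]

theorem sum_Ico_fin {M : Type*} [AddCommMonoid M] (n : ℕ) (f : ℕ → M) :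
    ∑ i ∈ Finset.Ico 0 n, f i = ∑ i : Fin n, f i.val := by
  rw [← Finset.range_eq_Ico, Finset.sum_range]

theorem ref_frame : HasFrame (BR ℚ) ⊤ dq 0 22 := by
  refine ⟨fun i => if h : i < 22 then cv ℚ (fun k => WM ⟨i, h⟩ k) else 0, ?_, by simp, ?_⟩
  · intro i hi j hj
    simp only [Finset.mem_Ico] at hi hj
    beta_reduce
    rw [dif_pos hi.2, dif_pos hj.2]
    have := row_gram wm_gram ⟨i, hi.2⟩ ⟨j, hj.2⟩
    simp only [Fin.mk.injEq] at this
    rw [dq, ← this, BR, Matrix.toBilin'_apply]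
    exact Finset.sum_congr rfl fun k _ => Finset.sum_congr rfl fun l _ => by simp; ring
  · intro x _
    obtain ⟨P, hP⟩ := exists_linv (fun i : Fin 22 => dz_ne i.val) wm_gram
    refine ⟨fun i => if h : i < 22 then (x ᵥ* P) ⟨i, h⟩ else 0, ?_⟩
    rw [sum_Ico_fin]
    have h1 : x = (x ᵥ* P) ᵥ* WM.map (Int.cast : ℤ → ℚ) := by
      rw [Matrix.vecMul_vecMul, hP, Matrix.vecMul_one]
    conv_lhs => rw [h1]
    ext k
    simp [Matrix.vecMul, dotProduct]

/-- Coordinates of the frame of `T`. -/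
def TM : Matrix (Fin 11) (Fin 11) ℤ := Matrix.of fun i k =>
  if i.val = 0 then (if k.val < 2 then 1 else 0)
  else if i.val = 1 then (if k.val = 0 then 1 else if k.val = 1 then -1 else 0)
  else if i.val < 10 then
    (if k.val < 2 then 0 else if k.val < 10 then frE (i.val - 2) (k.val - 2) else 0)
  else (if k.val = 10 then 1 else 0)

theorem tm_gram : TM * GT * TMᵀ = Matrix.diagonal (fun i => dz i.val) := by decide +kernel

/-- The rational orthogonal complement of `T`. -/
noncomputable def WK (t : Fin 11 → Fin 22 → ℤ) : Submodule ℚ (Fin 22 → ℚ) where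
  carrier := {x | ∀ i, BR ℚ x (cv ℚ (t i)) = 0}
  zero_mem' := by intro i; simp
  add_mem' := by intro a b ha hb i; simp [ha i, hb i]
  smul_mem' := by intro c a ha i; simp [ha i]

theorem mem_WK (x : Fin 22 → ℚ) : x ∈ WK t ↔ ∀ i, BR ℚ x (cv ℚ (t i)) = 0 := Iff.rfl

theorem cv_mem_WK (x : Fin 22 → ℤ) : cv ℚ x ∈ WK t ↔ InK t x := by
  rw [mem_WK]
  refine forall_congr' fun i => ?_
  rw [BR_cast]; simp

theorem frameK (E : Emb t y) : HasFrame (BR ℚ) (WK t) dq 11 22 := by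
  refine ref_frame.peel BR_symm (fun i _ => dq_ne i)
    (fun i => if h : i < 11 then ∑ k, (TM ⟨i, h⟩ k : ℚ) • cv ℚ (t k) else 0) 11 (by norm_num) ?_ _ ?_
  · intro i hi j hj
    rw [dif_pos hi, dif_pos hj]
    have := row_gram tm_gram ⟨i, hi⟩ ⟨j, hj⟩
    simp only [Fin.mk.injEq] at this
    rw [dq, ← this]
    simp only [map_sum, LinearMap.sum_apply, map_smul, LinearMap.smul_apply, BR_cast, E.ht, smul_eq_mul, Finset.mul_sum]
    rw [Finset.sum_comm]
    exact Finset.sum_congr rfl fun k _ => Finset.sum_congr rfl fun l _ => by ring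
  · intro x
    rw [mem_WK]
    constructor
    · intro h i hi
      rw [dif_pos hi]
      simp [map_sum, h]
    · intro h j
      obtain ⟨P, hP⟩ := exists_linv (fun i : Fin 11 => dz_ne i.val) tm_gram
      have h1 : ∀ i : Fin 11, BR ℚ x (∑ k, (TM i k : ℚ) • cv ℚ (t k)) = 0 := by
        intro i
        have := h i.val i.isLt
        rwa [dif_pos i.isLt] at this
      have h2 : ∑ i, P j i * BR ℚ x (∑ k, (TM i k : ℚ) • cv ℚ (t k)) = BR ℚ x (cv ℚ (t j)) := by
        simp only [map_sum, map_smul, smul_eq_mul, Finset.mul_sum]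
        rw [Finset.sum_comm]
        have h3 : ∀ k, ∑ i, P j i * ((TM i k : ℚ) * BR ℚ x (cv ℚ (t k))) =
            (if j = k then 1 else 0) * BR ℚ x (cv ℚ (t k)) := by
          intro k
          have := congrFun (congrFun hP j) k
          rw [Matrix.mul_apply, Matrix.one_apply] at this
          rw [← this, Finset.sum_mul]
          exact Finset.sum_congr rfl fun i _ => by simp; ring
        simp only [h3]
        simp
      rw [← h2]
      simp [h1]

/-- The complement of a hyperbolic plane in `WK`. -/
noncomputable def Wef (t : Fin 11 → Fin 22 → ℤ) (e f : Fin 22 → ℤ) : Submodule ℚ (Fin 22 → ℚ) where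
  carrier := {x | x ∈ WK t ∧ BR ℚ x (cv ℚ e) = 0 ∧ BR ℚ x (cv ℚ f) = 0}
  zero_mem' := ⟨Submodule.zero_mem _, by simp, by simp⟩
  add_mem' := by
    rintro a b ⟨ha, ha1, ha2⟩ ⟨hb, hb1, hb2⟩
    exact ⟨Submodule.add_mem _ ha hb, by simp [ha1, hb1], by simp [ha2, hb2]⟩
  smul_mem' := by
    rintro c a ⟨ha, ha1, ha2⟩
    exact ⟨Submodule.smul_mem _ _ ha, by simp [ha1], by simp [ha2]⟩

theorem mem_Wef {e f : Fin 22 → ℤ} (x : Fin 22 → ℚ) :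
    x ∈ Wef t e f ↔ x ∈ WK t ∧ BR ℚ x (cv ℚ e) = 0 ∧ BR ℚ x (cv ℚ f) = 0 := Iff.rfl

theorem frame_ef (E : Emb t y) {e f : Fin 22 → ℤ} (he : InK t e) (hf : InK t f)
    (hee : BR ℤ e e = 0) (hff : BR ℤ f f = 0) (hef : BR ℤ e f = 1) :
    HasFrame (BR ℚ) (Wef t e f) dq 13 22 := by
  let W1 : Submodule ℚ (Fin 22 → ℚ) := WK t ⊓ (LinearMap.ker ((BR ℚ).flip (cv ℚ (e + f))))
  have hW1 : ∀ x, x ∈ W1 ↔ x ∈ WK t ∧ BR ℚ x (cv ℚ (e + f)) = 0 := by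
    intro x; simp [W1, LinearMap.mem_ker]
  have hfe : BR ℤ f e = 1 := by rw [BR_symm, hef]
  have h1 := (frameK E).step BR_symm (by norm_num) (dq_ne 11) (h := cv ℚ (e + f)) (W' := W1)
    ((cv_mem_WK _).mpr (he.add hf)) (by
      rw [BR_cast]
      simp only [map_add, LinearMap.add_apply, hee, hff, hef, hfe]
      norm_num [dq, dz]) hW1
  refine h1.step BR_symm (by norm_num) (dq_ne 12) (h := cv ℚ (e - f)) ?_ ?_ ?_
  · rw [hW1]
    refine ⟨(cv_mem_WK _).mpr (he.sub hf), ?_⟩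
    rw [BR_cast]
    simp only [map_add, map_sub, LinearMap.sub_apply, LinearMap.add_apply, hee, hff, hef, hfe]
    norm_num
  · rw [BR_cast]
    simp only [map_add, map_sub, LinearMap.sub_apply, LinearMap.add_apply, hee, hff, hef, hfe]
    norm_num [dq, dz]
  · intro x
    rw [mem_Wef, hW1]
    simp only [map_add, map_sub]
    constructor
    · rintro ⟨h, h1, h2⟩
      exact ⟨⟨h, by rw [h1, h2]; ring⟩, by rw [h1, h2]; ring⟩
    · rintro ⟨⟨h, h1⟩, h2⟩
      exact ⟨h, by linarith, by linarith⟩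

theorem frame_half {W : Submodule ℚ (Fin 22 → ℚ)} (H : HasFrame (BR ℚ) W dq 13 22) :
    HasFrame ((1/2 : ℚ) • BR ℚ) W dn 0 9 := by
  obtain ⟨w, hw, hW, hsp⟩ := H
  refine ⟨fun i => (1/2 : ℚ) • w (i + 13), ?_, ?_, ?_⟩
  · intro i hi j hj
    simp only [Finset.mem_Ico] at hi hj
    have := hw (i + 13) (by simp; omega) (j + 13) (by simp; omega)
    simp only [LinearMap.smul_apply, map_smul, smul_eq_mul, this, add_left_inj]
    have hi2 := hi.2
    by_cases hij : i = j
    · subst hij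
      simp only [if_true]
      interval_cases i <;> norm_num [dq, dz, dn]
    · simp [hij]
  · intro i hi
    simp only [Finset.mem_Ico] at hi
    exact W.smul_mem _ (hW _ (by simp; omega))
  · intro x hx
    obtain ⟨c, hc⟩ := hsp x hx
    refine ⟨fun i => 2 * c (i + 13), ?_⟩
    rw [hc]
    have : Finset.Ico 13 22 = Finset.image (· + 13) (Finset.Ico 0 9) := by decide
    rw [this, Finset.sum_image (by intro a _ b _ h; simpa using h)]
    refine Finset.sum_congr rfl fun i _ => ?_
    rw [smul_smul]; congr 1; ring
end K3
end

section
open Matrix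
namespace K3
set_option linter.unusedSimpArgs false
variable {t y : Fin 11 → Fin 22 → ℤ}

/-- The lattice `K` inside the rational space. -/
def XK (t : Fin 11 → Fin 22 → ℤ) : AddSubgroup (Fin 22 → ℚ) where
  carrier := {x | ∃ z, InK t z ∧ cv ℚ z = x}
  zero_mem' := ⟨0, fun i => by simp, map_zero _⟩
  add_mem' := by
    rintro _ _ ⟨a, ha, rfl⟩ ⟨b, hb, rfl⟩
    exact ⟨a + b, ha.add hb, map_add _ _ _⟩
  neg_mem' := by
    rintro _ ⟨a, ha, rfl⟩
    exact ⟨-a, fun i => by simp [ha i], map_neg _ _⟩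

theorem two_div_den (a : Fin 11 → ℤ) (h : 2 ∣ a 10) (i : Fin 11) :
    ∃ b : ℤ, 2 * ((a i : ℚ) / den i) = b := by
  by_cases h1 : i.val < 2
  · exact ⟨2 * a i, by simp [den, h1]⟩
  · by_cases h2 : i.val < 10
    · exact ⟨a i, by simp [den, h1, h2]; ring⟩
    · have : i = 10 := by omega
      subst this
      obtain ⟨b, hb⟩ := h
      refine ⟨b, ?_⟩
      rw [hb]; simp [den]; ring

theorem lemD (E : Emb t y) {e : Fin 22 → ℤ} (he : InK t e) (hee : BR ℤ e e = 0)
    (hne : ∃ k, InK t k ∧ BR ℤ e k ≠ 0) :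
    ∃ (v : Fin 22 → ℚ) (d : ℤ) (u : Fin 22 → ℤ), cv ℚ e = (d : ℚ) • v ∧
      (∀ k, InK t k → ∃ n : ℤ, BR ℚ v (cv ℚ k) = n) ∧ (∃ x, InK t x ∧ BR ℚ v (cv ℚ x) = 1) ∧
      InK t u ∧ cv ℚ u = (2 : ℚ) • v ∧ BR ℚ v v = 0 := by
  obtain ⟨d, ⟨x0, ⟨x, hx, rfl⟩, hx2⟩, hd⟩ := values_cyclic (XK t) (BR ℚ (cv ℚ e)) (by
    rintro _ ⟨z, _, rfl⟩; exact ⟨_, BR_cast _ _⟩)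
  have hd0 : (d : ℚ) ≠ 0 := by
    intro h0
    obtain ⟨k, hk, hk0⟩ := hne
    obtain ⟨n, hn⟩ := hd _ ⟨k, hk, rfl⟩
    rw [h0, zero_mul, BR_cast] at hn
    exact hk0 (by exact_mod_cast hn)
  set v : Fin 22 → ℚ := (d : ℚ)⁻¹ • cv ℚ e with hv
  have hvv : BR ℚ v v = 0 := by
    simp [hv, BR_cast, hee]
  have hvt : ∀ i, BR ℚ v (cv ℚ (t i)) = 0 := fun i => by
    simp [hv, BR_cast, he i]
  have hvK : ∀ k, InK t k → ∃ n : ℤ, BR ℚ v (cv ℚ k) = n := by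
    intro k hk
    obtain ⟨n, hn⟩ := hd _ ⟨k, hk, rfl⟩
    refine ⟨n, ?_⟩
    simp only [hv, map_smul, LinearMap.smul_apply, hn, smul_eq_mul]
    field_simp
  obtain ⟨l, a, hla⟩ := kdual E v hvt hvK
  obtain ⟨n, hn⟩ := disc_norm E a
  set τ := ∑ i, ((a i : ℚ) / den i) • cv ℚ (t i) with hτ
  have hvτ : BR ℚ v τ = 0 := by simp [hτ, map_sum, hvt]
  have h1 : BR ℚ (cv ℚ l) (cv ℚ l) = BR ℚ τ τ := by
    have : cv ℚ l = v - τ := by rw [hla]; abel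
    rw [this]
    simp only [map_sub, LinearMap.sub_apply, hvv, BR_symm τ v, hvτ]; ring
  obtain ⟨m, hm⟩ := BR_even l
  rw [BR_cast, hm] at h1
  have ha : 2 ∣ a 10 := by
    have h2 : (a 10) ^ 2 = 2 * (2 * n - 4 * m) := by
      have : ((a 10 : ℤ) : ℚ) ^ 2 = 2 * (2 * n - 4 * m) := by
        rw [← h1] at hn; push_cast at hn; linarith
      exact_mod_cast this
    exact Int.prime_two.dvd_of_dvd_pow ⟨_, h2⟩
  choose b hb using two_div_den a ha
  have hu : cv ℚ ((2 : ℤ) • l + ∑ i, b i • t i) = (2 : ℚ) • v := by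
    rw [hla, hτ, smul_add, Finset.smul_sum]
    simp only [map_add, map_sum, cv_smul, smul_smul, hb]
    norm_num
  refine ⟨v, d, _, ?_, hvK, ⟨x, hx, ?_⟩, ?_, hu, hvv⟩
  · rw [hv, smul_smul, mul_inv_cancel₀ hd0, one_smul]
  · simp only [hv, map_smul, LinearMap.smul_apply, hx2, smul_eq_mul]
    field_simp
  · rw [← cv_mem_WK, hu]
    exact (WK t).smul_mem _ hvt

theorem exists_iso (E : Emb t y) : ∃ e, InK t e ∧ BR ℤ e e = 0 ∧ ∃ k, InK t k ∧ BR ℤ e k ≠ 0 := by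
  obtain ⟨w, hw, hW, -⟩ := frameK E
  have h1 := hw 11 (by simp) 11 (by simp)
  have h2 := hw 11 (by simp) 12 (by simp)
  have h3 := hw 12 (by simp) 11 (by simp)
  have h4 := hw 12 (by simp) 12 (by simp)
  norm_num [dq, dz] at h1 h2 h3 h4
  have hz : w 11 + w 12 ∈ WK t := Submodule.add_mem _ (hW 11 (by simp)) (hW 12 (by simp))
  obtain ⟨N, hN, e, he⟩ := clear_den (w 11 + w 12)
  obtain ⟨N', hN', k, hk⟩ := clear_den (w 11)
  refine ⟨e, ?_, ?_, k, ?_, ?_⟩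
  · rw [← cv_mem_WK, ← he]; exact Submodule.smul_mem _ _ hz
  · have : BR ℚ (cv ℚ e) (cv ℚ e) = 0 := by
      rw [← he]; simp [h1, h2, h3, h4]
    rw [BR_cast] at this; exact_mod_cast this
  · rw [← cv_mem_WK, ← hk]; exact Submodule.smul_mem _ _ (hW 11 (by simp))
  · intro h0
    have : BR ℚ (cv ℚ e) (cv ℚ k) = 0 := by rw [BR_cast, h0]; simp
    rw [← he, ← hk] at this
    simp [h1, h3, hN, hN'] at this

theorem exists_hyp (E : Emb t y) : ∃ e f, InK t e ∧ InK t f ∧ BR ℤ e e = 0 ∧ BR ℤ f f = 0 ∧ BR ℤ e f = 1 := by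
  obtain ⟨e0, he0, hee0, hne0⟩ := exists_iso E
  obtain ⟨v, d, u, -, hvK, ⟨x, hx, hvx⟩, hu, huv, hvv⟩ := lemD E he0 hee0 hne0
  obtain ⟨b, c, hb, hc, hb4, hc4, hbc⟩ := f1 E
  obtain ⟨vb, hvb⟩ := hvK b hb
  obtain ⟨vc, hvc⟩ := hvK c hc
  obtain ⟨a, c', m, ha, hc', hva, hm, ⟨k, hk⟩, hac⟩ : ∃ a c' m, InK t a ∧ InK t c' ∧ BR ℚ v (cv ℚ a) = (m : ℤ) ∧
      ¬ 2 ∣ m ∧ 4 ∣ BR ℤ a a ∧ ¬ 2 ∣ BR ℤ a c' := by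
    by_cases h1 : 2 ∣ vb
    swap
    · exact ⟨b, c, vb, hb, hc, hvb, h1, hb4, hbc⟩
    by_cases h2 : 2 ∣ vc
    swap
    · exact ⟨c, b, vc, hc, hb, hvc, h2, hc4, by rwa [BR_symm]⟩
    set ρ := x - BR ℤ x c • b - BR ℤ x b • c with hρ
    have hρK : InK t ρ := (hx.sub (hb.smul _)).sub (hc.smul _)
    obtain ⟨s, hs⟩ : ∃ s, BR ℤ b c = 2 * s + 1 := ⟨BR ℤ b c / 2, by omega⟩
    obtain ⟨nb, hnb⟩ := hb4
    obtain ⟨nc, hnc⟩ := hc4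
    have hρb : 2 ∣ BR ℤ ρ b := by
      rw [hρ]
      simp only [map_sub, LinearMap.sub_apply, map_smul, LinearMap.smul_apply, smul_eq_mul, BR_symm c b, hs, hnb]
      exact ⟨- BR ℤ x c * (2 * nb) - BR ℤ x b * s, by ring⟩
    have hρc : 2 ∣ BR ℤ ρ c := by
      rw [hρ]
      simp only [map_sub, LinearMap.sub_apply, map_smul, LinearMap.smul_apply, smul_eq_mul, hs, hnc]
      exact ⟨- BR ℤ x b * (2 * nc) - BR ℤ x c * s, by ring⟩
    obtain ⟨-, hρ4⟩ := r1 E hb hc hbc hρK hρb hρc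
    refine ⟨b + ρ, c, vb + (1 - BR ℤ x c * vb - BR ℤ x b * vc), hb.add hρK, hc, ?_, ?_, ?_, ?_⟩
    · rw [hρ]
      simp only [map_add, map_sub, cv_smul, map_smul, hvb, hvc, hvx, smul_eq_mul]
      push_cast; ring
    · obtain ⟨p, rfl⟩ := h1
      obtain ⟨q, rfl⟩ := h2
      rintro ⟨r, hr⟩
      have : 1 = 2 * (r - p + BR ℤ x c * p + BR ℤ x b * q) := by linarith
      omega
    · obtain ⟨p, hp⟩ := hρb
      obtain ⟨q, hq⟩ := hρ4
      refine ⟨nb + p + q, ?_⟩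
      simp only [map_add, LinearMap.add_apply, hnb, hp, hq, BR_symm b ρ]; ring
    · simp only [map_add, LinearMap.add_apply]
      omega
  have hua : BR ℤ u a = 2 * m := by
    have : BR ℚ (cv ℚ u) (cv ℚ a) = 2 * m := by rw [huv]; simp [hva]
    rw [BR_cast] at this; exact_mod_cast this
  have huu : BR ℤ u u = 0 := by
    have : BR ℚ (cv ℚ u) (cv ℚ u) = 0 := by rw [huv]; simp [hvv]
    rw [BR_cast] at this; exact_mod_cast this
  obtain ⟨n, hn⟩ := hvK c' hc'
  have huc : BR ℤ u c' = 2 * n := by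
    have : BR ℚ (cv ℚ u) (cv ℚ c') = 2 * n := by rw [huv]; simp [hn]
    rw [BR_cast] at this; exact_mod_cast this
  set e1 := k • u - m • a with he1
  have he1K : InK t e1 := (hu.smul _).sub (ha.smul _)
  have hee1 : BR ℤ e1 e1 = 0 := by
    rw [he1]
    simp only [map_sub, LinearMap.sub_apply, map_smul, LinearMap.smul_apply, smul_eq_mul, huu, hua, hk, BR_symm a u]
    ring
  have hodd : ¬ 2 ∣ BR ℤ e1 c' := by
    rw [he1]
    simp only [map_sub, LinearMap.sub_apply, map_smul, LinearMap.smul_apply, smul_eq_mul, huc]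
    intro h
    have : 2 ∣ m * BR ℤ a c' := by
      have h2 := dvd_sub (Dvd.intro (k * n) rfl : (2 : ℤ) ∣ 2 * (k * n)) h
      have h3 : 2 * (k * n) - (k * (2 * n) - m * BR ℤ a c') = m * BR ℤ a c' := by ring
      rwa [h3] at h2
    rcases Int.prime_two.dvd_or_dvd this with h | h
    · exact hm h
    · exact hac h
  obtain ⟨v', d', u', hv', hvK', ⟨f, hf, hvf⟩, hu', huv', hvv'⟩ := lemD E he1K hee1
    ⟨c', hc', fun h => hodd (by rw [h]; simp)⟩
  obtain ⟨n', hn'⟩ := hvK' c' hc'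
  have hd' : ¬ 2 ∣ d' := by
    rintro ⟨q, hq⟩
    apply hodd
    have : BR ℚ (cv ℚ e1) (cv ℚ c') = d' * n' := by rw [hv']; simp [hn']
    rw [BR_cast] at this
    have h2 : BR ℤ e1 c' = d' * n' := by exact_mod_cast this
    exact ⟨q * n', by rw [h2, hq]; ring⟩
  obtain ⟨s, hs⟩ : ∃ s, d' = 2 * s + 1 := ⟨d' / 2, by omega⟩
  have heq : cv ℚ (e1 - s • u') = v' := by
    rw [map_sub, cv_smul, hv', huv', hs]
    push_cast
    module
  have heK : InK t (e1 - s • u') := he1K.sub (hu'.smul _)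
  set e := e1 - s • u'
  have hee : BR ℤ e e = 0 := by
    have : BR ℚ (cv ℚ e) (cv ℚ e) = 0 := by rw [heq, hvv']
    rw [BR_cast] at this; exact_mod_cast this
  have hef : BR ℤ e f = 1 := by
    have : BR ℚ (cv ℚ e) (cv ℚ f) = 1 := by rw [heq, hvf]
    rw [BR_cast] at this; exact_mod_cast this
  obtain ⟨r, hr⟩ := BR_even f
  refine ⟨e, f - r • e, heK, hf.sub (heK.smul _), hee, ?_, ?_⟩
  · simp only [map_sub, LinearMap.sub_apply, map_smul, LinearMap.smul_apply, smul_eq_mul, hee, hef, hr, BR_symm f e]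
    ring
  · simp only [map_sub, LinearMap.sub_apply, map_smul, LinearMap.smul_apply, smul_eq_mul, hee, hef]
    ring
end K3
end

section
open Matrix
namespace K3
set_option linter.unusedSimpArgs false
variable {t y : Fin 11 → Fin 22 → ℤ}

/-- The complement of the hyperbolic plane in `K`. -/
def Mef (t : Fin 11 → Fin 22 → ℤ) (e f : Fin 22 → ℤ) : AddSubgroup (Fin 22 → ℚ) where
  carrier := {x | ∃ z, InK t z ∧ BR ℤ z e = 0 ∧ BR ℤ z f = 0 ∧ cv ℚ z = x}
  zero_mem' := ⟨0, fun i => by simp, by simp, by simp, map_zero _⟩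
  add_mem' := by
    rintro _ _ ⟨a, ha, h1, h2, rfl⟩ ⟨b, hb, h3, h4, rfl⟩
    exact ⟨a + b, ha.add hb, by simp [h1, h3], by simp [h2, h4], map_add _ _ _⟩
  neg_mem' := by
    rintro _ ⟨a, ha, h1, h2, rfl⟩
    exact ⟨-a, fun i => by simp [ha i], by simp [h1], by simp [h2], map_neg _ _⟩

theorem cv_mem_Wef {e f : Fin 22 → ℤ} (z : Fin 22 → ℤ) :
    cv ℚ z ∈ Wef t e f ↔ InK t z ∧ BR ℤ z e = 0 ∧ BR ℤ z f = 0 := by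
  rw [mem_Wef, cv_mem_WK, BR_cast, BR_cast]; simp

theorem cv_mem_Mef {e f : Fin 22 → ℤ} {z : Fin 22 → ℤ} (h : cv ℚ z ∈ Wef t e f) : cv ℚ z ∈ Mef t e f := by
  obtain ⟨h1, h2, h3⟩ := (cv_mem_Wef z).mp h
  exact ⟨z, h1, h2, h3, rfl⟩

theorem mef_lat (E : Emb t y) {e f : Fin 22 → ℤ} (he : InK t e) (hf : InK t f)
    (hee : BR ℤ e e = 0) (hff : BR ℤ f f = 0) (hef : BR ℤ e f = 1) :
    ∃ μ, Lat ((1/2 : ℚ) • BR ℚ) (Wef t e f) (Mef t e f) μ := by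
  have hef2 : ¬ 2 ∣ BR ℤ e f := by rw [hef]; decide
  have hfe : BR ℤ f e = 1 := by rw [BR_symm, hef]
  set κ := t 10 + (4 : ℤ) • y 10 with hκ
  have hκK : InK t κ := by
    intro j
    rw [hκ]
    simp only [map_add, LinearMap.add_apply, map_smul, LinearMap.smul_apply, smul_eq_mul, E.ht,
      BR_symm (y 10), E.hy]
    have : ∀ j, GT 10 j + 4 * (if j = 10 then 1 else 0) = 0 := by decide +kernel
    exact this j
  have hκx : ∀ x, InK t x → BR ℤ κ x = 4 * BR ℤ (y 10) x := by
    intro x hx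
    rw [hκ]
    simp only [map_add, LinearMap.add_apply, map_smul, LinearMap.smul_apply, smul_eq_mul,
      BR_symm (t 10), hx 10]
    ring
  set μz := κ - (BR ℤ κ f) • e - (BR ℤ κ e) • f with hμ
  have hμK : InK t μz := (hκK.sub (he.smul _)).sub (hf.smul _)
  have hμe : BR ℤ μz e = 0 := by
    rw [hμ]
    simp only [map_sub, LinearMap.sub_apply, map_smul, LinearMap.smul_apply, smul_eq_mul, hee, hfe]; ring
  have hμf : BR ℤ μz f = 0 := by
    rw [hμ]
    simp only [map_sub, LinearMap.sub_apply, map_smul, LinearMap.smul_apply, smul_eq_mul, hff, hef]; ring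
  have hμM : cv ℚ μz ∈ Mef t e f := ⟨μz, hμK, hμe, hμf, rfl⟩
  have hμx : ∀ x, InK t x → BR ℤ x e = 0 → BR ℤ x f = 0 → BR ℤ μz x = 4 * BR ℤ (y 10) x := by
    intro x hx hxe hxf
    rw [← hκx x hx, hμ]
    simp only [map_sub, LinearMap.sub_apply, map_smul, LinearMap.smul_apply, smul_eq_mul,
      BR_symm e x, BR_symm f x, hxe, hxf]; ring
  refine ⟨cv ℚ μz, ⟨?_, ?_, ?_, hμM, ?_, ?_, ?_⟩⟩
  · rintro _ ⟨z, h1, h2, h3, rfl⟩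
    exact (cv_mem_Wef z).mpr ⟨h1, h2, h3⟩
  · rintro _ ⟨x, h1, h2, h3, rfl⟩ _ ⟨x', h1', h2', h3', rfl⟩
    obtain ⟨n, hn⟩ := (r1 E he hf hef2 h1 (by rw [h2]; simp) (by rw [h3]; simp)).1 x' h1'
    exact ⟨n, by simp [BR_cast, hn]⟩
  · intro w hw
    obtain ⟨N, hN, l, hl⟩ := clear_den w
    refine ⟨N, hN, ?_⟩
    have := (Wef t e f).smul_mem (N : ℚ) hw
    rw [hl] at this ⊢
    exact cv_mem_Mef this
  · rintro _ ⟨x, h1, h2, h3, rfl⟩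
    exact ⟨BR ℤ (y 10) x, by simp [BR_cast, hμx x h1 h2 h3]; ring⟩
  · have h1 : BR ℤ μz μz = 4 * BR ℤ (y 10) μz := hμx μz hμK hμe hμf
    obtain ⟨n, hn⟩ := BR_even (y 10)
    have h2 : BR ℤ (y 10) μz = 1 + 4 * (2 * n) - 8 * (BR ℤ (y 10) e * BR ℤ (y 10) f) := by
      rw [hμ]
      simp only [map_sub, map_smul, smul_eq_mul, hκx e he, hκx f hf]
      rw [hκ]
      simp only [map_add, map_smul, smul_eq_mul, BR_symm (y 10) (t 10), E.hy, hn, if_true]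
      ring
    refine ⟨4 * n - 4 * (BR ℤ (y 10) e * BR ℤ (y 10) f), ?_⟩
    simp only [LinearMap.smul_apply, BR_cast, h1, h2, smul_eq_mul]
    push_cast; ring
  · intro v hv hIntg
    obtain ⟨hvK, hve, hvf⟩ := (mem_Wef v).mp hv
    obtain ⟨l, a, hla⟩ := kdual E ((1/2 : ℚ) • v) (fun i => by simp [hvK i]) (by
      intro k hk
      set k' := k - (BR ℤ k f) • e - (BR ℤ k e) • f with hk'
      have hkK : InK t k' := (hk.sub (he.smul _)).sub (hf.smul _)
      obtain ⟨n, hn⟩ := hIntg (cv ℚ k') ⟨k', hkK, by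
        rw [hk']
        simp only [map_sub, LinearMap.sub_apply, map_smul, LinearMap.smul_apply, smul_eq_mul, hee, hfe]; ring, by
        rw [hk']
        simp only [map_sub, LinearMap.sub_apply, map_smul, LinearMap.smul_apply, smul_eq_mul, hff, hef]; ring, rfl⟩
      refine ⟨n, ?_⟩
      rw [← hn, hk']
      simp [cv_smul, hve, hvf, -zsmul_eq_mul])
    refine ⟨a 10, ?_⟩
    choose b hb using two_div_den (Function.update a 10 0) (by simp)
    have hsplit : ∑ i, ((a i : ℚ) / den i) • cv ℚ (t i) =
        ∑ i, (((Function.update a 10 0 i : ℤ) : ℚ) / den i) • cv ℚ (t i) + ((a 10 : ℚ) / 4) • cv ℚ (t 10) := by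
      rw [← Finset.sum_erase_add _ _ (Finset.mem_univ (10 : Fin 11)),
        ← Finset.sum_erase_add (a := (10 : Fin 11)) Finset.univ (fun i => (((Function.update a 10 0 i : ℤ) : ℚ) / den i) • cv ℚ (t i)) (Finset.mem_univ _)]
      have h10 : den 10 = 4 := by decide
      rw [h10]
      simp only [Function.update_self, Int.cast_zero, zero_div, zero_smul, add_zero, Int.cast_ofNat]
      congr 1
    have hv2 : v = (2 : ℚ) • cv ℚ l + ∑ i, (b i : ℚ) • cv ℚ (t i) + ((a 10 : ℚ) / 2) • cv ℚ (t 10) := by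
      have : v = (2 : ℚ) • ((1/2 : ℚ) • v) := by rw [smul_smul]; norm_num
      rw [this, hla, hsplit]
      simp only [← hb, mul_smul, ← Finset.smul_sum]
      module
    have hfin : v - ((a 10 : ℚ) / 2) • cv ℚ μz = cv ℚ ((2 : ℤ) • l + ∑ i, b i • t i
        - (2 * a 10) • y 10 + (a 10 * (2 * BR ℤ (y 10) f)) • e + (a 10 * (2 * BR ℤ (y 10) e)) • f) := by
      rw [hμ, hκx e he, hκx f hf, hκ]
      conv_lhs => rw [hv2]
      simp only [map_add, map_sub, map_sum, cv_smul]
      push_cast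
      module
    have hmem := (Wef t e f).sub_mem hv ((Wef t e f).smul_mem ((a 10 : ℚ) / 2)
      ((cv_mem_Wef μz).mpr ⟨hμK, hμe, hμf⟩))
    rw [hfin] at hmem ⊢
    exact cv_mem_Mef hmem

theorem mef_even (E : Emb t y) {e f : Fin 22 → ℤ} (he : InK t e) (hf : InK t f)
    (hef : BR ℤ e f = 1) : ∀ x ∈ Mef t e f, ∃ n : ℤ, ((1/2 : ℚ) • BR ℚ) x x = 2 * n := by
  rintro _ ⟨x, h1, h2, h3, rfl⟩
  obtain ⟨n, hn⟩ := (r1 E he hf (by rw [hef]; decide) h1 (by rw [h2]; simp) (by rw [h3]; simp)).2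
  exact ⟨n, by simp [BR_cast, hn]; ring⟩

theorem idx_cases (i : Fin 11) : i = 0 ∨ i = 1 ∨ (∃ k : Fin 8, i = ⟨k.val + 2, by omega⟩) ∨ i = 10 := by
  by_cases h0 : i = 0
  · exact Or.inl h0
  by_cases h1 : i = 1
  · exact Or.inr (Or.inl h1)
  by_cases h2 : i = 10
  · exact Or.inr (Or.inr (Or.inr h2))
  exact Or.inr (Or.inr (Or.inl ⟨⟨i.val - 2, by omega⟩, by ext; simp; omega⟩))

/-- Assemble a basis. -/
def basisOf (e f g : Fin 22 → ℤ) (α : Fin 8 → Fin 22 → ℤ) (i : Fin 11) : Fin 22 → ℤ :=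
  if i.val = 0 then e else if i.val = 1 then f else
    if h : i.val < 10 then α ⟨i.val - 2, by omega⟩ else g

theorem gcomp_k : ∀ k l : Fin 8, GComp ⟨k.val + 2, by omega⟩ ⟨l.val + 2, by omega⟩ = -2 * cartanE8 k.val l.val := by
  have : Matrix.of (fun k l : Fin 8 => GComp ⟨k.val + 2, by omega⟩ ⟨l.val + 2, by omega⟩) =
    Matrix.of fun k l : Fin 8 => -2 * cartanE8 k.val l.val := by decide +kernel
  exact fun k l => congrFun (congrFun this k) l
theorem gcomp_1 : ∀ k : Fin 8, GComp 0 ⟨k.val + 2, by omega⟩ = 0 := by decide +kernel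
theorem gcomp_2 : ∀ k : Fin 8, GComp 1 ⟨k.val + 2, by omega⟩ = 0 := by decide +kernel
theorem gcomp_3 : ∀ k : Fin 8, GComp 10 ⟨k.val + 2, by omega⟩ = 0 := by decide +kernel
theorem gcomp_4 : ∀ k : Fin 8, GComp ⟨k.val + 2, by omega⟩ 0 = 0 := by decide +kernel
theorem gcomp_5 : ∀ k : Fin 8, GComp ⟨k.val + 2, by omega⟩ 1 = 0 := by decide +kernel
theorem gcomp_6 : ∀ k : Fin 8, GComp ⟨k.val + 2, by omega⟩ 10 = 0 := by decide +kernel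

theorem compl_basis (E : Emb t y) : ∃ b : Fin 11 → Fin 22 → ℤ, (∀ i j, BR ℤ (b i) (b j) = GComp i j) ∧
    (∀ i, InK t (b i)) ∧ ∀ z, InK t z → ∃ c : Fin 11 → ℤ, z = ∑ i, c i • b i := by
  obtain ⟨e, f, he, hf, hee, hff, hef⟩ := exists_hyp E
  have hfe : BR ℤ f e = 1 := by rw [BR_symm, hef]
  obtain ⟨μ, HL⟩ := mef_lat E he hf hee hff hef
  have hs : ∀ x y, ((1/2 : ℚ) • BR ℚ) x y = ((1/2 : ℚ) • BR ℚ) y x := by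
    intro x y; simp only [LinearMap.smul_apply]; rw [BR_symm]
  obtain ⟨_, ⟨g, hg, hge, hgf, rfl⟩, αq, hgg, hgα, hαM, hαα, hsp⟩ :=
    even_basis hs HL (mef_even E he hf hef) (frame_half (frame_ef E he hf hee hff hef))
  choose α hα hαe hαf hαq using hαM
  have hgg' : BR ℤ g g = 4 := by
    simp only [LinearMap.smul_apply, BR_cast, smul_eq_mul] at hgg
    have : ((BR ℤ g g : ℤ) : ℚ) = 4 := by linarith
    exact_mod_cast this
  have hgα' : ∀ i, BR ℤ g (α i) = 0 := by
    intro i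
    have := hgα i
    rw [← hαq i] at this
    simp only [LinearMap.smul_apply, BR_cast, smul_eq_mul] at this
    have : ((BR ℤ g (α i) : ℤ) : ℚ) = 0 := by linarith
    exact_mod_cast this
  have hαα' : ∀ i j, BR ℤ (α i) (α j) = -2 * cartanE8 i.val j.val := by
    intro i j
    have := hαα i j
    rw [← hαq i, ← hαq j] at this
    simp only [LinearMap.smul_apply, BR_cast, smul_eq_mul] at this
    have : ((BR ℤ (α i) (α j) : ℤ) : ℚ) = -2 * cartanE8 i.val j.val := by linarith
    exact_mod_cast this
  set b := basisOf e f g α with hb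
  have b0 : b 0 = e := rfl
  have b1 : b 1 = f := rfl
  have b10 : b 10 = g := rfl
  have bk : ∀ k : Fin 8, b ⟨k.val + 2, by omega⟩ = α k := by
    intro k
    have hk := k.isLt
    simp [hb, basisOf, hk]
  have gk := gcomp_k
  have g1 := gcomp_1
  have g2 := gcomp_2
  have g3 := gcomp_3
  have g4 := gcomp_4
  have g5 := gcomp_5
  have g6 := gcomp_6
  have g7 : GComp 0 0 = 0 := by decide
  have g8 : GComp 0 1 = 1 := by decide
  have g9 : GComp 1 0 = 1 := by decide
  have g10 : GComp 1 1 = 0 := by decide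
  have g11 : GComp 10 10 = 4 := by decide
  have g12 : GComp 0 10 = 0 := by decide
  have g13 : GComp 10 0 = 0 := by decide
  have g14 : GComp 1 10 = 0 := by decide
  have g15 : GComp 10 1 = 0 := by decide
  refine ⟨b, ?_, ?_, ?_⟩
  · intro i j
    rcases idx_cases i with rfl | rfl | ⟨k, rfl⟩ | rfl <;>
    rcases idx_cases j with rfl | rfl | ⟨l, rfl⟩ | rfl <;>
    simp only [b0, b1, b10, bk, gk, g1, g2, g3, g4, g5, g6, g7, g8, g9, g10, g11, g12, g13, g14, g15,
      hee, hff, hef, hfe, hge, hgf, hgg', hgα', hαα', hαe, hαf, BR_symm e g, BR_symm f g,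
      BR_symm e (α _), BR_symm f (α _), BR_symm (α _) g]
  · intro i
    rcases idx_cases i with rfl | rfl | ⟨k, rfl⟩ | rfl
    · exact he
    · exact hf
    · rw [bk]; exact hα k
    · exact hg
  · intro z hz
    set z' := z - (BR ℤ z f) • e - (BR ℤ z e) • f with hz'
    obtain ⟨n, c, hc⟩ := hsp (cv ℚ z') ⟨z', (hz.sub (he.smul _)).sub (hf.smul _), by
        rw [hz']
        simp only [map_sub, LinearMap.sub_apply, map_smul, LinearMap.smul_apply, smul_eq_mul, hee, hfe]; ring, by
        rw [hz']
        simp only [map_sub, LinearMap.sub_apply, map_smul, LinearMap.smul_apply, smul_eq_mul, hff, hef]; ring, rfl⟩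
    have hz2 : z' = n • g + ∑ i, c i • α i := by
      apply cv_inj
      rw [hc]
      simp only [map_add, map_sum, cv_smul, hαq]
    refine ⟨fun i => if i.val = 0 then BR ℤ z f else if i.val = 1 then BR ℤ z e else
      if h : i.val < 10 then c ⟨i.val - 2, by omega⟩ else n, ?_⟩
    have hz3 : z = z' + (BR ℤ z f) • e + (BR ℤ z e) • f := by rw [hz']; abel
    rw [Fin.sum_univ_succ, Fin.sum_univ_succ, Fin.sum_univ_castSucc]
    conv_lhs => rw [hz3, hz2]
    have : ∀ i : Fin 8, b i.castSucc.succ.succ = α i := fun i => bk i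
    have h10 : b (Fin.last 8).succ.succ = g := rfl
    have h1 : b (Fin.succ 0) = f := rfl
    rw [b0, h1, h10]
    simp only [this]
    have hlt : ∀ i : Fin 8, i.val + 1 + 1 < 10 := fun i => by omega
    simp [hlt, -zsmul_eq_mul]
    abel

end K3
end

section
open Matrix
namespace K3

/-- The matrix of an explicit primitive embedding. -/
def M0 : Matrix (Fin 22) (Fin 11) ℤ := Matrix.of fun i j =>
  if j.val < 2 then (if i.val = j.val + 16 then 1 else 0)
  else if j.val < 10 then (if i.val + 2 = j.val ∨ i.val = j.val + 6 then 1 else 0)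
  else (if i.val = 18 then 1 else if i.val = 19 then -2 else 0)

/-- A left inverse of `M0`. -/
def N0 : Matrix (Fin 11) (Fin 22) ℤ := Matrix.of fun j i =>
  if j.val < 2 then (if i.val = j.val + 16 then 1 else 0)
  else if j.val < 10 then (if i.val + 2 = j.val then 1 else 0)
  else (if i.val = 18 then 1 else 0)

theorem n0_m0 : N0 * M0 = 1 := by decide +kernel

theorem m0_gram : M0ᵀ * (GramK3 * M0) = GT := by decide +kernel

theorem exists_emb : ∃ ι : (Fin 11 → ℤ) →ₗ[ℤ] (Fin 22 → ℤ), IsPrimEmb ι := by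
  have hl : ∀ x, N0.mulVec (M0.mulVec x) = x := by
    intro x; rw [Matrix.mulVec_mulVec, n0_m0, Matrix.one_mulVec]
  refine ⟨M0.mulVecLin, ?_, ?_, ?_⟩
  · intro x y h
    simp only [Matrix.mulVecLin_apply] at h
    rw [← hl x, h, hl]
  · intro x y
    simp only [Matrix.mulVecLin_apply, BG]
    rw [← m0_gram, ← Matrix.mulVec_mulVec, ← Matrix.mulVec_mulVec, Matrix.mulVec_transpose,
      dotProduct_comm, dotProduct_comm x, ← Matrix.dotProduct_mulVec]
  · rintro y k hk ⟨x, hx⟩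
    refine ⟨N0.mulVec y, ?_⟩
    simp only [Matrix.mulVecLin_apply] at hx ⊢
    have h1 : x = k • N0.mulVec y := by rw [← hl x, hx, Matrix.mulVec_smul]
    rw [h1, Matrix.mulVec_smul] at hx
    exact smul_right_injective _ hk hx

theorem exists_retract {ι : (Fin 11 → ℤ) →ₗ[ℤ] (Fin 22 → ℤ)} (h : IsPrimEmb ι) :
    ∃ r : (Fin 22 → ℤ) →ₗ[ℤ] (Fin 11 → ℤ), ∀ x, r (ι x) = x := by
  obtain ⟨hi, -, ht⟩ := h
  have tf : Module.IsTorsionFree ℤ ((Fin 22 → ℤ) ⧸ LinearMap.range ι) := by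
    refine ⟨fun k hk => ?_⟩
    have hk0 : k ≠ 0 := hk.ne_zero
    intro a b hab
    obtain ⟨a, rfl⟩ := Submodule.Quotient.mk_surjective _ a
    obtain ⟨b, rfl⟩ := Submodule.Quotient.mk_surjective _ b
    simp only [← Submodule.Quotient.mk_smul] at hab
    rw [Submodule.Quotient.eq] at hab ⊢
    exact ht _ k hk0 (by rwa [smul_sub])
  obtain ⟨s, hs⟩ := Module.projective_lifting_property (LinearMap.range ι).mkQ LinearMap.id
    (Submodule.mkQ_surjective _)
  have hp : ∀ z, z - s ((LinearMap.range ι).mkQ z) ∈ LinearMap.range ι := by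
    intro z
    rw [← Submodule.Quotient.mk_eq_zero, ← Submodule.mkQ_apply, map_sub]
    have := LinearMap.congr_fun hs ((LinearMap.range ι).mkQ z)
    simp only [LinearMap.comp_apply, LinearMap.id_apply] at this
    rw [this, sub_self]
  let p : (Fin 22 → ℤ) →ₗ[ℤ] LinearMap.range ι :=
    LinearMap.codRestrict _ (LinearMap.id - s ∘ₗ (LinearMap.range ι).mkQ) hp
  refine ⟨(LinearEquiv.ofInjective ι hi).symm.toLinearMap ∘ₗ p, fun x => ?_⟩
  have : p (ι x) = LinearEquiv.ofInjective ι hi x := by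
    apply Subtype.ext
    have h0 : (LinearMap.range ι).mkQ (ι x) = 0 := by
      rw [Submodule.mkQ_apply, Submodule.Quotient.mk_eq_zero]; exact ⟨x, rfl⟩
    simp only [p, LinearMap.codRestrict_apply, LinearMap.sub_apply, LinearMap.id_apply,
      LinearMap.comp_apply, h0, map_zero, sub_zero]
    rfl
  simp [this]

theorem bg_single {n : ℕ} (G : Matrix (Fin n) (Fin n) ℤ) (i j : Fin n) :
    BG G (Pi.single i 1) (Pi.single j 1) = G i j := by
  simp [BG]

theorem bg_sum {n : ℕ} (G : Matrix (Fin n) (Fin n) ℤ) (x y : Fin n → ℤ) :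
    BG G x y = ∑ i, ∑ j, x i * y j * G i j := by
  simp only [BG, dotProduct, Matrix.mulVec, Finset.mul_sum]
  exact Finset.sum_congr rfl fun i _ => Finset.sum_congr rfl fun j _ => by ring

theorem exists_Emb {ι : (Fin 11 → ℤ) →ₗ[ℤ] (Fin 22 → ℤ)} (h : IsPrimEmb ι) :
    ∃ y, Emb (fun i => ι (Pi.single i 1)) y := by
  obtain ⟨r, hr⟩ := exists_retract h
  refine ⟨fun j => ∑ k, (r (Pi.single k 1)) j • gd k, ⟨fun i j => ?_, fun i j => ?_⟩⟩
  · rw [BR_int, h.2.1, bg_single]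
  · have hg : ∀ (z : Fin 22 → ℤ) k, BR ℤ z (gd k) = z k := by
      intro z k
      have := BR_gd z k
      have h2 : cv ℤ (gd k) = gd k := by ext; simp [cv]
      rwa [h2] at this
    have key : ∀ z : Fin 22 → ℤ, BR ℤ z (∑ k, (r (Pi.single k 1)) j • gd k) = r z j := by
      intro z
      simp only [map_sum, map_smul, hg, smul_eq_mul]
      conv_rhs => rw [LinearMap.pi_apply_eq_sum_univ r z]
      simp only [Finset.sum_apply, Pi.smul_apply, smul_eq_mul]
      refine Finset.sum_congr rfl fun k _ => ?_
      rw [mul_comm]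
      have hp : (Pi.single k 1 : Fin 22 → ℤ) = fun j => if k = j then 1 else 0 := by
        ext l; simp [Pi.single_apply, eq_comm]
      rw [hp]
    rw [key, hr]
    simp [Pi.single_apply, eq_comm]

/-- Integral inverse of `GComp` up to a diagonal factor. -/
def GCI : Matrix (Fin 11) (Fin 11) ℤ := Matrix.of fun i j =>
  if i = 10 ∧ j = 10 then 1 else GTI i j

theorem gcomp_gci : GComp * GCI = Matrix.diagonal den := by decide +kernel

theorem final {ι : (Fin 11 → ℤ) →ₗ[ℤ] (Fin 22 → ℤ)} (h : IsPrimEmb ι) :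
      ∃ e : (Fin 11 → ℤ) →ₗ[ℤ] (Fin 22 → ℤ),
        Function.Injective e ∧
        (∀ x y : Fin 11 → ℤ, BG GramK3 (e x) (e y) = BG GComp x y) ∧
        (∀ z : Fin 22 → ℤ,
          z ∈ LinearMap.range e ↔ ∀ x : Fin 11 → ℤ, BG GramK3 z (ι x) = 0) := by
  obtain ⟨y, E⟩ := exists_Emb h
  obtain ⟨b, hb, hbK, hsp⟩ := compl_basis E
  have hiso : ∀ x y : Fin 11 → ℤ, BG GramK3 (Fintype.linearCombination ℤ b x)
      (Fintype.linearCombination ℤ b y) = BG GComp x y := by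
    intro x y
    rw [← BR_int, bg_sum]
    simp only [Fintype.linearCombination_apply, map_sum, LinearMap.sum_apply, map_smul,
      LinearMap.smul_apply, smul_eq_mul, hb, Finset.mul_sum]
    rw [Finset.sum_comm]
    exact Finset.sum_congr rfl fun i _ => Finset.sum_congr rfl fun j _ => by ring
  refine ⟨Fintype.linearCombination ℤ b, ?_, hiso, fun z => ?_⟩
  · rw [← LinearMap.ker_eq_bot, LinearMap.ker_eq_bot']
    intro x hx
    have h0 : ∀ j, BG GComp x (GCI.mulVec (Pi.single j 1)) = 0 := by
      intro j
      rw [← hiso, hx]; simp [BG]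
    ext j
    have := h0 j
    rw [BG, Matrix.mulVec_mulVec, gcomp_gci] at this
    simp [den_ne] at this
    exact this
  · have hι : ∀ x, ι x = ∑ i, x i • ι (Pi.single i 1) := by
      intro x
      conv_lhs => rw [LinearMap.pi_apply_eq_sum_univ ι x]
      refine Finset.sum_congr rfl fun k _ => ?_
      congr 2
      ext l; simp [Pi.single_apply, eq_comm]
    constructor
    · rintro ⟨c, rfl⟩ x
      rw [← BR_int, hι]
      have hbK' : ∀ i j, BR ℤ (b i) (ι (Pi.single j 1)) = 0 := fun i j => hbK i j
      simp [Fintype.linearCombination_apply, hbK', -zsmul_eq_mul]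
    · intro hz
      obtain ⟨c, hc⟩ := hsp z (fun i => by rw [BR_int]; exact hz _)
      exact ⟨c, by rw [Fintype.linearCombination_apply, hc]⟩

end K3
end

/-- The lattice `T = U ⊕ E8(2) ⊕ [−4]` admits a primitive embedding into the K3 lattice
`L = 2E8 ⊕ 3U`, and for every such primitive embedding the orthogonal complement of its
image is isometric to `U ⊕ E8(2) ⊕ [4]`. -/
theorem primEmb_exists_and_complement :
    (∃ ι : (Fin 11 → ℤ) →ₗ[ℤ] (Fin 22 → ℤ), IsPrimEmb ι) ∧
    ∀ ι : (Fin 11 → ℤ) →ₗ[ℤ] (Fin 22 → ℤ), IsPrimEmb ι →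
      ∃ e : (Fin 11 → ℤ) →ₗ[ℤ] (Fin 22 → ℤ),
        Function.Injective e ∧
        (∀ x y : Fin 11 → ℤ, BG GramK3 (e x) (e y) = BG GComp x y) ∧
        (∀ z : Fin 22 → ℤ,
          z ∈ LinearMap.range e ↔ ∀ x : Fin 11 → ℤ, BG GramK3 z (ι x) = 0) := by
  exact ⟨K3.exists_emb, fun _ h => K3.final h⟩
end

section
/- Any two primitive embeddings ι₁, ι₂ of the lattice T = U ⊕ E8(2) ⊕ [−4] into the K3 lattice L = 2E8 ⊕ 3U are conjugate by an isometry of L: there exists a ℤ-linear automorphism φ of ℤ^22 with B_{G_L}(φ(x), φ(y)) = B_{G_L}(x,y) for all x, y such that φ ∘ ι₁ = ι₂. -/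
open Matrix

/-- An even lattice structure. -/
structure EvLat (V : Type) [AddCommGroup V] where
  B : V →ₗ[ℤ] V →ₗ[ℤ] ℤ
  q : V → ℤ
  symm : ∀ x y, B x y = B y x
  even : ∀ x, B x x = 2 * q x

namespace EvLat

variable {V : Type} [AddCommGroup V] (E : EvLat V)

/-- Isometries. -/
def IsIsom (g : V ≃ₗ[ℤ] V) : Prop := ∀ x y, E.B (g x) (g y) = E.B x y

/-- Eichler transvection. -/
def tv (e w : V) : V →ₗ[ℤ] V :=
  LinearMap.id + (E.B e).smulRight w - (E.B w).smulRight e - E.q w • (E.B e).smulRight e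

theorem tv_apply (e w x : V) :
    E.tv e w x = x + E.B e x • w - E.B w x • e - (E.q w * E.B e x) • e := by
  simp [tv, mul_smul, smul_comm (E.B e x) (E.q w) e]

theorem q_neg (w : V) : E.q (-w) = E.q w := by
  have h1 := E.even (-w)
  have h2 := E.even w
  simp at h1
  linarith

theorem tv_inv (e w x : V) (he : E.B e e = 0) (hw : E.B e w = 0) :
    E.tv e w (E.tv e (-w) x) = x := by
  have hw' : E.B w e = 0 := by rw [E.symm]; exact hw
  have h2 := E.even w
  simp only [tv_apply, q_neg, map_add, map_sub, map_smul, map_neg, LinearMap.neg_apply, he, hw, hw',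
    h2]
  module

theorem exists_tv (e w : V) (he : E.B e e = 0) (hw : E.B e w = 0) :
    ∃ g : V ≃ₗ[ℤ] V, E.IsIsom g ∧ ∀ x, g x = E.tv e w x := by
  refine ⟨LinearEquiv.ofLinearMap (E.tv e w) (E.tv e (-w)) ?_ ?_, ?_, ?_⟩
  · ext x
    exact E.tv_inv e w x he hw
  · ext x
    have := E.tv_inv e (-w) x he (by simp [hw])
    simpa using this
  · intro x y
    have hw' : E.B w e = 0 := by rw [E.symm]; exact hw
    have h2 := E.even w
    simp only [LinearEquiv.coe_ofLinearMap, tv_apply, map_add, map_sub, map_smul, LinearMap.add_apply,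
      LinearMap.sub_apply, LinearMap.smul_apply, he, hw, hw', h2, smul_eq_mul, E.symm x e, E.symm x w]
    ring
  · intro x
    rfl

/-- Key lemma: hyperbolic pairs orthogonal to `F` are conjugate by isometries fixing `F`,
provided there is room. -/
theorem key (F : Set V) (e f e1 f1 x y : V)
    (hF : ∀ v ∈ F, E.B v e = 0 ∧ E.B v f = 0 ∧ E.B v e1 = 0 ∧ E.B v f1 = 0 ∧
      E.B v x = 0 ∧ E.B v y = 0)
    (hee : E.B e e = 0) (hff : E.B f f = 0) (hef : E.B e f = 1)
    (hee1 : E.B e1 e1 = 0) (hff1 : E.B f1 f1 = 0) (hef1 : E.B e1 f1 = 1)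
    (h1 : E.B e e1 = 0) (h2 : E.B e f1 = 0) (h3 : E.B f e1 = 0) (h4 : E.B f f1 = 0)
    (hxx : E.B x x = 0) (hyy : E.B y y = 0) (hxy : E.B x y = 1) :
    ∃ g : V ≃ₗ[ℤ] V, E.IsIsom g ∧ (∀ v ∈ F, g v = v) ∧ g x = e ∧ g y = f := by
  set O : V → V → Prop := fun a b => ∃ g : V ≃ₗ[ℤ] V, E.IsIsom g ∧ (∀ v ∈ F, g v = v) ∧
    g x = a ∧ g y = b with hO
  change O e f
  have hfe : E.B f e = 1 := by rw [E.symm]; exact hef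
  have hfe1 : E.B f1 e1 = 1 := by rw [E.symm]; exact hef1
  have h1' : E.B e1 e = 0 := by rw [E.symm]; exact h1
  have h2' : E.B f1 e = 0 := by rw [E.symm]; exact h2
  have h3' : E.B e1 f = 0 := by rw [E.symm]; exact h3
  have h4' : E.B f1 f = 0 := by rw [E.symm]; exact h4
  have qe : E.q e = 0 := by have := E.even e; omega
  have qf : E.q f = 0 := by have := E.even f; omega
  have qe1 : E.q e1 = 0 := by have := E.even e1; omega
  have qf1 : E.q f1 = 0 := by have := E.even f1; omega
  have q0 : ∀ (k : ℤ) w, E.B w w = 0 → E.q (k • w) = 0 := by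
    intro k w hw
    have := E.even (k • w)
    simp [hw] at this
    exact this
  -- basic orbit facts
  have hOxy : O x y := ⟨LinearEquiv.refl ℤ V, fun _ _ => rfl, fun _ _ => rfl, rfl, rfl⟩
  have hfacts : ∀ a b, O a b → (∀ v ∈ F, E.B v a = 0 ∧ E.B v b = 0) ∧ E.B a a = 0 ∧ E.B b b = 0 ∧
      E.B a b = 1 := by
    rintro a b ⟨g, hg, hgF, rfl, rfl⟩
    refine ⟨fun v hv => ?_, by rw [hg, hxx], by rw [hg, hyy], by rw [hg, hxy]⟩
    obtain ⟨-, -, -, -, hx, hy⟩ := hF v hv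
    constructor
    · nth_rewrite 1 [← hgF v hv]
      rw [hg, hx]
    · nth_rewrite 1 [← hgF v hv]
      rw [hg, hy]
  have hcl : ∀ u w, (∀ v ∈ F, E.B v u = 0) → (∀ v ∈ F, E.B v w = 0) → E.B u u = 0 → E.B u w = 0 →
      ∀ a b, O a b → O (E.tv u w a) (E.tv u w b) := by
    rintro u w hu hw huu huw a b ⟨g, hg, hgF, rfl, rfl⟩
    obtain ⟨t, ht, htt⟩ := E.exists_tv u w huu huw
    refine ⟨g.trans t, fun x y => ?_, fun v hv => ?_, ?_, ?_⟩
    · simp only [LinearEquiv.trans_apply]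
      rw [ht, hg]
    · simp only [LinearEquiv.trans_apply]
      rw [hgF v hv, htt, tv_apply, E.symm u, E.symm w, hu v hv, hw v hv]
      simp
    · simp only [LinearEquiv.trans_apply]
      rw [htt]
    · simp only [LinearEquiv.trans_apply]
      rw [htt]
  have Fe : ∀ v ∈ F, E.B v e = 0 := fun v hv => (hF v hv).1
  have Ff : ∀ v ∈ F, E.B v f = 0 := fun v hv => (hF v hv).2.1
  have Fe1 : ∀ v ∈ F, E.B v e1 = 0 := fun v hv => (hF v hv).2.2.1
  have Ff1 : ∀ v ∈ F, E.B v f1 = 0 := fun v hv => (hF v hv).2.2.2.1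
  -- moves on the four coordinates
  have mv1 : ∀ (k : ℤ) a b, O a b → ∃ a' b', O a' b' ∧ E.B f a' = E.B f a + k * E.B f1 a ∧
      E.B f1 a' = E.B f1 a := by
    intro k a b hab
    refine ⟨_, _, hcl f1 (k • e) Ff1 (fun v hv => by simp [Fe v hv]) hff1 (by simp [h2']) a b hab, ?_, ?_⟩
    · simp [tv_apply, q0 k e hee, hfe, h4]
      ring
    · simp [tv_apply, q0 k e hee, h2', hff1]
  have mv1' : ∀ (k : ℤ) a b, O a b → ∃ a' b', O a' b' ∧ E.B f a' = E.B f a + k * E.B e1 a ∧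
      E.B e1 a' = E.B e1 a := by
    intro k a b hab
    refine ⟨_, _, hcl e1 (k • e) Fe1 (fun v hv => by simp [Fe v hv]) hee1 (by simp [h1']) a b hab, ?_, ?_⟩
    · simp [tv_apply, q0 k e hee, hfe, h3]
      ring
    · simp [tv_apply, q0 k e hee, h1', hee1]
  have mv2 : ∀ (k : ℤ) a b, O a b → ∃ a' b', O a' b' ∧ E.B f a' = E.B f a ∧
      E.B f1 a' = E.B f1 a + k * E.B f a := by
    intro k a b hab
    refine ⟨_, _, hcl f (k • e1) Ff (fun v hv => by simp [Fe1 v hv]) hff (by simp [h3]) a b hab, ?_, ?_⟩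
    · simp [tv_apply, q0 k e1 hee1, h3, hff]
    · simp [tv_apply, q0 k e1 hee1, hfe1, h4']
      ring
  have mv2' : ∀ (k : ℤ) a b, O a b → ∃ a' b', O a' b' ∧ E.B f a' = E.B f a ∧
      E.B e1 a' = E.B e1 a + k * E.B f a := by
    intro k a b hab
    refine ⟨_, _, hcl f (k • f1) Ff (fun v hv => by simp [Ff1 v hv]) hff (by simp [h4]) a b hab, ?_, ?_⟩
    · simp [tv_apply, q0 k f1 hff1, h4, hff]
    · simp [tv_apply, q0 k f1 hff1, hef1, h3']
      ring
  have mv3 : ∀ m, (∀ v ∈ F, E.B v m = 0) → E.B f1 m = 0 → E.B e1 m = 0 → ∀ a b, O a b →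
      E.B f1 a = 0 → ∃ a' b', O a' b' ∧ E.B f a' = E.B f a ∧ E.B e1 a' = E.B e1 a - E.B m a := by
    intro m hm hm1 hm2 a b hab ha
    refine ⟨_, _, hcl f1 m Ff1 hm hff1 hm1 a b hab, ?_, ?_⟩
    · simp [tv_apply, ha, h4]
    · simp [tv_apply, ha, hef1]
  -- splitting off the plane e1 f1
  have hsplit : ∀ (d : ℤ) a b, O a b → E.B f1 a = 0 → d ∣ E.B e1 a →
      (∀ m, (∀ v ∈ F, E.B v m = 0) → E.B f1 m = 0 → E.B e1 m = 0 → d ∣ E.B m a) → d ∣ 1 := by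
    intro d a b hab ha1 ha2 hm
    obtain ⟨hK, -, -, hab1⟩ := hfacts a b hab
    have := hm (b - E.B f1 b • e1 - E.B e1 b • f1) (fun v hv => by
      simp [(hK v hv).2, Fe1 v hv, Ff1 v hv]) (by simp [hfe1, hff1]) (by simp [hef1, hee1])
    simp only [map_sub, map_smul, LinearMap.sub_apply, LinearMap.smul_apply, ha1, smul_eq_mul,
      E.symm b a, hab1] at this
    have h := dvd_add this (Dvd.dvd.mul_left ha2 (E.B f1 b))
    simpa using h
  -- positive coordinate exists
  have hpos : ∃ n : ℕ, 0 < n ∧ ∃ a b, O a b ∧ E.B f a = n := by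
    by_contra hcon
    have hle : ∀ a b, O a b → E.B f a ≤ 0 := by
      intro a b hab
      by_contra hlt
      push Not at hlt
      exact hcon ⟨(E.B f a).toNat, by omega, a, b, hab, by omega⟩
    have hc0 : ∀ a b, O a b → E.B f1 a = 0 := by
      intro a b hab
      obtain ⟨a', b', hab', h, -⟩ := mv1 (E.B f1 a * (1 - E.B f a)) a b hab
      have := hle _ _ hab'
      have h0 := hle _ _ hab
      rw [h] at this
      by_contra hne
      have : 0 < E.B f1 a * E.B f1 a := mul_self_pos.mpr hne
      nlinarith
    have hd0 : ∀ a b, O a b → E.B e1 a = 0 := by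
      intro a b hab
      obtain ⟨a', b', hab', h, -⟩ := mv1' (E.B e1 a * (1 - E.B f a)) a b hab
      have := hle _ _ hab'
      have h0 := hle _ _ hab
      rw [h] at this
      by_contra hne
      have : 0 < E.B e1 a * E.B e1 a := mul_self_pos.mpr hne
      nlinarith
    have := hsplit 0 x y hOxy (hc0 _ _ hOxy) (by rw [hd0 _ _ hOxy]) (fun m hm hm1 hm2 => by
      obtain ⟨a', b', hab', -, h⟩ := mv3 m hm hm1 hm2 x y hOxy (hc0 _ _ hOxy)
      rw [hd0 _ _ hab', hd0 _ _ hOxy] at h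
      have : E.B m x = 0 := by linarith
      rw [this])
    simp at this
  classical
  obtain ⟨n, ⟨hn0, a, b, hab, ha⟩, hmin⟩ : ∃ n : ℕ, (0 < n ∧ ∃ a b, O a b ∧ E.B f a = n) ∧
      ∀ m : ℕ, 0 < m → (∃ a b, O a b ∧ E.B f a = m) → n ≤ m :=
    ⟨Nat.find hpos, Nat.find_spec hpos, fun m h0 hm => Nat.find_min' hpos ⟨h0, hm⟩⟩
  have hn0' : (0 : ℤ) < n := by exact_mod_cast hn0
  have hminZ : ∀ a b, O a b → 0 < E.B f a → (n : ℤ) ≤ E.B f a := by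
    intro a b hab h0
    have := hmin (E.B f a).toNat (by omega) ⟨a, b, hab, by omega⟩
    omega
  have arith : ∀ r : ℤ, 0 < r → 0 < (n : ℤ) + (-(((n : ℤ) - 1) / r)) * r ∧
      (n : ℤ) + (-(((n : ℤ) - 1) / r)) * r ≤ r := by
    intro r hr
    have h1 := Int.emod_add_mul_ediv ((n : ℤ) - 1) r
    have h2 := Int.emod_nonneg ((n : ℤ) - 1) hr.ne'
    have h3 := Int.emod_lt_of_pos ((n : ℤ) - 1) hr
    constructor <;> nlinarith
  have hdiv1 : ∀ a b, O a b → E.B f a = n → (n : ℤ) ∣ E.B f1 a := by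
    intro a b hab ha
    obtain ⟨a', b', hab', h1, h2⟩ := mv2 (-(E.B f1 a / n)) a b hab
    rw [ha] at h1 h2
    have hr : E.B f1 a' = E.B f1 a % n := by
      rw [h2, Int.emod_def]; ring
    by_contra hnd
    have hr0 : 0 < E.B f1 a % n := by
      have := Int.emod_nonneg (E.B f1 a) hn0'.ne'
      have h' : E.B f1 a % n ≠ 0 := fun h => hnd (Int.dvd_of_emod_eq_zero h)
      omega
    have hr1 := Int.emod_lt_of_pos (E.B f1 a) hn0'
    obtain ⟨p1, p2⟩ := arith _ hr0
    obtain ⟨a2, b2, hab2, h3, -⟩ := mv1 (-(((n : ℤ) - 1) / (E.B f1 a % n))) a' b' hab'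
    rw [h1, hr] at h3
    have := hminZ _ _ hab2 (by rw [h3]; exact p1)
    linarith
  have hdiv2 : ∀ a b, O a b → E.B f a = n → (n : ℤ) ∣ E.B e1 a := by
    intro a b hab ha
    obtain ⟨a', b', hab', h1, h2⟩ := mv2' (-(E.B e1 a / n)) a b hab
    rw [ha] at h1 h2
    have hr : E.B e1 a' = E.B e1 a % n := by
      rw [h2, Int.emod_def]; ring
    by_contra hnd
    have hr0 : 0 < E.B e1 a % n := by
      have := Int.emod_nonneg (E.B e1 a) hn0'.ne'
      have h' : E.B e1 a % n ≠ 0 := fun h => hnd (Int.dvd_of_emod_eq_zero h)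
      omega
    have hr1 := Int.emod_lt_of_pos (E.B e1 a) hn0'
    obtain ⟨p1, p2⟩ := arith _ hr0
    obtain ⟨a2, b2, hab2, h3, -⟩ := mv1' (-(((n : ℤ) - 1) / (E.B e1 a % n))) a' b' hab'
    rw [h1, hr] at h3
    have := hminZ _ _ hab2 (by rw [h3]; exact p1)
    linarith
  have hn1 : (n : ℤ) ∣ 1 := by
    obtain ⟨k, hk⟩ := hdiv1 a b hab ha
    obtain ⟨a', b', hab', g1, g2⟩ := mv2 (-k) a b hab
    rw [ha] at g1 g2
    have hz : E.B f1 a' = 0 := by rw [g2, hk]; ring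
    refine hsplit n a' b' hab' hz (hdiv2 _ _ hab' g1) (fun m hm hm1 hm2 => ?_)
    obtain ⟨a2, b2, hab2, k1, k2⟩ := mv3 m hm hm1 hm2 a' b' hab' hz
    have d1 := hdiv2 _ _ hab2 (by rw [k1, g1])
    have d2 := hdiv2 _ _ hab' g1
    have : E.B m a' = E.B e1 a' - E.B e1 a2 := by rw [k2]; ring
    rw [this]
    exact dvd_sub d2 d1
  have hn : (n : ℤ) = 1 := by
    have := Int.le_of_dvd one_pos hn1
    omega
  rw [hn] at ha
  clear hdiv1 hdiv2 arith hminZ hmin mv1 mv1' mv2 mv2' mv3 hsplit hpos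
  -- kill the rest
  have step : ∃ b', O e b' := by
    obtain ⟨hK, haa, -, -⟩ := hfacts a b hab
    have ha' : E.B a f = 1 := by rw [E.symm]; exact ha
    set w : V := -(a - E.B f a • e - E.B e a • f) with hw
    have hfw : E.B f w = 0 := by simp [hw, hfe, hff]
    have hew : E.B e w = 0 := by simp [hw, hef, hee]
    have hwF : ∀ v ∈ F, E.B v w = 0 := fun v hv => by simp [hw, (hK v hv).1, Fe v hv, Ff v hv]
    have hO2 := hcl f w Ff hwF hff hfw a b hab
    set a' := E.tv f w a with ha'def
    obtain ⟨-, haa', -, -⟩ := hfacts _ _ hO2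
    have hform : ∃ c : ℤ, a' = e + c • f := by
      refine ⟨E.B e a - E.B w a - E.q w, ?_⟩
      rw [ha'def, tv_apply, ha]
      have : w = -a + e + E.B e a • f := by rw [hw, ha]; module
      nth_rewrite 1 [this]
      module
    obtain ⟨c, hc⟩ := hform
    rw [hc] at haa'
    simp [hee, hef, hfe, hff] at haa'
    have hc0 : c = 0 := by omega
    rw [hc, hc0] at hO2
    simp at hO2
    exact ⟨_, hO2⟩
  obtain ⟨b', hb'⟩ := step
  obtain ⟨hK, -, hbb, heb⟩ := hfacts _ _ hb'
  have hbe : E.B b' e = 1 := by rw [E.symm]; exact heb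
  set w : V := -(b' - E.B f b' • e - f) with hw
  have hew : E.B e w = 0 := by simp [hw, hef, hee, heb]
  have hwe : E.B w e = 0 := by rw [E.symm]; exact hew
  have hwF : ∀ v ∈ F, E.B v w = 0 := fun v hv => by simp [hw, (hK v hv).2, Fe v hv, Ff v hv]
  have hO2 := hcl e w Fe hwF hee hew _ _ hb'
  obtain ⟨-, -, hbb', -⟩ := hfacts _ _ hO2
  have e1 : E.tv e w e = e := by simp [tv_apply, hee, hwe]
  have hform : ∃ c : ℤ, E.tv e w b' = f + c • e := by
    refine ⟨E.B f b' - E.B w b' - E.q w, ?_⟩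
    rw [tv_apply, heb]
    have : w = -b' + f + E.B f b' • e := by rw [hw]; module
    nth_rewrite 1 [this]
    module
  obtain ⟨c, hc⟩ := hform
  rw [hc] at hbb'
  simp [hee, hef, hfe, hff] at hbb'
  have hc0 : c = 0 := by omega
  rw [e1, hc, hc0] at hO2
  simpa using hO2

/-- Iterated version of `key`. -/
theorem key_iter (n : ℕ) (e f x y : Fin n → V) (F : Set V) (e1 f1 : V)
    (hF : ∀ v ∈ F, E.B v e1 = 0 ∧ E.B v f1 = 0 ∧ ∀ i, E.B v (e i) = 0 ∧ E.B v (f i) = 0 ∧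
      E.B v (x i) = 0 ∧ E.B v (y i) = 0)
    (hee1 : E.B e1 e1 = 0) (hff1 : E.B f1 f1 = 0) (hef1 : E.B e1 f1 = 1)
    (h1 : ∀ i, E.B (e i) e1 = 0) (h2 : ∀ i, E.B (e i) f1 = 0)
    (h3 : ∀ i, E.B (f i) e1 = 0) (h4 : ∀ i, E.B (f i) f1 = 0)
    (hee : ∀ i j, E.B (e i) (e j) = 0) (hff : ∀ i j, E.B (f i) (f j) = 0)
    (hef : ∀ i j, E.B (e i) (f j) = if i = j then 1 else 0)
    (hxx : ∀ i j, E.B (x i) (x j) = 0) (hyy : ∀ i j, E.B (y i) (y j) = 0)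
    (hxy : ∀ i j, E.B (x i) (y j) = if i = j then 1 else 0) :
    ∀ k ≤ n, ∃ g : V ≃ₗ[ℤ] V, E.IsIsom g ∧ (∀ v ∈ F, g v = v) ∧
      ∀ i : Fin n, i.val < k → g (x i) = e i ∧ g (y i) = f i := by
  intro k
  induction k with
  | zero =>
    intro _
    exact ⟨LinearEquiv.refl ℤ V, fun _ _ => rfl, fun _ _ => rfl, fun i hi => absurd hi (by omega)⟩
  | succ k ih =>
    intro hk
    obtain ⟨g, hg, hgF, hgk⟩ := ih (by omega)
    set c : Fin n := ⟨k, by omega⟩ with hc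
    have hfe : ∀ i j, E.B (f i) (e j) = if i = j then 1 else 0 := by
      intro i j; rw [E.symm, hef]; simp [eq_comm]
    have hyx : ∀ i j, E.B (y i) (x j) = if i = j then 1 else 0 := by
      intro i j; rw [E.symm, hxy]; simp [eq_comm]
    have hne : ∀ i : Fin n, i.val < k → i ≠ c := by
      intro i hi h
      rw [h, hc] at hi
      simp at hi
    obtain ⟨t, ht, htF, ht1, ht2⟩ := E.key (F ∪ {v | ∃ i : Fin n, i.val < k ∧ (v = e i ∨ v = f i)})
      (e c) (f c) e1 f1 (g (x c)) (g (y c)) (by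
        rintro v (hv | ⟨i, hi, rfl | rfl⟩)
        · obtain ⟨a1, a2, a3⟩ := hF v hv
          obtain ⟨b1, b2, b3, b4⟩ := a3 c
          refine ⟨b1, b2, a1, a2, ?_, ?_⟩
          · rw [← hgF v hv, hg, b3]
          · rw [← hgF v hv, hg, b4]
        · refine ⟨hee _ _, by rw [hef, if_neg (hne i hi)], h1 _, h2 _, ?_, ?_⟩
          · rw [← (hgk i hi).1, hg, hxx]
          · rw [← (hgk i hi).1, hg, hxy, if_neg (hne i hi)]
        · refine ⟨by rw [hfe, if_neg (hne i hi)], hff _ _, h3 _, h4 _, ?_, ?_⟩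
          · rw [← (hgk i hi).2, hg, hyx, if_neg (hne i hi)]
          · rw [← (hgk i hi).2, hg, hyy])
      (hee _ _) (hff _ _) (by simp [hef]) hee1 hff1 hef1 (h1 _) (h2 _) (h3 _) (h4 _)
      (by rw [hg, hxx]) (by rw [hg, hyy]) (by rw [hg, hxy]; simp)
    refine ⟨g.trans t, fun a b => ?_, fun v hv => ?_, fun i hi => ?_⟩
    · simp only [LinearEquiv.trans_apply]
      rw [ht, hg]
    · simp only [LinearEquiv.trans_apply]
      rw [hgF v hv, htF v (Or.inl hv)]
    · simp only [LinearEquiv.trans_apply]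
      by_cases h : i.val < k
      · rw [(hgk i h).1, (hgk i h).2]
        exact ⟨htF _ (Or.inr ⟨i, h, Or.inl rfl⟩), htF _ (Or.inr ⟨i, h, Or.inr rfl⟩)⟩
      · have : i = c := by ext; simp [hc]; omega
        rw [this]
        exact ⟨ht1, ht2⟩

/-- Orthogonal sum with `n` hyperbolic planes. -/
def ext (n : ℕ) : EvLat (V × (Fin n → ℤ) × (Fin n → ℤ)) where
  B := LinearMap.mk₂ ℤ (fun x y => E.B x.1 y.1 + x.2.1 ⬝ᵥ y.2.2 + x.2.2 ⬝ᵥ y.2.1)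
    (by intro x y z; simp; ring) (by
      intro c x y
      simp only [Prod.smul_fst, Prod.smul_snd, map_smul, LinearMap.smul_apply, smul_dotProduct,
        dotProduct_smul, smul_eq_mul]
      ring)
    (by intro x y z; simp; ring) (by
      intro c x y
      simp only [Prod.smul_fst, Prod.smul_snd, map_smul, LinearMap.smul_apply, smul_dotProduct,
        dotProduct_smul, smul_eq_mul]
      ring)
  q := fun x => E.q x.1 + x.2.1 ⬝ᵥ x.2.2
  symm := by
    intro x y
    simp only [LinearMap.mk₂_apply]
    rw [E.symm x.1 y.1, dotProduct_comm x.2.1, dotProduct_comm x.2.2]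
    ring
  even := by
    intro x
    simp only [LinearMap.mk₂_apply]
    rw [E.even, dotProduct_comm x.2.2]
    ring

theorem ext_B (n : ℕ) (x y : V × (Fin n → ℤ) × (Fin n → ℤ)) :
    (E.ext n).B x y = E.B x.1 y.1 + x.2.1 ⬝ᵥ y.2.2 + x.2.2 ⬝ᵥ y.2.1 := rfl

theorem ext_q (n : ℕ) (x : V × (Fin n → ℤ) × (Fin n → ℤ)) :
    (E.ext n).q x = E.q x.1 + x.2.1 ⬝ᵥ x.2.2 := rfl

theorem q_zero : E.q 0 = 0 := by
  have := E.even 0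
  simp at this
  exact this

theorem normal1 {n : ℕ} (a y : Fin n → V)
    (hay : ∀ i j, E.B (a i) (y j) = if i = j then 1 else 0) :
    ∀ m ≤ n, ∃ g : (V × (Fin n → ℤ) × (Fin n → ℤ)) ≃ₗ[ℤ] (V × (Fin n → ℤ) × (Fin n → ℤ)),
      (E.ext n).IsIsom g ∧
      ∀ k : Fin n, g (a k, 0, 0) = (a k, if k.val < m then Pi.single k 1 else 0, 0) := by
  intro m
  induction m with
  | zero =>
    intro _
    exact ⟨LinearEquiv.refl ℤ _, fun _ _ => rfl, fun k => by simp⟩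
  | succ m ih =>
    intro hm
    obtain ⟨g, hg, hgk⟩ := ih (by omega)
    set c : Fin n := ⟨m, by omega⟩ with hc
    obtain ⟨t, ht, htt⟩ := (E.ext n).exists_tv (0, Pi.single c 1, 0) (-y c, 0, 0)
      (by simp [ext_B]) (by simp [ext_B])
    refine ⟨g.trans t, fun a b => ?_, fun k => ?_⟩
    · simp only [LinearEquiv.trans_apply]
      rw [ht, hg]
    · simp only [LinearEquiv.trans_apply]
      rw [hgk, htt, tv_apply]
      have h1 : E.B (y c) (a k) = if k = c then 1 else 0 := by rw [E.symm, hay]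
      simp only [ext_B, ext_q]
      by_cases hkc : k = c
      · subst hkc
        have hcm : c.val = m := rfl
        have h2 : E.B (y c) (a c) = 1 := by rw [h1]; simp
        simp [h2, hcm]
      · have h2 : (k.val < m + 1) ↔ (k.val < m) := by
          have : k.val ≠ m := fun h => hkc (by ext; simp [hc, h])
          omega
        simp [h1, hkc, h2]

theorem normal2 {n : ℕ} (a : Fin n → V) :
    ∀ m ≤ n, ∃ g : (V × (Fin n → ℤ) × (Fin n → ℤ)) ≃ₗ[ℤ] (V × (Fin n → ℤ) × (Fin n → ℤ)),
      (E.ext n).IsIsom g ∧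
      ∀ k : Fin n, g (a k, Pi.single k 1, 0) = (if k.val < m then 0 else a k, Pi.single k 1,
        fun i => if i.val < m then (if i < k then E.B (a k) (a i) else if i = k then E.q (a k) else 0)
          else 0) := by
  intro m
  induction m with
  | zero =>
    intro _
    exact ⟨LinearEquiv.refl ℤ _, fun _ _ => rfl, fun k => by simp; rfl⟩
  | succ m ih =>
    intro hm
    obtain ⟨g, hg, hgk⟩ := ih (by omega)
    set c : Fin n := ⟨m, by omega⟩ with hc
    obtain ⟨t, ht, htt⟩ := (E.ext n).exists_tv (0, 0, Pi.single c 1) (-a c, 0, 0)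
      (by simp [ext_B]) (by simp [ext_B])
    refine ⟨g.trans t, fun a b => ?_, fun k => ?_⟩
    · simp only [LinearEquiv.trans_apply]
      rw [ht, hg]
    · simp only [LinearEquiv.trans_apply]
      rw [hgk, htt, tv_apply]
      simp only [ext_B, ext_q]
      have hcm : c.val = m := rfl
      rcases lt_trichotomy k c with hkc | hkc | hkc
      · have h1 : k.val < m := hkc
        have h2 : k.val < m + 1 := by omega
        simp only [h1, h2, if_true]
        refine Prod.ext ?_ (Prod.ext ?_ ?_)
        · simp [hkc.ne]
        · simp
        · funext i
          by_cases hi : i = c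
          · subst hi
            simp [hkc.ne, hkc.ne', hkc.not_gt]
          · have h3 : (i.val < m + 1) ↔ (i.val < m) := by
              have : i.val ≠ m := fun h => hi (by ext; simp [hc, h])
              omega
            simp [h3, hi, hkc.ne]
      · subst hkc
        have h1 : ¬ c.val < m := by omega
        have h2 : c.val < m + 1 := by omega
        simp only [h1, h2, if_true, if_false]
        refine Prod.ext ?_ (Prod.ext ?_ ?_)
        · simp
        · simp
        · funext i
          by_cases hi : i = c
          · subst hi
            have := E.even (a c)
            simp [hcm, this, q_neg]
            ring
          · have h3 : (i.val < m + 1) ↔ (i.val < m) := by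
              have : i.val ≠ m := fun h => hi (by ext; simp [hc, h])
              omega
            simp [h3, hi]
      · have h1 : ¬ k.val < m := by have : m < k.val := hkc; omega
        have h2 : ¬ k.val < m + 1 := by have : m < k.val := hkc; omega
        simp only [h1, h2, if_false]
        refine Prod.ext ?_ (Prod.ext ?_ ?_)
        · simp [hkc.ne']
        · simp
        · funext i
          by_cases hi : i = c
          · subst hi
            simp [hkc.ne', hkc, hcm, E.symm (a k)]
          · have h3 : (i.val < m + 1) ↔ (i.val < m) := by
              have : i.val ≠ m := fun h => hi (by ext; simp [hc, h])
              omega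
            simp [h3, hi, hkc.ne']

theorem normal {n : ℕ} (a y : Fin n → V)
    (hay : ∀ i j, E.B (a i) (y j) = if i = j then 1 else 0) :
    ∃ g : (V × (Fin n → ℤ) × (Fin n → ℤ)) ≃ₗ[ℤ] (V × (Fin n → ℤ) × (Fin n → ℤ)),
      (E.ext n).IsIsom g ∧
      ∀ k : Fin n, g (a k, 0, 0) = (0, Pi.single k 1,
        fun i => if i < k then E.B (a k) (a i) else if i = k then E.q (a k) else 0) := by
  obtain ⟨g, hg, hgk⟩ := E.normal1 a y hay n le_rfl
  obtain ⟨t, ht, htk⟩ := E.normal2 a n le_rfl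
  refine ⟨g.trans t, fun a b => ?_, fun k => ?_⟩
  · simp only [LinearEquiv.trans_apply]
    rw [ht, hg]
  · simp only [LinearEquiv.trans_apply]
    rw [hgk, if_pos k.isLt, htk, if_pos k.isLt]
    simp

theorem IsIsom.symm' {E : EvLat V} {g : V ≃ₗ[ℤ] V} (hg : E.IsIsom g) : E.IsIsom g.symm := by
  intro x y
  rw [← hg]
  simp

/-- Conjugacy of primitive families, one of which has a hyperbolic plane in its complement. -/
theorem conj {n : ℕ} (a y b z : Fin n → V)
    (hay : ∀ i j, E.B (a i) (y j) = if i = j then 1 else 0)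
    (hbz : ∀ i j, E.B (b i) (z j) = if i = j then 1 else 0)
    (hab : ∀ i j, E.B (a i) (a j) = E.B (b i) (b j))
    (e1 f1 : V) (hbe : ∀ i, E.B (b i) e1 = 0) (hbf : ∀ i, E.B (b i) f1 = 0)
    (hee1 : E.B e1 e1 = 0) (hff1 : E.B f1 f1 = 0) (hef1 : E.B e1 f1 = 1) :
    ∃ g : V ≃ₗ[ℤ] V, E.IsIsom g ∧ ∀ i, g (a i) = b i := by
  obtain ⟨g1, hg1, hg1k⟩ := E.normal a y hay
  obtain ⟨g2, hg2, hg2k⟩ := E.normal b z hbz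
  have hq : ∀ i, E.q (a i) = E.q (b i) := by
    intro i
    have h1 := E.even (a i)
    have h2 := E.even (b i)
    have h3 := hab i i
    omega
  set Φ := g1.trans g2.symm with hΦ
  have hΦi : (E.ext n).IsIsom Φ := by
    intro x y
    simp only [hΦ, LinearEquiv.trans_apply]
    rw [hg2.symm', hg1]
  have hΦk : ∀ k, Φ (a k, 0, 0) = (b k, 0, 0) := by
    intro k
    simp only [hΦ, LinearEquiv.trans_apply]
    rw [LinearEquiv.symm_apply_eq, hg1k, hg2k]
    simp only [hab, hq]
  have hbe' : ∀ i, E.B e1 (b i) = 0 := fun i => by rw [E.symm, hbe]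
  obtain ⟨t, ht, htF, hti⟩ := (E.ext n).key_iter n (fun i => (0, Pi.single i 1, 0))
    (fun i => (0, 0, Pi.single i 1)) (fun i => Φ (0, Pi.single i 1, 0))
    (fun i => Φ (0, 0, Pi.single i 1)) {v | ∃ i, v = (b i, 0, 0)} (e1, 0, 0) (f1, 0, 0)
    (by
      rintro v ⟨i, rfl⟩
      refine ⟨by simp [ext_B, hbe], by simp [ext_B, hbf], fun j => ⟨by simp [ext_B],
        by simp [ext_B], ?_, ?_⟩⟩
      · rw [← hΦk, hΦi]; simp [ext_B]
      · rw [← hΦk, hΦi]; simp [ext_B])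
    (by simp [ext_B, hee1]) (by simp [ext_B, hff1]) (by simp [ext_B, hef1])
    (by simp [ext_B]) (by simp [ext_B]) (by simp [ext_B]) (by simp [ext_B])
    (by simp [ext_B]) (by simp [ext_B])
    (by intro i j; simp [ext_B, Pi.single_apply, eq_comm])
    (by intro i j; rw [hΦi]; simp [ext_B]) (by intro i j; rw [hΦi]; simp [ext_B])
    (by intro i j; rw [hΦi]; simp [ext_B, Pi.single_apply, eq_comm]) n le_rfl
  set Ψ := Φ.trans t with hΨ
  have hΨi : (E.ext n).IsIsom Ψ := by
    intro x y
    simp only [hΨ, LinearEquiv.trans_apply]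
    rw [ht, hΦi]
  have hΨk : ∀ k, Ψ (a k, 0, 0) = (b k, 0, 0) := by
    intro k
    simp only [hΨ, LinearEquiv.trans_apply]
    rw [hΦk, htF _ ⟨k, rfl⟩]
  have hΨe : ∀ i, Ψ (0, Pi.single i 1, 0) = (0, Pi.single i 1, 0) := fun i => (hti i i.isLt).1
  have hΨf : ∀ i, Ψ (0, 0, Pi.single i 1) = (0, 0, Pi.single i 1) := fun i => (hti i i.isLt).2
  have main : ∀ (Θ : (V × (Fin n → ℤ) × (Fin n → ℤ)) ≃ₗ[ℤ] (V × (Fin n → ℤ) × (Fin n → ℤ))),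
      (E.ext n).IsIsom Θ → (∀ i, Θ (0, Pi.single i 1, 0) = (0, Pi.single i 1, 0)) →
      (∀ i, Θ (0, 0, Pi.single i 1) = (0, 0, Pi.single i 1)) →
      ∀ v, Θ (v, 0, 0) = ((Θ (v, 0, 0)).1, 0, 0) := by
    intro Θ hΘ he hf v
    refine Prod.ext rfl (Prod.ext ?_ ?_)
    · funext i
      have := hΘ (v, 0, 0) (0, 0, Pi.single i 1)
      rw [hf] at this
      simpa [ext_B] using this
    · funext i
      have := hΘ (v, 0, 0) (0, Pi.single i 1, 0)
      rw [he] at this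
      simpa [ext_B] using this
  have m1 := main Ψ hΨi hΨe hΨf
  have m2 := main Ψ.symm hΨi.symm' (fun i => by rw [LinearEquiv.symm_apply_eq, hΨe])
    (fun i => by rw [LinearEquiv.symm_apply_eq, hΨf])
  refine ⟨LinearEquiv.ofLinearMap
    (LinearMap.fst ℤ _ _ ∘ₗ Ψ.toLinearMap ∘ₗ LinearMap.inl ℤ _ _)
    (LinearMap.fst ℤ _ _ ∘ₗ Ψ.symm.toLinearMap ∘ₗ LinearMap.inl ℤ _ _) ?_ ?_, ?_, ?_⟩
  · apply LinearMap.ext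
    intro v
    change (Ψ ((Ψ.symm (v, 0, 0)).1, 0, 0)).1 = v
    rw [← m2 v]
    simp
  · apply LinearMap.ext
    intro v
    change (Ψ.symm ((Ψ (v, 0, 0)).1, 0, 0)).1 = v
    rw [← m1 v]
    simp
  · intro v w
    change E.B (Ψ (v, 0, 0)).1 (Ψ (w, 0, 0)).1 = _
    have := hΨi (v, 0, 0) (w, 0, 0)
    rw [m1 v, m1 w] at this
    simpa [ext_B] using this
  · intro i
    change (Ψ (a i, 0, 0)).1 = b i
    rw [hΨk]

end EvLat

/-- Inverse of the Cartan matrix of `E8`. -/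
def invE8 : Fin 8 → Fin 8 → ℤ := ![![4, 7, 10, 8, 6, 4, 2, 5],
  ![7, 14, 20, 16, 12, 8, 4, 10],
  ![10, 20, 30, 24, 18, 12, 6, 15],
  ![8, 16, 24, 20, 15, 10, 5, 12],
  ![6, 12, 18, 15, 12, 8, 4, 9],
  ![4, 8, 12, 10, 8, 6, 3, 6],
  ![2, 4, 6, 5, 4, 3, 2, 3],
  ![5, 10, 15, 12, 9, 6, 3, 8]]

/-- Inverse of the Gram matrix of the K3 lattice. -/
def invK3 : Matrix (Fin 22) (Fin 22) ℤ := Matrix.of fun i j =>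
  if hi : i.val < 8 then
    (if hj : j.val < 8 then -(invE8 ⟨i.val, hi⟩ ⟨j.val, hj⟩) else 0)
  else if hi : i.val < 16 then
    (if hj : 8 ≤ j.val ∧ j.val < 16 then
      -(invE8 ⟨i.val - 8, by omega⟩ ⟨j.val - 8, by omega⟩) else 0)
  else GramK3 i j

/-- Half of the Gram matrix (upper triangular part). -/
def halfK3 : Matrix (Fin 22) (Fin 22) ℤ := Matrix.of fun i j =>
  if i < j then GramK3 i j else if i = j then GramK3 i i / 2 else 0

theorem gram_inv : GramK3 * invK3 = 1 := by decide +kernel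

theorem gram_eq : GramK3 = halfK3 + halfK3ᵀ := by decide +kernel

/-- The K3 lattice. -/
def K3 : EvLat (Fin 22 → ℤ) where
  B := LinearMap.mk₂ ℤ (fun x y => BG GramK3 x y)
    (by intro x y z; simp [BG]) (by intro c x y; simp only [BG, smul_dotProduct])
    (by intro x y z; simp [BG, mulVec_add]) (by
      intro c x y
      simp only [BG, mulVec_smul, dotProduct_smul])
  q := fun x => BG halfK3 x x
  symm := by
    intro x y
    simp only [LinearMap.mk₂_apply, BG]
    have h : GramK3ᵀ = GramK3 := by
      rw [gram_eq, transpose_add, transpose_transpose, add_comm]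
    rw [dotProduct_mulVec, ← mulVec_transpose, h, dotProduct_comm]
  even := by
    intro x
    simp only [LinearMap.mk₂_apply, BG]
    rw [gram_eq, add_mulVec, dotProduct_add, dotProduct_mulVec x halfK3ᵀ, vecMul_transpose,
      dotProduct_comm (halfK3 *ᵥ x)]
    ring

theorem K3_B (x y : Fin 22 → ℤ) : K3.B x y = BG GramK3 x y := rfl

/-- Standard embedding: images of the basis vectors. -/
def stdB (i : Fin 11) : Fin 22 → ℤ := fun k =>
  if i.val = 0 then (if k.val = 16 then 1 else 0)
  else if i.val = 1 then (if k.val = 17 then 1 else 0)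
  else if i.val < 10 then
    (if k.val = i.val - 2 then 1 else if k.val = i.val + 6 then 1 else 0)
  else (if k.val = 18 then 1 else if k.val = 19 then -2 else 0)

/-- Dual vectors of the standard embedding. -/
def stdZ (i : Fin 11) : Fin 22 → ℤ := fun k =>
  if i.val = 0 then (if k.val = 17 then 1 else 0)
  else if i.val = 1 then (if k.val = 16 then 1 else 0)
  else if hi : i.val < 10 then
    (if hk : k.val < 8 then -(invE8 ⟨k.val, hk⟩ ⟨i.val - 2, by omega⟩) else 0)
  else (if k.val = 19 then 1 else 0)

theorem std_dual : ∀ i j, BG GramK3 (stdB i) (stdZ j) = if i = j then 1 else 0 := by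
  decide +kernel

theorem std_gram' : (Matrix.of fun i j => BG GramK3 (stdB i) (stdB j)) = GT := by
  decide +kernel

theorem std_gram (i j : Fin 11) : BG GramK3 (stdB i) (stdB j) = GT i j := by
  rw [← std_gram']
  rfl

theorem std_perp : ∀ i, BG GramK3 (stdB i) (Pi.single 20 1) = 0 ∧
    BG GramK3 (stdB i) (Pi.single 21 1) = 0 := by
  decide +kernel

theorem std_hyp : BG GramK3 (Pi.single 20 1) (Pi.single 20 1) = 0 ∧
    BG GramK3 (Pi.single 21 1) (Pi.single 21 1) = 0 ∧
    BG GramK3 (Pi.single 20 1) (Pi.single 21 1) = 1 := by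
  decide +kernel

theorem exists_dual (ι : (Fin 11 → ℤ) →ₗ[ℤ] (Fin 22 → ℤ)) (h : IsPrimEmb ι) :
    ∃ y : Fin 11 → Fin 22 → ℤ, ∀ i j,
      K3.B (ι (Pi.single i 1)) (y j) = if i = j then 1 else 0 := by
  obtain ⟨hinj, -, hprim⟩ := h
  have htf : Module.IsTorsionFree ℤ ((Fin 22 → ℤ) ⧸ LinearMap.range ι) := by
    rw [Module.isTorsionFree_iff_smul_eq_zero]
    intro k x hx
    obtain ⟨v, rfl⟩ := Submodule.Quotient.mk_surjective _ x
    by_contra hcon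
    push Not at hcon
    apply hcon.2
    rw [Submodule.Quotient.mk_eq_zero]
    apply hprim v k hcon.1
    rw [← Submodule.Quotient.mk_smul, Submodule.Quotient.mk_eq_zero] at hx
    exact hx
  have hfree : Module.Free ℤ ((Fin 22 → ℤ) ⧸ LinearMap.range ι) :=
    Module.free_of_finite_type_torsion_free'
  obtain ⟨s, hs⟩ := Module.projective_lifting_property (LinearMap.range ι).mkQ LinearMap.id
    (Submodule.mkQ_surjective _)
  have hmem : ∀ v, v - s ((LinearMap.range ι).mkQ v) ∈ LinearMap.range ι := by
    intro v
    rw [← Submodule.Quotient.mk_eq_zero, ← Submodule.mkQ_apply, map_sub]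
    have := LinearMap.congr_fun hs ((LinearMap.range ι).mkQ v)
    simp only [LinearMap.comp_apply, LinearMap.id_apply] at this
    rw [this, sub_self]
  let p : (Fin 22 → ℤ) →ₗ[ℤ] (Fin 11 → ℤ) := (LinearEquiv.ofInjective ι hinj).symm.toLinearMap ∘ₗ
    LinearMap.codRestrict (LinearMap.range ι) (LinearMap.id - s ∘ₗ (LinearMap.range ι).mkQ) hmem
  have hp : ∀ t, p (ι t) = t := by
    intro t
    simp only [p, LinearMap.comp_apply, LinearEquiv.coe_coe]
    rw [LinearEquiv.symm_apply_eq]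
    apply Subtype.ext
    have : (LinearMap.range ι).mkQ (ι t) = 0 := by
      rw [← LinearMap.mem_ker, Submodule.ker_mkQ]
      exact ⟨t, rfl⟩
    simp only [LinearMap.codRestrict_apply, LinearMap.sub_apply, LinearMap.id_apply,
      LinearMap.comp_apply, this, map_zero, sub_zero, LinearEquiv.ofInjective_apply]
  refine ⟨fun j => invK3 *ᵥ (fun k => p (Pi.single k 1) j), fun i j => ?_⟩
  rw [K3_B, BG, mulVec_mulVec, gram_inv, one_mulVec]
  have hx : ∀ v : Fin 22 → ℤ, v ⬝ᵥ (fun k => p (Pi.single k 1) j) = p v j := by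
    intro v
    conv_rhs => rw [← Finset.univ_sum_single v]
    rw [map_sum, Finset.sum_apply, dotProduct]
    refine Finset.sum_congr rfl fun k _ => ?_
    have : (Pi.single k (v k) : Fin 22 → ℤ) = v k • Pi.single k 1 := by
      rw [← Pi.single_smul]; simp
    rw [this, map_smul, Pi.smul_apply, smul_eq_mul]
  rw [hx, hp, Pi.single_apply]
  simp [eq_comm]

theorem conj_std (ι : (Fin 11 → ℤ) →ₗ[ℤ] (Fin 22 → ℤ)) (h : IsPrimEmb ι) :
    ∃ g : (Fin 22 → ℤ) ≃ₗ[ℤ] (Fin 22 → ℤ), K3.IsIsom g ∧ ∀ i, g (ι (Pi.single i 1)) = stdB i := by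
  obtain ⟨y, hy⟩ := exists_dual ι h
  refine K3.conj (fun i => ι (Pi.single i 1)) y stdB stdZ hy std_dual (fun i j => ?_)
    (Pi.single 20 1) (Pi.single 21 1) (fun i => (std_perp i).1) (fun i => (std_perp i).2)
    std_hyp.1 std_hyp.2.1 std_hyp.2.2
  rw [K3_B, K3_B, h.2.1, std_gram, BG]
  simp

/-- Any two primitive embeddings of `T = U ⊕ E8(2) ⊕ [−4]` into the K3 lattice
`L = 2E8 ⊕ 3U` are conjugate by an isometry of `L`. -/
theorem primEmb_unique_up_to_isometry
    (ι₁ ι₂ : (Fin 11 → ℤ) →ₗ[ℤ] (Fin 22 → ℤ))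
    (h₁ : IsPrimEmb ι₁) (h₂ : IsPrimEmb ι₂) :
    ∃ φ : (Fin 22 → ℤ) ≃ₗ[ℤ] (Fin 22 → ℤ),
      (∀ x y : Fin 22 → ℤ, BG GramK3 (φ x) (φ y) = BG GramK3 x y) ∧
      ∀ x : Fin 11 → ℤ, φ (ι₁ x) = ι₂ x := by
  obtain ⟨g₁, hg₁, e₁⟩ := conj_std ι₁ h₁
  obtain ⟨g₂, hg₂, e₂⟩ := conj_std ι₂ h₂
  refine ⟨g₁.trans g₂.symm, fun x y => ?_, fun x => ?_⟩
  · simp only [LinearEquiv.trans_apply]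
    exact (hg₂.symm' _ _).trans (hg₁ x y)
  · have : (g₁.trans g₂.symm).toLinearMap ∘ₗ ι₁ = ι₂ := by
      refine LinearMap.pi_ext' fun i => LinearMap.ext_ring ?_
      simp only [LinearMap.comp_apply, LinearMap.single_apply, LinearEquiv.coe_coe,
        LinearEquiv.trans_apply]
      rw [LinearEquiv.symm_apply_eq, e₁, e₂]
    exact LinearMap.congr_fun this x
end
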